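/- Let a be a natural number and let s be a real number with 0 ≤ s < a. There exists a minimal closed subset X of the full shift (([0,1]^a)^ℤ, σ) satisfying: (1) mdim(X, σ) = s and the upper and lower metric mean dimensions of (X, σ, D) coincide and equal s; and (2) for every natural number b and every equivariant continuous map π : (X, σ) → (([0,1]^b)^ℤ, σ), the lower conditional metric mean dimension satisfies lower-mdim_M(π, σ, D) ≥ s − b. Here D is the metric D((x_n), (y_n)) = Σ_{n∈ℤ} 2^{-|n|} ‖x_n − y_n‖_∞. -/

import Mathlib

open Filter Topology
open scoped ENNReal NNReal

noncomputable section

/-- Diameter (in `ℝ≥0∞`) of a set with respect to a distance function `ρ`. -/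
def setEDiam {X : Type*} (ρ : X → X → ℝ) (E : Set X) : ℝ≥0∞ :=
  ⨆ x ∈ E, ⨆ y ∈ E, ENNReal.ofReal (ρ x y)

/-- Openness with respect to a distance function `ρ`. -/
def ROpen {X : Type*} (ρ : X → X → ℝ) (U : Set X) : Prop :=
  ∀ x ∈ U, ∃ δ > 0, ∀ y, ρ x y < δ → y ∈ U

/-- `#(E, ρ, ε)`: the minimal number `n` of `ρ`-open sets of `ρ`-diameter `< ε` covering `E`
(`0` when `E = ∅`, since the empty family covers it). -/
def covNum {X : Type*} (ρ : X → X → ℝ) (ε : ℝ) (E : Set X) : ℕ :=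
  sInf {n : ℕ | ∃ U : Fin n → Set X, (∀ i, ROpen ρ (U i)) ∧
    (∀ i, setEDiam ρ (U i) < ENNReal.ofReal ε) ∧ E ⊆ ⋃ i, U i}

/-- The dynamical metric `d_N(x,y) = max_{0 ≤ n < N} d(Tⁿx, Tⁿy)`. -/
def dynDist {X : Type*} (T : X → X) (d : X → X → ℝ) (N : ℕ) (x y : X) : ℝ :=
  sSup {r : ℝ | ∃ n, n < N ∧ r = d (T^[n] x) (T^[n] y)}

/-- `sup_{y ∈ Y} log #(π⁻¹(y), ρ, ε)`. -/
def supLogCov {X Y : Type*} (π : X → Y) (ρ : X → X → ℝ) (ε : ℝ) : ℝ :=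
  ⨆ y : Y, Real.log (covNum ρ ε (π ⁻¹' {y}) : ℝ)

/-- `sup_{y ∈ Y} log #(π⁻¹(B_δ(y, ρY)), ρX, ε)` where `B_δ` is the closed `δ`-ball. -/
def supLogCovBall {X Y : Type*} (π : X → Y) (ρX : X → X → ℝ) (ρY : Y → Y → ℝ)
    (ε δ : ℝ) : ℝ :=
  ⨆ y : Y, Real.log (covNum ρX ε (π ⁻¹' {x | ρY x y ≤ δ}) : ℝ)

/-- Topological conditional entropy
`h_top(π, T) = lim_{ε→0} lim_{N→∞} (sup_y log #(π⁻¹(y), d_N, ε))/N`, as an extended real. -/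
def condEntropy {X Y : Type*} (π : X → Y) (T : X → X) (d : X → X → ℝ) : EReal :=
  Filter.limsup (fun ε : ℝ => Filter.liminf
      (fun N : ℕ => ((supLogCov π (dynDist T d N) ε / N : ℝ) : EReal)) Filter.atTop)
    (𝓝[>] (0 : ℝ))

/-- `lim_{N→∞} (sup_y log #(π⁻¹(y), d_N, ε))/(N log(1/ε))` (the limit exists by
subadditivity; it is realized here as a liminf). -/
def condMdimRate {X Y : Type*} (π : X → Y) (T : X → X) (d : X → X → ℝ) (ε : ℝ) : EReal :=
  Filter.liminf (fun N : ℕ =>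
    ((supLogCov π (dynDist T d N) ε / (N * Real.log (1 / ε)) : ℝ) : EReal)) Filter.atTop

/-- Lower conditional metric mean dimension of `π : (X,T,d) → Y`. -/
def lowerCondMdimM {X Y : Type*} (π : X → Y) (T : X → X) (d : X → X → ℝ) : EReal :=
  Filter.liminf (fun ε : ℝ => condMdimRate π T d ε) (𝓝[>] (0 : ℝ))

/-- Upper conditional metric mean dimension of `π : (X,T,d) → Y`. -/
def upperCondMdimM {X Y : Type*} (π : X → Y) (T : X → X) (d : X → X → ℝ) : EReal :=
  Filter.limsup (fun ε : ℝ => condMdimRate π T d ε) (𝓝[>] (0 : ℝ))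

/-- `lim_{N→∞} log #(X, d_N, ε)/(N log(1/ε))`. -/
def mdimMRate {X : Type*} (T : X → X) (d : X → X → ℝ) (ε : ℝ) : EReal :=
  Filter.liminf (fun N : ℕ =>
    ((Real.log (covNum (dynDist T d N) ε (Set.univ : Set X) : ℝ) /
      (N * Real.log (1 / ε)) : ℝ) : EReal)) Filter.atTop

/-- Lower metric mean dimension of `(X, T, d)`. -/
def lowerMdimM {X : Type*} (T : X → X) (d : X → X → ℝ) : EReal :=
  Filter.liminf (fun ε : ℝ => mdimMRate T d ε) (𝓝[>] (0 : ℝ))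

/-- Upper metric mean dimension of `(X, T, d)`. -/
def upperMdimM {X : Type*} (T : X → X) (d : X → X → ℝ) : EReal :=
  Filter.limsup (fun ε : ℝ => mdimMRate T d ε) (𝓝[>] (0 : ℝ))

/-- `widim_ε(X, ρ)`: the minimal `k` such that there are a finite simplicial complex of
dimension `≤ k` (realized in some `ℝ^m`) and a continuous `ε`-embedding `f : X → P`
(all fibers of `f` have `ρ`-diameter `< ε`). -/
def widim (X : Type*) [TopologicalSpace X] (ρ : X → X → ℝ) (ε : ℝ) : ℕ :=
  sInf {k : ℕ | ∃ (m : ℕ) (K : Geometry.SimplicialComplex ℝ (Fin m → ℝ)),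
    K.faces.Finite ∧ (∀ s ∈ K.faces, s.card ≤ k + 1) ∧
    ∃ f : X → K.space, Continuous f ∧
      ∀ p : K.space, setEDiam ρ (f ⁻¹' {p}) < ENNReal.ofReal ε}

/-- Mean dimension `mdim(X, T) = lim_{ε→0} lim_{N→∞} widim_ε(X, d_N)/N`. -/
def mdim (X : Type*) [TopologicalSpace X] (T : X → X) (d : X → X → ℝ) : EReal :=
  Filter.limsup (fun ε : ℝ => Filter.liminf
      (fun N : ℕ => (((widim X (dynDist T d N) ε : ℝ) / N : ℝ) : EReal)) Filter.atTop)
    (𝓝[>] (0 : ℝ))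

/-- The cube `[0,1]^a`. -/
abbrev Cube (a : ℕ) := Fin a → unitInterval

/-- The full shift space `([0,1]^a)^ℤ`. -/
abbrev FullShift (a : ℕ) := ℤ → Cube a

/-- The shift map `σ((x_n)_n) = (x_{n+1})_n`. -/
def shift {α : Type*} (x : ℤ → α) : ℤ → α := fun n => x (n + 1)

/-- The `ℓ^∞`-distance on the cube `[0,1]^a`. -/
def cubeDist {a : ℕ} (x y : Cube a) : ℝ :=
  ‖(fun i => (x i : ℝ)) - fun i => (y i : ℝ)‖

/-- The metric `D((x_n), (y_n)) = Σ_{n∈ℤ} 2^{-|n|} ‖x_n − y_n‖_∞` on the full shift. -/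
def shiftDist {a : ℕ} (x y : FullShift a) : ℝ :=
  ∑' n : ℤ, (2 : ℝ) ^ (-|n|) * cubeDist (x n) (y n)

end

noncomputable section

/-! ### Chains modulo two on finite lists -/

/-- Formal sums modulo two. -/
abbrev Sum2 (α : Type*) := α →₀ ZMod 2

/-- Chains modulo two whose simplices are lists of vertices. -/
abbrev Chain (V : Type*) := Sum2 (List V)

/-- A basis element. -/
abbrev gen {α : Type*} (a : α) : Sum2 α := Finsupp.single a 1

/-- Linear extension of a map defined on basis elements. -/
abbrev lext {α M : Type*} [AddCommGroup M] [Module (ZMod 2) M] (f : α → M) :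
    Sum2 α →ₗ[ZMod 2] M := Finsupp.linearCombination (ZMod 2) f

/-- Bilinear extension of a map defined on pairs of basis elements. -/
abbrev lext₂ {α β M : Type*} [AddCommGroup M] [Module (ZMod 2) M] (f : α → β → M) :
    Sum2 α →ₗ[ZMod 2] Sum2 β →ₗ[ZMod 2] M := lext fun a => lext (f a)

/-- Formal sums supported on the elements satisfying `P`. -/
abbrev SuppOn {α : Type*} (P : α → Prop) : Submodule (ZMod 2) (Sum2 α) :=
  Finsupp.supported (ZMod 2) (ZMod 2) {a | P a}

section Basic

variable {α β γ M N : Type*} [AddCommGroup M] [Module (ZMod 2) M] [AddCommGroup N]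
  [Module (ZMod 2) N]

theorem add_self_two (x : M) : x + x = 0 := by
  have : (2 : ZMod 2) • x = x + x := two_smul _ x
  rw [← this, show (2 : ZMod 2) = 0 from rfl, zero_smul]

@[simp] theorem lext_gen (f : α → M) (a : α) : lext f (gen a) = f a := by simp

theorem lhom_ext {f g : Sum2 α →ₗ[ZMod 2] M} (h : ∀ a, f (gen a) = g (gen a)) : f = g :=
  Finsupp.lhom_ext' fun a => LinearMap.ext_ring (h a)

theorem gen_mem {P : α → Prop} {a : α} (h : P a) : gen a ∈ SuppOn P :=
  Finsupp.single_mem_supported _ _ h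

theorem suppOn_mono {P Q : α → Prop} (h : ∀ a, P a → Q a) {c : Sum2 α} (hc : c ∈ SuppOn P) :
    c ∈ SuppOn Q :=
  Finsupp.supported_mono (fun a ha => h a ha) hc

theorem suppOn_mem {P : α → Prop} {c : Sum2 α} (hc : c ∈ SuppOn P) {a : α} (ha : c a ≠ 0) : P a :=
  hc (Finsupp.mem_support_iff.2 ha)

theorem map_mem_of_suppOn {P : α → Prop} {S : Submodule (ZMod 2) M} (f : Sum2 α →ₗ[ZMod 2] M)
    (h : ∀ a, P a → f (gen a) ∈ S) {c : Sum2 α} (hc : c ∈ SuppOn P) : f c ∈ S := by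
  have : f = lext fun a => f (gen a) := lhom_ext fun a => by simp
  rw [this, Finsupp.linearCombination_apply]
  exact S.sum_mem fun a ha => S.smul_mem _ (h a (hc ha))

theorem eqOn_of_suppOn {P : α → Prop} (f g : Sum2 α →ₗ[ZMod 2] M)
    (h : ∀ a, P a → f (gen a) = g (gen a)) {c : Sum2 α} (hc : c ∈ SuppOn P) : f c = g c := by
  have := map_mem_of_suppOn (S := ⊥) (f - g) (fun a ha => by simp [h a ha]) hc
  simpa [sub_eq_zero] using this

theorem suppOn_true (c : Sum2 α) : c ∈ SuppOn fun _ : α => True := fun _ _ => trivial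

/-- The push-forward of formal sums. -/
abbrev push (φ : α → β) : Sum2 α →ₗ[ZMod 2] Sum2 β := lext fun a => gen (φ a)

theorem push_comp (φ : α → β) (ψ : β → γ) (c : Sum2 α) : push ψ (push φ c) = push (ψ ∘ φ) c :=
  LinearMap.congr_fun (f := push ψ ∘ₗ push φ) (g := push (ψ ∘ φ)) (lhom_ext fun a => by simp) c

theorem push_id (c : Sum2 α) : push (fun a : α => a) c = c :=
  LinearMap.congr_fun (g := LinearMap.id) (lhom_ext fun a => by simp) c

end Basic

section Boundary

variable {V W : Type*}

/-- The cone with apex `v`. -/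
abbrev cone (v : V) : Chain V →ₗ[ZMod 2] Chain V := push fun l => v :: l

/-- The augmented boundary of a list. -/
def bdList : List V → Chain V
  | [] => 0
  | v :: l => gen l + cone v (bdList l)

/-- The augmented boundary. -/
def bd : Chain V →ₗ[ZMod 2] Chain V := lext bdList

@[simp] theorem bd_nil : bd (gen ([] : List V)) = 0 := by simp [bd, bdList]

@[simp] theorem bd_cons (v : V) (l : List V) :
    bd (gen (v :: l)) = gen l + cone v (bd (gen l)) := by simp [bd, bdList]

theorem bd_cone (v : V) (c : Chain V) : bd (cone v c) = c + cone v (bd c) :=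
  LinearMap.congr_fun (f := bd ∘ₗ cone v) (g := LinearMap.id + cone v ∘ₗ bd)
    (lhom_ext fun a => by simp) c

theorem bd_bd (c : Chain V) : bd (bd c) = 0 := by
  refine LinearMap.congr_fun (f := bd ∘ₗ bd) (g := 0) (lhom_ext fun l => ?_) c
  induction l with
  | nil => simp
  | cons v l ih =>
    simp only [LinearMap.comp_apply, LinearMap.zero_apply] at ih ⊢
    rw [bd_cons, map_add, bd_cone, ih, map_zero, add_zero, add_self_two]

/-- The push-forward of chains along a map of vertices. -/
abbrev chainMap (φ : V → W) : Chain V →ₗ[ZMod 2] Chain W := push (List.map φ)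

theorem chainMap_cone (φ : V → W) (v : V) (c : Chain V) :
    chainMap φ (cone v c) = cone (φ v) (chainMap φ c) := by
  rw [push_comp, push_comp]; rfl

theorem chainMap_nil (φ : V → W) : chainMap φ (gen []) = gen [] := by simp

theorem bd_chainMap (φ : V → W) (c : Chain V) : bd (chainMap φ c) = chainMap φ (bd c) := by
  refine LinearMap.congr_fun (f := bd ∘ₗ chainMap φ) (g := chainMap φ ∘ₗ bd)
    (lhom_ext fun l => ?_) c
  induction l with
  | nil => simp
  | cons v l ih =>
    simp only [LinearMap.comp_apply, lext_gen] at ih ⊢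
    rw [List.map_cons, bd_cons, bd_cons, ih, map_add, lext_gen, chainMap_cone]

/-- The coefficient of the empty list. -/
abbrev nilCoeff : Chain V →ₗ[ZMod 2] ZMod 2 := Finsupp.lapply []

/-- The non-augmented boundary. -/
def del : Chain V →ₗ[ZMod 2] Chain V :=
  bd + (LinearMap.toSpanSingleton (ZMod 2) (Chain V) (gen [])) ∘ₗ nilCoeff ∘ₗ bd

theorem del_apply (c : Chain V) : del c = bd c + nilCoeff (bd c) • gen [] := by
  simp [del]

theorem bd_eq (c : Chain V) : bd c = del c + nilCoeff (bd c) • gen [] := by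
  rw [del_apply, add_assoc, add_self_two, add_zero]

theorem nilCoeff_del (c : Chain V) : nilCoeff (del c) = 0 := by
  rw [del_apply, map_add, map_smul]
  simp [CharTwo.add_self_eq_zero]

theorem del_del (c : Chain V) : del (del c) = 0 := by
  have h : bd (del c) = 0 := by rw [del_apply, map_add, bd_bd, map_smul, bd_nil]; simp
  rw [del_apply, h]; simp

theorem nilCoeff_cone (v : V) (c : Chain V) : nilCoeff (cone v c) = 0 :=
  LinearMap.congr_fun (f := nilCoeff ∘ₗ cone v) (g := 0) (lhom_ext fun l => by simp) c

theorem nilCoeff_chainMap (φ : V → W) (c : Chain V) : nilCoeff (chainMap φ c) = nilCoeff c := by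
  refine LinearMap.congr_fun (f := nilCoeff ∘ₗ chainMap φ) (g := nilCoeff)
    (lhom_ext fun l => ?_) c
  cases l <;> simp

theorem del_chainMap (φ : V → W) (c : Chain V) : del (chainMap φ c) = chainMap φ (del c) := by
  rw [del_apply, del_apply, bd_chainMap, nilCoeff_chainMap, map_add, map_smul, lext_gen]; rfl

theorem del_cons_cons (v w : V) (l : List V) :
    del (gen (v :: w :: l)) = gen (w :: l) + cone v (bd (gen (w :: l))) := by
  rw [del_apply, bd_cons, map_add, nilCoeff_cone]; simp

theorem del_singleton (v : V) : del (gen [v]) = 0 := by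
  rw [del_apply]; simp [add_self_two]

theorem del_nil : del (gen ([] : List V)) = 0 := by
  rw [del_apply]; simp

theorem bd_length {n : ℕ} {c : Chain V} (hc : c ∈ SuppOn fun l => l.length = n + 1) :
    bd c ∈ SuppOn fun l : List V => l.length = n := by
  refine map_mem_of_suppOn bd (fun l hl => ?_) hc
  clear hc c
  induction l generalizing n with
  | nil => simp at hl
  | cons v l ih =>
    rw [bd_cons]
    refine Submodule.add_mem _ (gen_mem (by simpa using hl)) ?_
    cases l with
    | nil => simp
    | cons w l =>
      obtain ⟨k, rfl⟩ : ∃ k, n = k + 1 := ⟨l.length, by simpa using hl.symm⟩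
      refine map_mem_of_suppOn (P := fun l => l.length = k) (cone v)
        (fun m hm => ?_) (ih (by simpa using hl))
      rw [lext_gen]
      exact gen_mem (by simp [hm])

end Boundary

/-! ### Pairs of chains, Steenrod diagonals and shuffles -/

section Pairs

variable {V W V' W' : Type*}

/-- The tensor product of chains. -/
abbrev tens : Chain V →ₗ[ZMod 2] Chain W →ₗ[ZMod 2] Sum2 (List V × List W) :=
  lext₂ fun l m => gen (l, m)

/-- The tensor product of linear maps of chains. -/
abbrev tensMap (f : Chain V →ₗ[ZMod 2] Chain V') (g : Chain W →ₗ[ZMod 2] Chain W') :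
    Sum2 (List V × List W) →ₗ[ZMod 2] Sum2 (List V' × List W') :=
  lext fun p => tens (f (gen p.1)) (g (gen p.2))

theorem lhom_ext₂ {α β M : Type*} [AddCommGroup M] [Module (ZMod 2) M]
    {f g : Sum2 α →ₗ[ZMod 2] Sum2 β →ₗ[ZMod 2] M}
    (h : ∀ a b, f (gen a) (gen b) = g (gen a) (gen b)) : f = g :=
  lhom_ext fun a => lhom_ext fun b => h a b

theorem tens_gen (l : List V) (m : List W) : tens (gen l) (gen m) = gen (l, m) := by simp

theorem tensMap_tens (f : Chain V →ₗ[ZMod 2] Chain V') (g : Chain W →ₗ[ZMod 2] Chain W')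
    (x : Chain V) (y : Chain W) : tensMap f g (tens x y) = tens (f x) (g y) := by
  refine LinearMap.congr_fun (LinearMap.congr_fun
    (f := tens.compr₂ (tensMap f g)) (g := tens.compl₁₂ f g) (lhom_ext₂ fun a b => ?_) x) y
  simp

/-- The boundary of the tensor product. -/
def bdPair : Sum2 (List V × List W) →ₗ[ZMod 2] Sum2 (List V × List W) :=
  tensMap bd LinearMap.id + tensMap LinearMap.id bd

theorem bdPair_tens (x : Chain V) (y : Chain W) :
    bdPair (tens x y) = tens (bd x) y + tens x (bd y) := by
  simp only [bdPair, LinearMap.add_apply, tensMap_tens, LinearMap.id_apply]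

theorem tensMap_bdPair {f : Chain V →ₗ[ZMod 2] Chain V'} {g : Chain W →ₗ[ZMod 2] Chain W'}
    (hf : ∀ x, bd (f x) = f (bd x)) (hg : ∀ x, bd (g x) = g (bd x))
    (c : Sum2 (List V × List W)) : bdPair (tensMap f g c) = tensMap f g (bdPair c) := by
  refine LinearMap.congr_fun (f := bdPair ∘ₗ tensMap f g) (g := tensMap f g ∘ₗ bdPair)
    (lhom_ext fun p => ?_) c
  rw [LinearMap.comp_apply, LinearMap.comp_apply, ← tens_gen, bdPair_tens, tensMap_tens,
    bdPair_tens, map_add, tensMap_tens, tensMap_tens, hf, hg]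

/-- The swap of the two factors. -/
abbrev swapPair : Sum2 (List V × List W) →ₗ[ZMod 2] Sum2 (List W × List V) := push Prod.swap

theorem swapPair_tens (x : Chain V) (y : Chain W) : swapPair (tens x y) = tens y x :=
  LinearMap.congr_fun (LinearMap.congr_fun
    (f := tens.compr₂ swapPair) (g := tens.flip) (lhom_ext₂ fun a b => by simp) x) y

theorem tensMap_swapPair (f : Chain V →ₗ[ZMod 2] Chain V') (g : Chain W →ₗ[ZMod 2] Chain W')
    (c : Sum2 (List W × List V)) :
    tensMap f g (swapPair c) = swapPair (tensMap g f c) := by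
  refine LinearMap.congr_fun (f := tensMap f g ∘ₗ swapPair) (g := swapPair ∘ₗ tensMap g f)
    (lhom_ext fun p => ?_) c
  rw [LinearMap.comp_apply, LinearMap.comp_apply, ← tens_gen, tensMap_tens, swapPair_tens,
    swapPair_tens, tensMap_tens]

theorem bdPair_swapPair (c : Sum2 (List V × List W)) :
    bdPair (swapPair c) = swapPair (bdPair c) := by
  refine LinearMap.congr_fun (f := bdPair ∘ₗ swapPair) (g := swapPair ∘ₗ bdPair)
    (lhom_ext fun p => ?_) c
  rw [LinearMap.comp_apply, LinearMap.comp_apply, ← tens_gen, swapPair_tens, bdPair_tens,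
    bdPair_tens, map_add, swapPair_tens, swapPair_tens, add_comm]

theorem tensMap_comp {V'' W'' : Type*} (f : Chain V →ₗ[ZMod 2] Chain V')
    (g : Chain W →ₗ[ZMod 2] Chain W') (f' : Chain V' →ₗ[ZMod 2] Chain V'')
    (g' : Chain W' →ₗ[ZMod 2] Chain W'') (c : Sum2 (List V × List W)) :
    tensMap f' g' (tensMap f g c) = tensMap (f' ∘ₗ f) (g' ∘ₗ g) c := by
  refine LinearMap.congr_fun (f := tensMap f' g' ∘ₗ tensMap f g)
    (g := tensMap (f' ∘ₗ f) (g' ∘ₗ g)) (lhom_ext fun p => ?_) c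
  rw [LinearMap.comp_apply, ← tens_gen, tensMap_tens, tensMap_tens, tensMap_tens]; rfl

/-- The cone on the left factor. -/
abbrev coneL (v : V) : Sum2 (List V × List W) →ₗ[ZMod 2] Sum2 (List V × List W) :=
  push fun p => (v :: p.1, p.2)

/-- The cone on the right factor. -/
abbrev coneR (w : W) : Sum2 (List V × List W) →ₗ[ZMod 2] Sum2 (List V × List W) :=
  push fun p => (p.1, w :: p.2)

theorem coneL_tens (v : V) (x : Chain V) (y : Chain W) :
    coneL v (tens x y) = tens (cone v x) y :=
  LinearMap.congr_fun (LinearMap.congr_fun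
    (f := tens.compr₂ (coneL v)) (g := tens.compl₁₂ (cone v) LinearMap.id)
    (lhom_ext₂ fun a b => by simp) x) y

theorem coneR_tens (w : W) (x : Chain V) (y : Chain W) :
    coneR w (tens x y) = tens x (cone w y) :=
  LinearMap.congr_fun (LinearMap.congr_fun
    (f := tens.compr₂ (coneR w)) (g := tens.compl₁₂ LinearMap.id (cone w))
    (lhom_ext₂ fun a b => by simp) x) y

theorem bdPair_coneL (v : V) (c : Sum2 (List V × List W)) :
    bdPair (coneL v c) = c + coneL v (bdPair c) := by
  refine LinearMap.congr_fun (f := bdPair ∘ₗ coneL v) (g := LinearMap.id + coneL v ∘ₗ bdPair)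
    (lhom_ext fun p => ?_) c
  simp only [LinearMap.comp_apply, LinearMap.add_apply, LinearMap.id_apply]
  rw [← tens_gen, coneL_tens, bdPair_tens, bdPair_tens, map_add, coneL_tens, coneL_tens, bd_cone,
    map_add, LinearMap.add_apply]
  abel

theorem bdPair_coneR (w : W) (c : Sum2 (List V × List W)) :
    bdPair (coneR w c) = c + coneR w (bdPair c) := by
  refine LinearMap.congr_fun (f := bdPair ∘ₗ coneR w) (g := LinearMap.id + coneR w ∘ₗ bdPair)
    (lhom_ext fun p => ?_) c
  simp only [LinearMap.comp_apply, LinearMap.add_apply, LinearMap.id_apply]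
  rw [← tens_gen, coneR_tens, bdPair_tens, bdPair_tens, map_add, coneR_tens, coneR_tens, bd_cone,
    map_add]
  abel

theorem swapPair_coneL (v : V) (c : Sum2 (List V × List W)) :
    swapPair (coneL v c) = coneR v (swapPair c) := by
  rw [push_comp, push_comp]; rfl

theorem swapPair_coneR (w : W) (c : Sum2 (List V × List W)) :
    swapPair (coneR w c) = coneL w (swapPair c) := by
  rw [push_comp, push_comp]; rfl

theorem coneL_coneR (v : V) (w : W) (c : Sum2 (List V × List W)) :
    coneL v (coneR w c) = coneR w (coneL v c) := by
  rw [push_comp, push_comp]; rfl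

theorem swapPair_swapPair (c : Sum2 (List V × List W)) : swapPair (swapPair c) = c := by
  rw [push_comp]; exact push_id c

end Pairs

section Diagonals

variable {V W : Type*}

/-- The Steenrod diagonals of a list; the index is shifted so that the first one with
a geometric meaning (the Alexander–Whitney diagonal) has index one. -/
def diagList : ℕ → List V → Sum2 (List V × List V)
  | 0, [] => gen ([], [])
  | _ + 1, [] => 0
  | 0, x :: l => coneL x (diagList 0 l)
  | i + 1, x :: l => coneL x (diagList (i + 1) l) + coneL x (coneR x (swapPair (diagList i l)))

/-- The Steenrod diagonals. -/
def diag (i : ℕ) : Chain V →ₗ[ZMod 2] Sum2 (List V × List V) := lext (diagList i)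

theorem diag_zero_nil : diag 0 (gen ([] : List V)) = gen ([], []) := by simp [diag, diagList]

theorem diag_succ_nil (i : ℕ) : diag (i + 1) (gen ([] : List V)) = 0 := by simp [diag, diagList]

theorem diag_zero_cone (x : V) (c : Chain V) : diag 0 (cone x c) = coneL x (diag 0 c) :=
  LinearMap.congr_fun (f := diag 0 ∘ₗ cone x) (g := coneL x ∘ₗ diag 0)
    (lhom_ext fun l => by simp only [LinearMap.comp_apply, lext_gen, diag, diagList]) c

theorem diag_succ_cone (i : ℕ) (x : V) (c : Chain V) : diag (i + 1) (cone x c) =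
    coneL x (diag (i + 1) c) + coneL x (coneR x (swapPair (diag i c))) :=
  LinearMap.congr_fun (f := diag (i + 1) ∘ₗ cone x)
    (g := coneL x ∘ₗ diag (i + 1) + coneL x ∘ₗ coneR x ∘ₗ swapPair ∘ₗ diag i)
    (lhom_ext fun l => by
      simp only [LinearMap.comp_apply, LinearMap.add_apply, lext_gen, diag, diagList]) c

theorem cone_gen (x : V) (l : List V) : cone x (gen l) = gen (x :: l) := by simp

theorem bd_diag_zero (c : Chain V) : bdPair (diag 0 c) = diag 0 (bd c) := by
  refine LinearMap.congr_fun (f := bdPair ∘ₗ diag 0) (g := diag 0 ∘ₗ bd)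
    (lhom_ext fun l => ?_) c
  induction l with
  | nil =>
    simp only [LinearMap.comp_apply, diag_zero_nil, bd_nil, map_zero]
    rw [← tens_gen, bdPair_tens]; simp
  | cons x l ih =>
    simp only [LinearMap.comp_apply] at ih ⊢
    rw [← cone_gen, diag_zero_cone, bdPair_coneL, ih, bd_cone, map_add, diag_zero_cone]

theorem bd_diag_succ (i : ℕ) (c : Chain V) :
    bdPair (diag (i + 1) c) = diag (i + 1) (bd c) + diag i c + swapPair (diag i c) := by
  refine LinearMap.congr_fun (f := bdPair ∘ₗ diag (i + 1))
    (g := diag (i + 1) ∘ₗ bd + diag i + swapPair ∘ₗ diag i) (lhom_ext fun l => ?_) c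
  induction l generalizing i with
  | nil =>
    simp only [LinearMap.comp_apply, LinearMap.add_apply, diag_succ_nil, bd_nil, map_zero]
    cases i with
    | zero => rw [diag_zero_nil, lext_gen, Prod.swap_prod_mk, zero_add, add_self_two]
    | succ i => rw [diag_succ_nil, map_zero]; simp
  | cons x l ih =>
    simp only [LinearMap.comp_apply, LinearMap.add_apply] at ih ⊢
    rw [bd_cons, map_add, ← cone_gen, diag_succ_cone, diag_succ_cone, map_add, bdPair_coneL, ih,
      bdPair_coneL, bdPair_coneR, bdPair_swapPair]
    cases i with
    | zero =>
      rw [bd_diag_zero, diag_zero_cone]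
      simp only [map_add, swapPair_coneL]
      linear_combination (norm := module)
        add_self_two (coneL x (swapPair (diag 0 (gen l))))
    | succ i =>
      rw [ih i, diag_succ_cone]
      simp only [map_add, swapPair_coneL, swapPair_coneR, swapPair_swapPair, ← coneL_coneR]
      linear_combination (norm := module)
        add_self_two (coneL x (swapPair (diag (i + 1) (gen l))))

theorem diag_chainMap (i : ℕ) (φ : V → W) (c : Chain V) :
    diag i (chainMap φ c) = tensMap (chainMap φ) (chainMap φ) (diag i c) := by
  refine LinearMap.congr_fun (f := diag i ∘ₗ chainMap φ)
    (g := tensMap (chainMap φ) (chainMap φ) ∘ₗ diag i) (lhom_ext fun l => ?_) c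
  have hL : ∀ (x : V) (c : Sum2 (List V × List V)),
      tensMap (chainMap φ) (chainMap φ) (coneL x c) =
        coneL (φ x) (tensMap (chainMap φ) (chainMap φ) c) := fun x c =>
    LinearMap.congr_fun (f := tensMap (chainMap φ) (chainMap φ) ∘ₗ coneL x)
      (g := coneL (φ x) ∘ₗ tensMap (chainMap φ) (chainMap φ))
      (lhom_ext fun p => by simp) c
  have hR : ∀ (x : V) (c : Sum2 (List V × List V)),
      tensMap (chainMap φ) (chainMap φ) (coneR x c) =
        coneR (φ x) (tensMap (chainMap φ) (chainMap φ) c) := fun x c =>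
    LinearMap.congr_fun (f := tensMap (chainMap φ) (chainMap φ) ∘ₗ coneR x)
      (g := coneR (φ x) ∘ₗ tensMap (chainMap φ) (chainMap φ))
      (lhom_ext fun p => by simp) c
  induction l generalizing i with
  | nil =>
    simp only [LinearMap.comp_apply, lext_gen, List.map_nil]
    cases i with
    | zero => simp [diag_zero_nil]
    | succ i => simp [diag_succ_nil]
  | cons x l ih =>
    simp only [LinearMap.comp_apply] at ih ⊢
    rw [← cone_gen, chainMap_cone]
    cases i with
    | zero => rw [diag_zero_cone, diag_zero_cone, ih, hL]
    | succ i =>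
      rw [diag_succ_cone, diag_succ_cone, map_add, ih, ih, hL, hL, hR, tensMap_swapPair]

/-- Supports of the Steenrod diagonals: total length and membership. -/
theorem diag_mem (i : ℕ) (l : List V) : diag i (gen l) ∈
    SuppOn fun p : List V × List V => p.1.length + p.2.length = l.length + i ∧
      (∀ x ∈ p.1, x ∈ l) ∧ ∀ x ∈ p.2, x ∈ l := by
  induction l generalizing i with
  | nil =>
    cases i with
    | zero => rw [diag_zero_nil]; exact gen_mem (by simp)
    | succ i => rw [diag_succ_nil]; exact Submodule.zero_mem _
  | cons x l ih =>
    rw [← cone_gen]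
    have h1 : ∀ i, coneL x (diag i (gen l)) ∈
        SuppOn fun p : List V × List V => p.1.length + p.2.length = (x :: l).length + i ∧
      (∀ y ∈ p.1, y ∈ x :: l) ∧ ∀ y ∈ p.2, y ∈ x :: l := fun i =>
      map_mem_of_suppOn _ (fun p hp => by
        rw [lext_gen]
        refine gen_mem ⟨by simp only [List.length_cons]; omega, ?_, ?_⟩
        · intro y hy
          rcases List.mem_cons.1 hy with rfl | hy
          · simp
          · exact List.mem_cons_of_mem _ (hp.2.1 y hy)
        · exact fun y hy => List.mem_cons_of_mem _ (hp.2.2 y hy)) (ih i)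
    cases i with
    | zero => rw [diag_zero_cone]; exact h1 0
    | succ i =>
      rw [diag_succ_cone]
      refine Submodule.add_mem _ (h1 _) ?_
      rw [push_comp, push_comp]
      refine map_mem_of_suppOn _ (fun p hp => ?_) (ih i)
      rw [lext_gen]
      refine gen_mem ⟨by simp; omega, ?_, ?_⟩
      · intro y hy
        rcases List.mem_cons.1 hy with rfl | hy
        · simp
        · exact List.mem_cons_of_mem _ (hp.2.2 y hy)
      · intro y hy
        rcases List.mem_cons.1 hy with rfl | hy
        · simp
        · exact List.mem_cons_of_mem _ (hp.2.1 y hy)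

theorem diag_zero_gen (l : List V) : diag 0 (gen l) = gen (l, []) := by
  induction l with
  | nil => exact diag_zero_nil
  | cons x l ih => rw [← cone_gen, diag_zero_cone, ih]; simp

/-- The first diagonal is supported on the splittings of the list at a vertex. -/
theorem diag_one_mem (l : List V) : diag 1 (gen l) ∈
    SuppOn fun p : List V × List V =>
      ∃ (pre post : List V) (c : V), l = pre ++ c :: post ∧ p = (pre ++ [c], c :: post) := by
  induction l with
  | nil => rw [diag_succ_nil]; exact Submodule.zero_mem _
  | cons x l ih =>
    rw [← cone_gen, diag_succ_cone, diag_zero_gen]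
    refine Submodule.add_mem _ (map_mem_of_suppOn _ ?_ ih) ?_
    · rintro _ ⟨pre, post, c, rfl, rfl⟩
      rw [lext_gen]
      exact gen_mem ⟨x :: pre, post, c, rfl, rfl⟩
    · rw [push_comp, push_comp, lext_gen]
      exact gen_mem ⟨[], l, x, rfl, rfl⟩

end Diagonals

section Shuffle

variable {V W V' W' : Type*}

/-- The shuffle product of two lists, as a chain of lists of pairs. -/
def shuffleList : List V → List W → Chain (V × W)
  | [], _ => 0
  | _ :: _, [] => 0
  | [v], [w] => gen [(v, w)]
  | [v], w :: w' :: m => cone (v, w) (shuffleList [v] (w' :: m))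
  | v :: v' :: l, [w] => cone (v, w) (shuffleList (v' :: l) [w])
  | v :: v' :: l, w :: w' :: m => cone (v, w)
      (shuffleList (v' :: l) (w :: w' :: m) + shuffleList (v :: v' :: l) (w' :: m))
  termination_by l m => l.length + m.length

/-- The shuffle product of chains. -/
def shuffle₂ : Chain V →ₗ[ZMod 2] Chain W →ₗ[ZMod 2] Chain (V × W) := lext₂ shuffleList

/-- The shuffle product on the tensor product of chains. -/
def shuffle : Sum2 (List V × List W) →ₗ[ZMod 2] Chain (V × W) :=
  lext fun p => shuffleList p.1 p.2

theorem shuffle_tens (x : Chain V) (y : Chain W) : shuffle (tens x y) = shuffle₂ x y :=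
  LinearMap.congr_fun (LinearMap.congr_fun
    (f := tens.compr₂ shuffle) (g := shuffle₂)
    (lhom_ext₂ fun a b => by simp [shuffle, shuffle₂]) x) y

theorem shuffle₂_nil_left (y : Chain W) : shuffle₂ (gen ([] : List V)) y = 0 :=
  LinearMap.congr_fun (f := shuffle₂ (gen ([] : List V))) (g := 0)
    (lhom_ext fun m => by simp [shuffle₂, shuffleList]) y

theorem shuffle₂_nil_right (x : Chain V) : shuffle₂ x (gen ([] : List W)) = 0 :=
  LinearMap.congr_fun (f := shuffle₂.flip (gen ([] : List W))) (g := 0)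
    (lhom_ext fun m => by cases m <;> simp [shuffle₂, shuffleList]) x

theorem shuffle₂_cone_cone (v : V) (w : W) (x : Chain V) (y : Chain W) :
    shuffle₂ (cone v x) (cone w y) = cone (v, w) ((nilCoeff x * nilCoeff y) • gen [] +
      shuffle₂ x (cone w y) + shuffle₂ (cone v x) y) := by
  let A : Chain V →ₗ[ZMod 2] Chain W →ₗ[ZMod 2] Chain (V × W) :=
    (LinearMap.mul (ZMod 2) (ZMod 2)).compl₁₂ nilCoeff nilCoeff |>.compr₂
      (LinearMap.toSpanSingleton (ZMod 2) _ (gen []))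
  let B : Chain V →ₗ[ZMod 2] Chain W →ₗ[ZMod 2] Chain (V × W) :=
    shuffle₂.compl₁₂ LinearMap.id (cone w)
  let C : Chain V →ₗ[ZMod 2] Chain W →ₗ[ZMod 2] Chain (V × W) :=
    shuffle₂.compl₁₂ (cone v) LinearMap.id
  refine LinearMap.congr_fun (LinearMap.congr_fun (f := shuffle₂.compl₁₂ (cone v) (cone w))
    (g := (A + B + C).compr₂ (cone (v, w))) (lhom_ext₂ fun l m => ?_) x) y
  cases l <;> cases m <;>
    simp [A, B, C, shuffle₂, shuffleList]

theorem bd_shuffle₂ (x : Chain V) (y : Chain W) : bd (shuffle₂ x y) =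
    shuffle₂ (bd x) y + shuffle₂ x (bd y) +
      (nilCoeff (bd x) * nilCoeff (bd y)) • gen [] := by
  let A : Chain V →ₗ[ZMod 2] Chain W →ₗ[ZMod 2] Chain (V × W) :=
    (LinearMap.mul (ZMod 2) (ZMod 2)).compl₁₂ (nilCoeff ∘ₗ bd) (nilCoeff ∘ₗ bd) |>.compr₂
      (LinearMap.toSpanSingleton (ZMod 2) _ (gen []))
  refine LinearMap.congr_fun (LinearMap.congr_fun (f := shuffle₂.compr₂ bd)
    (g := shuffle₂.compl₁₂ bd LinearMap.id + shuffle₂.compl₁₂ LinearMap.id bd + A)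
      (lhom_ext₂ fun l m => ?_) x) y
  change bd (shuffle₂ (gen l) (gen m)) = shuffle₂ (bd (gen l)) (gen m) +
    shuffle₂ (gen l) (bd (gen m)) + (nilCoeff (bd (gen l)) * nilCoeff (bd (gen m))) • gen []
  induction hn : l.length + m.length using Nat.strong_induction_on generalizing l m with
  | _ n ih =>
  subst hn
  cases l with
  | nil => simp [shuffle₂_nil_left]
  | cons v l =>
  cases m with
  | nil => simp [shuffle₂_nil_right]
  | cons w m =>
    have h1 := ih _ (by simp) l (w :: m) rfl
    have h2 := ih _ (by simp) (v :: l) m rfl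
    simp only [← cone_gen, bd_cone, map_add, LinearMap.add_apply, nilCoeff_cone, add_zero]
      at h1 h2 ⊢
    rw [shuffle₂_cone_cone, shuffle₂_cone_cone, shuffle₂_cone_cone, bd_cone, map_add bd,
      map_add bd, h1, h2, map_smul, bd_nil]
    simp only [map_add, map_smul, map_zero, smul_zero]
    linear_combination (norm := module) add_self_two (cone (v, w) (shuffle₂ (gen l) (gen m)))

theorem del_shuffle (c : Sum2 (List V × List W)) : del (shuffle c) = shuffle (bdPair c) := by
  refine LinearMap.congr_fun (f := del ∘ₗ shuffle) (g := shuffle ∘ₗ bdPair)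
    (lhom_ext fun p => ?_) c
  rw [LinearMap.comp_apply, LinearMap.comp_apply, ← tens_gen, shuffle_tens, bdPair_tens, map_add,
    shuffle_tens, shuffle_tens]
  have h := nilCoeff_del (shuffle₂ (gen p.1) (gen p.2))
  have h0 : ∀ z : Sum2 (List V × List W), nilCoeff (shuffle z) = 0 := by
    intro z
    refine LinearMap.congr_fun (f := nilCoeff ∘ₗ shuffle) (g := 0) (lhom_ext fun p => ?_) z
    obtain ⟨l, m⟩ := p
    rw [LinearMap.comp_apply, ← tens_gen, shuffle_tens, LinearMap.zero_apply]
    cases l with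
    | nil => rw [shuffle₂_nil_left, map_zero]
    | cons v l =>
    cases m with
    | nil => rw [shuffle₂_nil_right, map_zero]
    | cons w m => rw [← cone_gen, ← cone_gen, shuffle₂_cone_cone, nilCoeff_cone]
  rw [del_apply, bd_shuffle₂, map_add, map_add, ← shuffle_tens, ← shuffle_tens, h0, h0, map_smul]
  simp only [Finsupp.lapply_apply, Finsupp.single_eq_same, smul_eq_mul, mul_one, zero_add]
  rw [add_assoc, add_self_two, add_zero]

theorem shuffle₂_chainMap (φ : V → V') (ψ : W → W') (x : Chain V) (y : Chain W) :
    shuffle₂ (chainMap φ x) (chainMap ψ y) = chainMap (Prod.map φ ψ) (shuffle₂ x y) := by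
  refine LinearMap.congr_fun (LinearMap.congr_fun
    (f := shuffle₂.compl₁₂ (chainMap φ) (chainMap ψ))
    (g := shuffle₂.compr₂ (chainMap (Prod.map φ ψ))) (lhom_ext₂ fun l m => ?_) x) y
  change shuffle₂ (chainMap φ (gen l)) (chainMap ψ (gen m)) =
    chainMap (Prod.map φ ψ) (shuffle₂ (gen l) (gen m))
  induction hn : l.length + m.length using Nat.strong_induction_on generalizing l m with
  | _ n ih =>
  subst hn
  cases l with
  | nil => simp [shuffle₂_nil_left]
  | cons v l =>
  cases m with
  | nil => simp [shuffle₂_nil_right]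
  | cons w m =>
    have h1 := ih _ (by simp) l (w :: m) rfl
    have h2 := ih _ (by simp) (v :: l) m rfl
    simp only [← cone_gen, chainMap_cone] at h1 h2 ⊢
    rw [shuffle₂_cone_cone, shuffle₂_cone_cone, chainMap_cone, map_add (chainMap _),
      map_add (chainMap _), ← h1, ← h2, nilCoeff_chainMap,
      nilCoeff_chainMap, map_smul, chainMap_nil]
    rfl

theorem shuffle_chainMap (φ : V → V') (ψ : W → W') (c : Sum2 (List V × List W)) :
    shuffle (tensMap (chainMap φ) (chainMap ψ) c) = chainMap (Prod.map φ ψ) (shuffle c) := by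
  refine LinearMap.congr_fun (f := shuffle ∘ₗ tensMap (chainMap φ) (chainMap ψ))
    (g := chainMap (Prod.map φ ψ) ∘ₗ shuffle) (lhom_ext fun p => ?_) c
  rw [LinearMap.comp_apply, LinearMap.comp_apply, ← tens_gen, tensMap_tens, shuffle_tens,
    shuffle_tens, shuffle₂_chainMap]

theorem shuffle_swapPair (c : Sum2 (List V × List W)) :
    shuffle (swapPair c) = chainMap Prod.swap (shuffle c) := by
  refine LinearMap.congr_fun (f := shuffle ∘ₗ swapPair)
    (g := chainMap Prod.swap ∘ₗ shuffle) (lhom_ext fun p => ?_) c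
  obtain ⟨l, m⟩ := p
  rw [LinearMap.comp_apply, LinearMap.comp_apply, ← tens_gen, swapPair_tens, shuffle_tens,
    shuffle_tens]
  induction hn : l.length + m.length using Nat.strong_induction_on generalizing l m with
  | _ n ih =>
  subst hn
  cases l with
  | nil => rw [shuffle₂_nil_left, shuffle₂_nil_right, map_zero]
  | cons v l =>
  cases m with
  | nil => rw [shuffle₂_nil_left, shuffle₂_nil_right, map_zero]
  | cons w m =>
    have h1 := ih _ (by simp) l (w :: m) rfl
    have h2 := ih _ (by simp) (v :: l) m rfl
    simp only [← cone_gen] at h1 h2 ⊢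
    rw [shuffle₂_cone_cone, shuffle₂_cone_cone, chainMap_cone, map_add (chainMap _),
      map_add (chainMap _), ← h1, ← h2, map_smul, chainMap_nil,
      mul_comm (nilCoeff (gen l)), add_right_comm]
    rfl

/-- Supports of shuffle products: length, membership and monotonicity. -/
theorem shuffle_mem (R : V → V → Prop) (S : W → W → Prop) (hR : ∀ v, R v v) (hS : ∀ w, S w w)
    (l : List V) (m : List W) (hl : l.Pairwise R) (hm : m.Pairwise S) :
    shuffle (gen (l, m)) ∈ SuppOn fun q : List (V × W) => q.length + 1 = l.length + m.length ∧
      (∀ z ∈ q, z.1 ∈ l ∧ z.2 ∈ m) ∧ q.Pairwise fun z z' => R z.1 z'.1 ∧ S z.2 z'.2 := by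
  rw [← tens_gen, shuffle_tens]
  induction hn : l.length + m.length using Nat.strong_induction_on generalizing l m with
  | _ n ih =>
  subst hn
  cases l with
  | nil => rw [shuffle₂_nil_left]; exact Submodule.zero_mem _
  | cons v l =>
  cases m with
  | nil => rw [shuffle₂_nil_right]; exact Submodule.zero_mem _
  | cons w m =>
    have h1 := ih _ (by simp) l (w :: m) (List.Pairwise.of_cons hl) hm rfl
    have h2 := ih _ (by simp) (v :: l) m hl (List.Pairwise.of_cons hm) rfl
    rw [List.pairwise_cons] at hl hm
    rw [← cone_gen, ← cone_gen, shuffle₂_cone_cone, cone_gen, cone_gen, map_add, map_add]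
    refine Submodule.add_mem _ (Submodule.add_mem _ ?_ (map_mem_of_suppOn _ ?_ h1))
      (map_mem_of_suppOn _ ?_ h2)
    · cases l <;> cases m <;> simp
      exact fun q hq => by
        have := Finsupp.support_single_subset hq
        simp only [Finset.mem_singleton] at this
        subst this
        simp
    · rintro q ⟨hq, hq', hq''⟩
      rw [lext_gen]
      refine gen_mem ⟨by simp at hq ⊢; omega, ?_, List.pairwise_cons.2 ⟨fun z hz => ?_, hq''⟩⟩
      · intro z hz
        rcases List.mem_cons.1 hz with rfl | hz
        · simp
        · exact ⟨List.mem_cons_of_mem _ (hq' z hz).1, (hq' z hz).2⟩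
      · obtain ⟨ha, hb⟩ := hq' z hz
        refine ⟨hl.1 _ ha, ?_⟩
        rcases List.mem_cons.1 hb with hb | hb
        · exact hb ▸ hS _
        · exact hm.1 _ hb
    · rintro q ⟨hq, hq', hq''⟩
      rw [lext_gen]
      refine gen_mem ⟨by simp at hq ⊢; omega, ?_, List.pairwise_cons.2 ⟨fun z hz => ?_, hq''⟩⟩
      · intro z hz
        rcases List.mem_cons.1 hz with rfl | hz
        · simp
        · exact ⟨(hq' z hz).1, List.mem_cons_of_mem _ (hq' z hz).2⟩
      · obtain ⟨ha, hb⟩ := hq' z hz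
        refine ⟨?_, hm.1 _ hb⟩
        rcases List.mem_cons.1 ha with ha | ha
        · exact ha ▸ hR _
        · exact hl.1 _ ha

theorem shuffle₂_singleton (v : V) (w : W) : shuffle₂ (gen [v]) (gen [w]) = gen [(v, w)] := by
  simp [shuffle₂, shuffleList]

end Shuffle

/-! ### Subdivided chains on the cross-polytope sphere -/

section Subdivision

variable {V : Type*} [AddCommGroup V] [Module ℝ V]

/-- The midpoint of a pair. -/
def midPair (p : V × V) : V := (1 / 2 : ℝ) • (p.1 + p.2)

/-- The edgewise subdivision. -/
def subdiv : Chain V →ₗ[ZMod 2] Chain V := chainMap midPair ∘ₗ shuffle ∘ₗ diag 1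

theorem shuffle_diag_zero {W : Type*} (c : Chain W) : shuffle (diag 0 c) = 0 := by
  refine LinearMap.congr_fun (f := shuffle ∘ₗ diag 0) (g := 0) (lhom_ext fun l => ?_) c
  rw [LinearMap.comp_apply, diag_zero_gen, ← tens_gen, shuffle_tens, shuffle₂_nil_right]; rfl

theorem del_subdiv (c : Chain V) : del (subdiv c) = subdiv (del c) := by
  simp only [subdiv, LinearMap.comp_apply]
  rw [del_chainMap, del_shuffle, bd_diag_succ, map_add shuffle, map_add shuffle, shuffle_swapPair,
    shuffle_diag_zero, map_zero, add_zero, add_zero, bd_eq c, map_add (diag 1), map_smul,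
    diag_succ_nil, smul_zero, add_zero]

theorem subdiv_neg (c : Chain V) :
    subdiv (chainMap Neg.neg c) = chainMap Neg.neg (subdiv c) := by
  simp only [subdiv, LinearMap.comp_apply]
  rw [diag_chainMap, shuffle_chainMap, push_comp, push_comp]
  have : List.map (midPair (V := V)) ∘ List.map (Prod.map Neg.neg Neg.neg) =
      List.map Neg.neg ∘ List.map midPair := by
    funext l
    simp only [Function.comp_apply, List.map_map]
    congr 1
    funext p
    simp only [Function.comp_apply, midPair, Prod.map_fst, Prod.map_snd, ← neg_add, smul_neg]
  rw [this]

omit [Module ℝ V] in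
theorem neg_neg_chain (c : Chain V) : chainMap Neg.neg (chainMap Neg.neg c) = c := by
  rw [push_comp]
  have : List.map (Neg.neg : V → V) ∘ List.map Neg.neg = fun l => l := by
    funext l; simp
  rw [this, push_id]

end Subdivision

section Sphere

variable {m : ℕ}

/-- The sphere of the `ℓ¹`-norm. -/
def crossSphere (m : ℕ) : Set (Fin (m + 1) → ℝ) := {u | ∑ i, |u i| = 1}

/-- Cumulative sums of absolute values. -/
def cumAbs (k : ℕ) (u : Fin (m + 1) → ℝ) : ℝ := ∑ i with i.val < k, |u i|

theorem cumAbs_nonneg (k : ℕ) (u : Fin (m + 1) → ℝ) : 0 ≤ cumAbs k u :=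
  Finset.sum_nonneg fun _ _ => abs_nonneg _

theorem cumAbs_le (k : ℕ) (u : Fin (m + 1) → ℝ) : cumAbs k u ≤ ∑ i, |u i| :=
  Finset.sum_le_sum_of_subset_of_nonneg (Finset.filter_subset _ _) fun _ _ _ => abs_nonneg _

theorem cumAbs_succ (i : Fin (m + 1)) (u : Fin (m + 1) → ℝ) :
    cumAbs (i.val + 1) u = cumAbs i.val u + |u i| := by
  have : (Finset.univ.filter fun j : Fin (m + 1) => j.val < i.val + 1) =
      insert i (Finset.univ.filter fun j : Fin (m + 1) => j.val < i.val) := by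
    ext j; simp [Fin.ext_iff]; omega
  rw [cumAbs, cumAbs, this, Finset.sum_insert (by simp), add_comm]

theorem cumAbs_eq_sum {k : ℕ} {u : Fin (m + 1) → ℝ} (h : ∀ i : Fin (m + 1), k ≤ i.val → u i = 0) :
    cumAbs k u = ∑ i, |u i| := by
  refine Finset.sum_subset (Finset.filter_subset _ _) fun i _ hi => ?_
  rw [h i (by simpa using hi), abs_zero]

/-- A list of points of a closed face of the cross-polytope sphere, in monotone position at
scale `h`. -/
def MonoList (h : ℝ) (l : List (Fin (m + 1) → ℝ)) : Prop :=
  ∃ ε : Fin (m + 1) → ℝ, (∀ i, |ε i| = 1) ∧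
    (∀ v ∈ l, (∀ i, 0 ≤ ε i * v i) ∧ v ∈ crossSphere m) ∧
    l.Pairwise fun v v' => ∀ k, cumAbs k v ≤ cumAbs k v' ∧ cumAbs k v' ≤ cumAbs k v + h

theorem abs_eq_of_sign {e x : ℝ} (he : |e| = 1) (hx : 0 ≤ e * x) : |x| = e * x := by
  rw [← abs_of_nonneg hx, abs_mul, he, one_mul]

theorem MonoList.neg {h : ℝ} {l : List (Fin (m + 1) → ℝ)} (hl : MonoList h l) :
    MonoList h (l.map Neg.neg) := by
  obtain ⟨ε, h1, h2, h3⟩ := hl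
  refine ⟨-ε, by simpa using h1, ?_, ?_⟩
  · intro v hv
    obtain ⟨w, hw, rfl⟩ := List.mem_map.1 hv
    refine ⟨by simpa using (h2 w hw).1, ?_⟩
    simpa [crossSphere] using (h2 w hw).2
  · rw [List.pairwise_map]
    simpa [cumAbs] using h3

theorem MonoList.ne_neg {h : ℝ} {l : List (Fin (m + 1) → ℝ)} (hl : MonoList h l)
    {v w : Fin (m + 1) → ℝ} (hv : v ∈ l) (hw : w ∈ l) : v ≠ -w := by
  obtain ⟨ε, h1, h2, -⟩ := hl
  rintro rfl
  have h0 : ∀ i, w i = 0 := fun i => by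
    have ha := (h2 _ hv).1 i
    have hb := (h2 _ hw).1 i
    have : ε i * w i = 0 := by simp at ha; linarith
    rw [← abs_eq_zero, abs_eq_of_sign (h1 i) hb, this]
  have := (h2 _ hw).2
  simp [crossSphere, h0] at this

theorem MonoList.dist_le {h : ℝ} (h0 : 0 ≤ h) {l : List (Fin (m + 1) → ℝ)} (hl : MonoList h l)
    {v w : Fin (m + 1) → ℝ} (hv : v ∈ l) (hw : w ∈ l) : dist v w ≤ 2 * h := by
  obtain ⟨ε, h1, h2, h3⟩ := hl
  have key : ∀ v ∈ l, ∀ w ∈ l, ∀ k, |cumAbs k v - cumAbs k w| ≤ h := by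
    have : Std.Symm fun v w : Fin (m + 1) → ℝ => ∀ k, |cumAbs k v - cumAbs k w| ≤ h :=
      ⟨fun a b hab k => by rw [abs_sub_comm]; exact hab k⟩
    refine fun v hv w hw => List.Pairwise.forall_of_forall
      (R := fun v w : Fin (m + 1) → ℝ => ∀ k, |cumAbs k v - cumAbs k w| ≤ h)
      (fun a _ k => by simpa using h0) (h3.imp fun {a b} hab k => ?_) hv hw
    rw [abs_le]; constructor <;> linarith [(hab k).1, (hab k).2]
  refine (dist_pi_le_iff (by linarith)).2 fun i => ?_
  have e1 := key v hv w hw i.val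
  have e2 := key v hv w hw (i.val + 1)
  rw [cumAbs_succ, cumAbs_succ, abs_eq_of_sign (h1 i) ((h2 v hv).1 i),
    abs_eq_of_sign (h1 i) ((h2 w hw).1 i)] at e2
  have : dist (v i) (w i) = |ε i * v i - ε i * w i| := by
    rw [← mul_sub, abs_mul, h1, one_mul, Real.dist_eq]
  rw [this, abs_le]
  rw [abs_le] at e1 e2
  constructor <;> linarith [e1.1, e1.2, e2.1, e2.2]

theorem cumAbs_midPair {ε : Fin (m + 1) → ℝ} (hε : ∀ i, |ε i| = 1) {v w : Fin (m + 1) → ℝ}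
    (hv : ∀ i, 0 ≤ ε i * v i) (hw : ∀ i, 0 ≤ ε i * w i) :
    (∀ i, 0 ≤ ε i * midPair (v, w) i) ∧
      (∀ i, |midPair (v, w) i| = (|v i| + |w i|) / 2) := by
  have h : ∀ i, ε i * midPair (v, w) i = (ε i * v i + ε i * w i) / 2 := fun i => by
    simp [midPair]; ring
  have h0 : ∀ i, 0 ≤ ε i * midPair (v, w) i := fun i => by
    rw [h]; linarith [hv i, hw i]
  refine ⟨h0, fun i => ?_⟩
  rw [abs_eq_of_sign (hε i) (h0 i), abs_eq_of_sign (hε i) (hv i), abs_eq_of_sign (hε i) (hw i), h]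

theorem subdiv_mem {h : ℝ} {l : List (Fin (m + 1) → ℝ)} (hl : MonoList h l) :
    subdiv (gen l) ∈ SuppOn fun q : List (Fin (m + 1) → ℝ) =>
      MonoList (h / 2) q ∧ q.length = l.length := by
  obtain ⟨ε, h1, h2, h3⟩ := hl
  simp only [subdiv, LinearMap.comp_apply]
  refine map_mem_of_suppOn (P := fun q : List ((Fin (m + 1) → ℝ) × (Fin (m + 1) → ℝ)) =>
    MonoList (h / 2) (q.map midPair) ∧ q.length = l.length) _ (fun q hq => ?_) ?_
  · rw [lext_gen]
    exact gen_mem ⟨hq.1, by simpa using hq.2⟩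
  refine map_mem_of_suppOn _ ?_ (diag_one_mem l)
  rintro _ ⟨pre, post, c, rfl, rfl⟩
  refine suppOn_mono ?_ (shuffle_mem (fun v v' => ∀ k, cumAbs k v ≤ cumAbs k v')
    (fun v v' => ∀ k, cumAbs k v ≤ cumAbs k v') (fun _ _ => le_rfl) (fun _ _ => le_rfl) _ _ ?_ ?_)
  · rintro q ⟨ha, hb, hc⟩
    have hb' : ∀ z ∈ q, z.1 ∈ pre ++ c :: post ∧ z.2 ∈ pre ++ c :: post := fun z hz => by
      have := hb z hz
      simp only [List.mem_append, List.mem_cons, List.not_mem_nil, or_false] at this ⊢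
      tauto
    have hmid : ∀ z ∈ q, _ := fun z hz =>
      cumAbs_midPair h1 (h2 _ (hb' z hz).1).1 (h2 _ (hb' z hz).2).1
    have hcum : ∀ z ∈ q, ∀ k, cumAbs k (midPair z) = (cumAbs k z.1 + cumAbs k z.2) / 2 := by
      intro z hz k
      simp only [cumAbs]
      rw [Finset.sum_congr rfl fun i _ => (hmid z hz).2 i, ← Finset.sum_div, Finset.sum_add_distrib]
    refine ⟨⟨ε, h1, ?_, ?_⟩, by simp at ha ⊢; omega⟩
    · intro v hv
      obtain ⟨z, hz, rfl⟩ := List.mem_map.1 hv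
      refine ⟨(hmid z hz).1, ?_⟩
      have e1 := (h2 _ (hb' z hz).1).2
      have e2 := (h2 _ (hb' z hz).2).2
      simp only [crossSphere, Set.mem_ofPred_eq] at e1 e2 ⊢
      rw [Finset.sum_congr rfl fun i _ => (hmid z hz).2 i, ← Finset.sum_div,
        Finset.sum_add_distrib, e1, e2]
      norm_num
    · rw [List.pairwise_map]
      have hx : ∀ z ∈ q, ∀ k, cumAbs k z.1 ≤ cumAbs k c := by
        intro z hz k
        have := (hb z hz).1
        rw [List.mem_append, List.mem_singleton] at this
        rw [List.pairwise_append] at h3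
        rcases this with h | h
        · exact (h3.2.2 _ h c (by simp) k).1
        · rw [h]
      have hy : ∀ z ∈ q, ∀ k, cumAbs k c ≤ cumAbs k z.2 := by
        intro z hz k
        have := (hb z hz).2
        rw [List.mem_cons] at this
        rw [List.pairwise_append, List.pairwise_cons] at h3
        rcases this with h | h
        · rw [h]
        · exact (h3.2.1.1 _ h k).1
      have hxy : ∀ z ∈ q, ∀ z' ∈ q, ∀ k, cumAbs k z'.2 ≤ cumAbs k z.1 + h ∨
          (z.1 = c ∧ z'.2 = c) := by
        intro z hz z' hz' k
        have hp := (hb z hz).1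
        have hq := (hb z' hz').2
        rw [List.mem_append, List.mem_singleton] at hp
        rw [List.mem_cons] at hq
        rw [List.pairwise_append, List.pairwise_cons] at h3
        rcases hp with hp | hp
        · exact Or.inl (h3.2.2 _ hp _ (List.mem_cons.2 hq) k).2
        · rcases hq with hq | hq
          · exact Or.inr ⟨hp, hq⟩
          · left; rw [hp]; exact (h3.2.1.1 _ hq k).2
      by_cases hh : 0 ≤ h
      · refine (List.pairwise_iff_forall_sublist.2 fun {z z'} hs => ?_)
        have hz : z ∈ q := hs.subset (by simp)
        have hz' : z' ∈ q := hs.subset (by simp)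
        have hc' := List.pairwise_iff_forall_sublist.1 hc hs
        intro k
        rw [hcum z hz, hcum z' hz']
        have i1 := hc'.1 k
        have i2 := hc'.2 k
        have i3 := hx z' hz' k
        have i4 := hy z hz k
        refine ⟨by linarith, ?_⟩
        rcases hxy z hz z' hz' k with i5 | ⟨i5, i6⟩
        · linarith
        · rw [i6]; rw [i5] at i1 ⊢; linarith
      · have : pre ++ c :: post = [c] := by
          rw [List.pairwise_append, List.pairwise_cons] at h3
          cases pre with
          | nil =>
            cases post with
            | nil => rfl
            | cons d post => have := h3.2.1.1 d (by simp) 0; linarith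
          | cons d pre => have := h3.2.2 d (by simp) c (by simp) 0; linarith
        have hq : q.length = 1 := by
          have := congrArg List.length this
          simp at this ha; omega
        obtain ⟨z, rfl⟩ := List.length_eq_one_iff.1 hq
        simp
  · have : pre ++ c :: post = (pre ++ [c]) ++ post := by simp
    rw [this] at h3
    exact (List.pairwise_append.1 h3).1.imp fun hab k => (hab k).1
  · exact (List.pairwise_append.1 h3).2.1.imp fun hab k => (hab k).1

/-- The vertices of the cross-polytope. -/
def crossVertex (m b : ℕ) : Fin (m + 1) → ℝ := fun i => if i.val = b then 1 else 0

/-- The hemispheres of the cross-polytope sphere. -/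
def hemi (m : ℕ) : ℕ → Chain (Fin (m + 1) → ℝ)
  | 0 => gen [crossVertex m 0]
  | b + 1 => cone (crossVertex m (b + 1)) (hemi m b + chainMap Neg.neg (hemi m b))

theorem bd_hemi_succ (b : ℕ) :
    bd (hemi m (b + 1)) = hemi m b + chainMap Neg.neg (hemi m b) := by
  rw [hemi, bd_cone]
  suffices h : bd (hemi m b + chainMap Neg.neg (hemi m b)) = 0 by rw [h, map_zero, add_zero]
  rw [map_add, bd_chainMap]
  cases b with
  | zero => simp [hemi, add_self_two]
  | succ b => rw [bd_hemi_succ, map_add, neg_neg_chain, add_comm (chainMap _ _), add_self_two]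

theorem nilCoeff_hemi (b : ℕ) : nilCoeff (hemi m b) = 0 := by
  cases b with
  | zero => simp [hemi]
  | succ b => exact nilCoeff_cone _ _

theorem crossVertex_mem {b : ℕ} (hb : b ≤ m) : crossVertex m b ∈ crossSphere m := by
  have : ∀ i : Fin (m + 1), |crossVertex m b i| = if i = ⟨b, by omega⟩ then 1 else 0 := by
    intro i; simp only [crossVertex, Fin.ext_iff]; split_ifs <;> simp
  simp [crossSphere, this]

theorem hemi_mem {b : ℕ} (hb : b ≤ m) : hemi m b ∈ SuppOn fun l : List (Fin (m + 1) → ℝ) =>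
    MonoList 1 l ∧ l.length = b + 1 ∧ ∀ v ∈ l, ∀ i : Fin (m + 1), b < i.val → v i = 0 := by
  induction b with
  | zero =>
    refine gen_mem ⟨⟨fun _ => 1, by simp, ?_, by simp⟩, by simp, ?_⟩
    · simp only [List.mem_singleton, forall_eq]
      refine ⟨fun i => ?_, crossVertex_mem hb⟩
      simp only [crossVertex]; split_ifs <;> simp
    · simp only [List.mem_singleton, forall_eq]
      intro i hi
      simp [crossVertex, hi.ne']
  | succ b ih =>
    rw [hemi]
    refine map_mem_of_suppOn (P := fun l : List (Fin (m + 1) → ℝ) =>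
      MonoList 1 l ∧ l.length = b + 1 ∧ ∀ v ∈ l, ∀ i : Fin (m + 1), b < i.val → v i = 0) _
      (fun l hl => ?_) (Submodule.add_mem _ (ih (by omega)) (map_mem_of_suppOn _ (fun l hl => ?_)
        (ih (by omega))))
    · rw [lext_gen]
      obtain ⟨⟨ε, h1, h2, h3⟩, h4, h5⟩ := hl
      refine gen_mem ⟨⟨fun i => if i.val = b + 1 then 1 else ε i, ?_, ?_, ?_⟩, by simp [h4], ?_⟩
      · intro i; dsimp only; split_ifs <;> simp [h1]
      · intro v hv
        rcases List.mem_cons.1 hv with rfl | hv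
        · refine ⟨fun i => ?_, crossVertex_mem hb⟩
          simp only [crossVertex]; split_ifs <;> simp
        · refine ⟨fun i => ?_, (h2 v hv).2⟩
          dsimp only
          split_ifs with hi
          · rw [h5 v hv i (by omega)]; simp
          · exact (h2 v hv).1 i
      · refine List.pairwise_cons.2 ⟨fun v hv k => ?_, h3⟩
        have hv1 : ∑ i, |v i| = 1 := (h2 v hv).2
        have he : ∑ i, |crossVertex m (b + 1) i| = 1 := crossVertex_mem hb
        rcases le_or_gt k (b + 1) with hk | hk
        · have : cumAbs k (crossVertex m (b + 1)) = 0 := by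
            refine Finset.sum_eq_zero fun i hi => ?_
            have : i.val < k := by simpa using hi
            simp [crossVertex, show i.val ≠ b + 1 by omega]
          rw [this]
          exact ⟨cumAbs_nonneg _ _, by linarith [cumAbs_le k v]⟩
        · have e1 : cumAbs k (crossVertex m (b + 1)) = 1 := by
            rw [cumAbs_eq_sum fun i hi => ?_, he]
            simp [crossVertex, show i.val ≠ b + 1 by omega]
          rw [e1, cumAbs_eq_sum fun i hi => h5 v hv i (by omega), hv1]
          norm_num
      · intro v hv i hi
        rcases List.mem_cons.1 hv with rfl | hv
        · simp [crossVertex, hi.ne']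
        · exact h5 v hv i (by omega)
    · rw [lext_gen]
      refine gen_mem ⟨hl.1.neg, by simp [hl.2.1], fun v hv i hi => ?_⟩
      obtain ⟨w, hw, rfl⟩ := List.mem_map.1 hv
      simp [hl.2.2 w hw i hi]

/-- The subdivided hemispheres. -/
def subHemi (m N b : ℕ) : Chain (Fin (m + 1) → ℝ) := (subdiv ^ N) (hemi m b)

theorem del_subHemi_zero (N : ℕ) : del (subHemi m N 0) = 0 := by
  induction N with
  | zero => exact del_singleton _
  | succ N ih =>
    rw [subHemi, pow_succ', Module.End.mul_apply, del_subdiv, ← subHemi, ih, map_zero]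

theorem del_subHemi_succ (N b : ℕ) :
    del (subHemi m N (b + 1)) = subHemi m N b + chainMap Neg.neg (subHemi m N b) := by
  induction N with
  | zero =>
    change del (hemi m (b + 1)) = hemi m b + chainMap Neg.neg (hemi m b)
    rw [del_apply, bd_hemi_succ, map_add, nilCoeff_chainMap, nilCoeff_hemi, add_zero, zero_smul,
      add_zero]
  | succ N ih =>
    simp only [subHemi, pow_succ', Module.End.mul_apply] at ih ⊢
    rw [del_subdiv, ih, map_add, subdiv_neg]

theorem subHemi_mem {b : ℕ} (hb : b ≤ m) (N : ℕ) :
    subHemi m N b ∈ SuppOn fun l : List (Fin (m + 1) → ℝ) =>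
      MonoList ((1 / 2 : ℝ) ^ N) l ∧ l.length = b + 1 := by
  induction N with
  | zero => exact suppOn_mono (fun l hl => ⟨by simpa using hl.1, hl.2.1⟩) (hemi_mem hb)
  | succ N ih =>
    rw [subHemi, pow_succ' subdiv, Module.End.mul_apply]
    refine map_mem_of_suppOn _ (fun l hl => suppOn_mono (fun q hq => ?_) (subdiv_mem hl.1)) ih
    refine ⟨?_, hq.2.trans hl.2⟩
    have := hq.1
    rwa [pow_succ, ← div_eq_mul_one_div]

theorem subHemi_zero_zero (N : ℕ) : subHemi m N 0 = gen [crossVertex m 0] := by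
  induction N with
  | zero => rfl
  | succ N ih =>
    rw [subHemi, pow_succ', Module.End.mul_apply, ← subHemi, ih]
    simp only [subdiv, LinearMap.comp_apply]
    rw [← cone_gen, diag_succ_cone, diag_succ_nil, diag_zero_nil]
    simp [shuffle, shuffleList, midPair, ← two_smul ℝ, smul_smul]

end Sphere

/-! ### Capping chains along antisymmetric functions -/

section Cap

variable {V W Z : Type*}

/-- The number of vertices of a chain, modulo two. -/
def eps : Chain V →ₗ[ZMod 2] ZMod 2 := nilCoeff ∘ₗ bd

theorem bd_eq_eps (c : Chain V) : bd c = del c + eps c • gen [] := bd_eq c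

theorem eps_chainMap (φ : V → W) (c : Chain V) : eps (chainMap φ c) = eps c := by
  simp only [eps, LinearMap.comp_apply]
  rw [bd_chainMap, nilCoeff_chainMap]

theorem eps_singleton (v : V) : eps (gen [v]) = 1 := by simp [eps]

theorem eps_del (c : Chain V) : eps (del c) = 0 := by
  have h : bd (del c) = 0 := by rw [del_apply, map_add, bd_bd, map_smul, bd_nil]; simp
  rw [eps, LinearMap.comp_apply, h, map_zero]

theorem eps_eq_zero_of_length {n : ℕ} {c : Chain V} (hc : c ∈ SuppOn fun l => l.length = n + 2) :
    eps c = 0 := by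
  by_contra h
  have := suppOn_mem (bd_length (n := n + 1) hc) (a := []) h
  simp at this

/-- Weighting a list by a function of its first vertex. -/
def sigList (s : Z → ZMod 2) : List Z → Chain Z
  | [] => 0
  | e :: r => s e • gen (e :: r)

/-- Weighting chains by a function of the first vertex. -/
def sig (s : Z → ZMod 2) : Chain Z →ₗ[ZMod 2] Chain Z := lext (sigList s)

theorem sig_cons (s : Z → ZMod 2) (e : Z) (r : List Z) :
    sig s (gen (e :: r)) = s e • gen (e :: r) := by rw [sig, lext_gen, sigList]

theorem sig_cone (s : Z → ZMod 2) (e : Z) (c : Chain Z) : sig s (cone e c) = s e • cone e c :=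
  LinearMap.congr_fun (f := sig s ∘ₗ cone e) (g := s e • cone e)
    (lhom_ext fun r => by
      rw [LinearMap.comp_apply, LinearMap.smul_apply, cone_gen, sig_cons]) c

/-- The part of a chain along which the function `s` changes. -/
def kap (s : Z → ZMod 2) : Chain Z →ₗ[ZMod 2] Chain Z := del ∘ₗ sig s + sig s ∘ₗ del

theorem del_kap (s : Z → ZMod 2) (c : Chain Z) : del (kap s c) = kap s (del c) := by
  simp only [kap, LinearMap.add_apply, LinearMap.comp_apply, map_add, del_del, map_zero,
    zero_add, add_zero]

theorem kap_cons_cons (s : Z → ZMod 2) (e f : Z) (r : List Z) :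
    kap s (gen (e :: f :: r)) = (s e + s f) • gen (f :: r) := by
  simp only [kap, LinearMap.add_apply, LinearMap.comp_apply]
  rw [sig_cons, map_smul, del_cons_cons, map_add, sig_cons, sig_cone, smul_add, add_smul]
  linear_combination (norm := module) add_self_two (s e • cone e (bd (gen (f :: r))))

theorem kap_singleton (s : Z → ZMod 2) (e : Z) : kap s (gen [e]) = 0 := by
  simp only [kap, LinearMap.add_apply, LinearMap.comp_apply]
  rw [sig_cons, map_smul, del_singleton, smul_zero, map_zero, add_zero]

theorem kap_nil (s : Z → ZMod 2) : kap s (gen ([] : List Z)) = 0 := by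
  simp only [kap, LinearMap.add_apply, LinearMap.comp_apply]
  rw [del_nil, map_zero, add_zero, sig, lext_gen, sigList, map_zero]

theorem kap_chainMap {s : Z → ZMod 2} {φ : Z → Z} {c : Chain Z}
    (hc : c ∈ SuppOn fun l => ∀ z ∈ l, s (φ z) = 1 + s z) :
    kap s (chainMap φ c) = chainMap φ (kap s c) := by
  refine eqOn_of_suppOn (kap s ∘ₗ chainMap φ) (chainMap φ ∘ₗ kap s) (fun l hl => ?_) hc
  rw [LinearMap.comp_apply, LinearMap.comp_apply, lext_gen]
  match l, hl with
  | [], _ => rw [List.map_nil, kap_nil, map_zero]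
  | [e], _ => rw [List.map_singleton, kap_singleton, kap_singleton, map_zero]
  | e :: f :: r, hl =>
    rw [List.map_cons, List.map_cons, kap_cons_cons, kap_cons_cons, map_smul, lext_gen,
      List.map_cons, hl e (by simp), hl f (by simp)]
    congr 1
    linear_combination add_self_two (1 : ZMod 2)

theorem eps_sig_chainMap {s : Z → ZMod 2} {φ : Z → Z} {c : Chain Z}
    (hc : c ∈ SuppOn fun l => ∀ z ∈ l, s (φ z) = 1 + s z) :
    eps (sig s (chainMap φ c)) = eps c + eps (sig s c) := by
  refine eqOn_of_suppOn (eps ∘ₗ sig s ∘ₗ chainMap φ) (eps + eps ∘ₗ sig s) (fun l hl => ?_) hc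
  rw [LinearMap.comp_apply, LinearMap.comp_apply, LinearMap.add_apply, LinearMap.comp_apply]
  cases l with
  | nil => simp [sig, sigList, eps]
  | cons e r =>
    have h : eps (gen (φ e :: r.map φ)) = eps (gen (e :: r)) := by
      rw [← eps_chainMap φ (gen (e :: r)), lext_gen, List.map_cons]
    rw [lext_gen, List.map_cons, sig_cons, sig_cons, map_smul, map_smul, hl e (by simp), h,
      add_smul, one_smul]

theorem kap_mem (s : Z → ZMod 2) (l : List Z) : kap s (gen l) ∈ SuppOn fun q : List Z =>
    q.length + 1 = l.length ∧ (∀ z ∈ q, z ∈ l) ∧ (∃ z ∈ l, s z = 0) ∧ ∃ z ∈ l, s z = 1 := by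
  match l with
  | [] => rw [kap_nil]; exact Submodule.zero_mem _
  | [e] => rw [kap_singleton]; exact Submodule.zero_mem _
  | e :: f :: r =>
    rw [kap_cons_cons]
    have h2 : ∀ x : ZMod 2, x = 0 ∨ x = 1 := by decide
    rcases h2 (s e) with he | he <;> rcases h2 (s f) with hf | hf <;> rw [he, hf]
    · rw [add_zero, zero_smul]; exact Submodule.zero_mem _
    · exact Submodule.smul_mem _ _ (gen_mem ⟨by simp, fun z hz => List.mem_cons_of_mem _ hz,
        ⟨e, by simp, he⟩, ⟨f, by simp, hf⟩⟩)
    · exact Submodule.smul_mem _ _ (gen_mem ⟨by simp, fun z hz => List.mem_cons_of_mem _ hz,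
        ⟨f, by simp, hf⟩, ⟨e, by simp, he⟩⟩)
    · rw [add_self_two, zero_smul]; exact Submodule.zero_mem _

/-- Iterated capping. -/
def kaps : List (Z → ZMod 2) → Chain Z →ₗ[ZMod 2] Chain Z
  | [] => LinearMap.id
  | s :: ss => kap s ∘ₗ kaps ss

theorem del_kaps (ss : List (Z → ZMod 2)) (c : Chain Z) :
    del (kaps ss c) = kaps ss (del c) := by
  induction ss with
  | nil => rfl
  | cons s ss ih => simp only [kaps, LinearMap.comp_apply]; rw [del_kap, ih]

theorem kaps_mem (ss : List (Z → ZMod 2)) (l : List Z) :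
    kaps ss (gen l) ∈ SuppOn fun q : List Z =>
      q.length + ss.length = l.length ∧ (∀ z ∈ q, z ∈ l) ∧
        ∀ s ∈ ss, (∃ z ∈ l, s z = 0) ∧ ∃ z ∈ l, s z = 1 := by
  induction ss with
  | nil => exact gen_mem (by simp)
  | cons s ss ih =>
    simp only [kaps, LinearMap.comp_apply]
    refine map_mem_of_suppOn _ (fun q hq => suppOn_mono ?_ (kap_mem s q)) ih
    rintro p ⟨h1, h2, ⟨z, hz, hz'⟩, w, hw, hw'⟩
    refine ⟨by simp only [List.length_cons]; omega, fun z hz => hq.2.1 z (h2 z hz), ?_⟩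
    intro s' hs'
    rcases List.mem_cons.1 hs' with rfl | hs'
    · exact ⟨⟨z, hq.2.1 z hz, hz'⟩, w, hq.2.1 w hw, hw'⟩
    · exact hq.2.2 s' hs'

theorem kaps_mem_forall {P : Z → Prop} (ss : List (Z → ZMod 2)) {c : Chain Z}
    (hc : c ∈ SuppOn fun l => ∀ z ∈ l, P z) : kaps ss c ∈ SuppOn fun l => ∀ z ∈ l, P z :=
  map_mem_of_suppOn _ (fun l hl => suppOn_mono (fun _ hq z hz => hl z (hq.2.1 z hz))
    (kaps_mem ss l)) hc

theorem kaps_chainMap {ss : List (Z → ZMod 2)} {φ : Z → Z} {c : Chain Z}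
    (hc : c ∈ SuppOn fun l => ∀ z ∈ l, ∀ s ∈ ss, s (φ z) = 1 + s z) :
    kaps ss (chainMap φ c) = chainMap φ (kaps ss c) := by
  induction ss with
  | nil => rfl
  | cons s ss ih =>
    simp only [kaps, LinearMap.comp_apply]
    rw [ih (suppOn_mono (fun l hl z hz s' hs' => hl z hz s' (List.mem_cons_of_mem _ hs')) hc),
      kap_chainMap]
    exact kaps_mem_forall ss (suppOn_mono (fun l hl z hz => hl z hz s (by simp)) hc)

/-- Telescoping: the parity of the number of points where all of the functions change. -/
theorem eps_kaps (ss : List (Z → ZMod 2)) {φ : Z → Z} (Q : ℕ → Chain Z)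
    (hQ : ∀ i < ss.length, del (Q (i + 1)) = Q i + chainMap φ (Q i))
    (hs : ∀ i < ss.length, Q i ∈ SuppOn fun l => ∀ z ∈ l, ∀ s ∈ ss, s (φ z) = 1 + s z) :
    eps (kaps ss (Q ss.length)) = eps (Q 0) := by
  induction ss with
  | nil => rfl
  | cons s ss ih =>
    have hq := hs ss.length (by simp)
    rw [← ih (fun i hi => hQ i (by simp; omega)) (fun i hi => suppOn_mono
      (fun l hl z hz s' hs' => hl z hz s' (List.mem_cons_of_mem _ hs')) (hs i (by simp; omega)))]
    simp only [kaps, LinearMap.comp_apply, List.length_cons]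
    rw [kap, LinearMap.add_apply, map_add, LinearMap.comp_apply, LinearMap.comp_apply, eps_del,
      zero_add, del_kaps, hQ _ (by simp), map_add, kaps_chainMap (suppOn_mono
        (fun l hl z hz s' hs' => hl z hz s' (List.mem_cons_of_mem _ hs')) hq), map_add, map_add,
      eps_sig_chainMap (kaps_mem_forall ss (suppOn_mono (fun l hl z hz => hl z hz s (by simp)) hq)),
      add_left_comm, add_self_two, add_zero]

end Cap

/-! ### Lifting chains through a correspondence -/

section Lift

variable {m : ℕ}

/-- Approximate lifting of small simplices through a family of relations. -/
def Lifts {B Y : Type*} [PseudoMetricSpace B] [PseudoMetricSpace Y]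
    (H : ℝ → B → Y → Prop) : Prop :=
  ∀ η > 0, ∃ δ > 0, ∀ (X : Type) (β : X → B), ∃ t : Chain X →ₗ[ZMod 2] Chain (X × Y),
    t (gen []) = gen [] ∧ (∀ c, bd (t c) = t (bd c)) ∧
    ∀ L, t (gen L) ∈ SuppOn fun M : List (X × Y) => M.length = L.length ∧ (∀ z ∈ M, z.1 ∈ L) ∧
      ((∀ x ∈ L, ∀ x' ∈ L, dist (β x) (β x') ≤ δ) →
        (∀ z ∈ M, ∀ z' ∈ M, dist z.2 z'.2 ≤ η) ∧ ∀ z ∈ M, H η (β z.1) z.2)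

/-- Stability of a family of relations under small perturbations. -/
structure StableRel {B Y : Type*} [PseudoMetricSpace B] [PseudoMetricSpace Y]
    (H : ℝ → B → Y → Prop) : Prop where
  mono : ∀ ⦃η η'⦄, η ≤ η' → ∀ ⦃v y⦄, H η v y → H η' v y
  stable : ∀ η > 0, ∃ η' > 0, ∀ ⦃v v' y y'⦄, H η' v y → dist v v' ≤ η' → dist y y' ≤ η' → H η v' y'

theorem tens_mem {V W : Type*} {P : List V → Prop} {Q : List W → Prop} {x : Chain V} {y : Chain W}
    (hx : x ∈ SuppOn P) (hy : y ∈ SuppOn Q) :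
    tens x y ∈ SuppOn fun p : List V × List W => P p.1 ∧ Q p.2 := by
  refine map_mem_of_suppOn (tens.flip y) (fun l hl => ?_) hx
  refine map_mem_of_suppOn (tens (gen l)) (fun k hk => ?_) hy
  rw [tens_gen]
  exact gen_mem ⟨hl, hk⟩

variable {X Y : Type*}

/-- The antipode in the second coordinate. -/
def flipSnd (z : X × (Fin (m + 1) → ℝ)) : X × (Fin (m + 1) → ℝ) := (z.1, -z.2)

/-- The product with a hemisphere. -/
def prism (m N b : ℕ) : Chain X →ₗ[ZMod 2] Chain (X × (Fin (m + 1) → ℝ)) :=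
  shuffle₂.flip (subHemi m N b)

theorem flipSnd_flipSnd (c : Chain (X × (Fin (m + 1) → ℝ))) :
    chainMap flipSnd (chainMap flipSnd c) = c := by
  rw [push_comp]
  have : List.map (flipSnd : X × (Fin (m + 1) → ℝ) → _) ∘ List.map flipSnd = fun l => l := by
    funext l
    have : (flipSnd : X × (Fin (m + 1) → ℝ) → _) ∘ flipSnd = id := by
      funext z; simp [flipSnd]
    simp [this]
  rw [this, push_id]

theorem shuffle₂_bd_right {V W : Type*} (x : Chain V) (y : Chain W) :
    shuffle₂ x (bd y) = shuffle₂ x (del y) := by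
  rw [bd_eq, map_add, map_smul, shuffle₂_nil_right, smul_zero, add_zero]

theorem chainMap_flipSnd_shuffle₂ (c : Chain X) (y : Chain (Fin (m + 1) → ℝ)) :
    chainMap flipSnd (shuffle₂ c y) = shuffle₂ c (chainMap Neg.neg y) := by
  have h := shuffle₂_chainMap (fun x : X => x) (Neg.neg : (Fin (m + 1) → ℝ) → _) c y
  have h1 : chainMap (fun x : X => x) c = c := by
    have : List.map (fun x : X => x) = fun l => l := by funext l; simp
    rw [chainMap, this, push_id]
  rw [h1] at h
  rw [h]; rfl

theorem del_prism_zero (N : ℕ) (c : Chain X) :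
    del (prism m N 0 c) = prism m N 0 (bd c) := by
  simp only [prism, LinearMap.flip_apply]
  rw [← shuffle_tens, del_shuffle, bdPair_tens, map_add, shuffle_tens, shuffle_tens,
    shuffle₂_bd_right, del_subHemi_zero, map_zero, add_zero]

theorem del_prism_succ (N b : ℕ) (c : Chain X) :
    del (prism m N (b + 1) c) =
      prism m N (b + 1) (bd c) + (prism m N b c + chainMap flipSnd (prism m N b c)) := by
  simp only [prism, LinearMap.flip_apply]
  rw [← shuffle_tens, del_shuffle, bdPair_tens, map_add, shuffle_tens, shuffle_tens,
    shuffle₂_bd_right, del_subHemi_succ, map_add, chainMap_flipSnd_shuffle₂]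

theorem prism_mem {b : ℕ} (hb : b ≤ m) (N : ℕ) (L : List X) :
    prism m N b (gen L) ∈ SuppOn fun K : List (X × (Fin (m + 1) → ℝ)) =>
      K.length = L.length + b ∧ (∀ k ∈ K, k.1 ∈ L) ∧
        ∃ D : List (Fin (m + 1) → ℝ), MonoList ((1 / 2 : ℝ) ^ N) D ∧ ∀ k ∈ K, k.2 ∈ D := by
  refine map_mem_of_suppOn (shuffle₂ (gen L)) (fun D hD => ?_) (subHemi_mem hb N)
  rw [← shuffle_tens, tens_gen]
  refine suppOn_mono ?_ (shuffle_mem (fun _ _ => True) (fun _ _ => True) (fun _ => trivial)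
    (fun _ => trivial) L D (List.pairwise_of_forall fun _ _ => trivial)
    (List.pairwise_of_forall fun _ _ => trivial))
  rintro K ⟨h1, h2, -⟩
  exact ⟨by omega, fun k hk => (h2 k hk).1, D, hD.1, fun k hk => (h2 k hk).2⟩

variable (t : Chain (X × (Fin (m + 1) → ℝ)) →ₗ[ZMod 2] Chain ((X × (Fin (m + 1) → ℝ)) × Y))

/-- The diagonal approximations of a lift composed with the antipode. -/
def twist (a : ℕ) : Chain (X × (Fin (m + 1) → ℝ)) →ₗ[ZMod 2]
    Chain (((X × (Fin (m + 1) → ℝ)) × Y) × ((X × (Fin (m + 1) → ℝ)) × Y)) :=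
  shuffle ∘ₗ tensMap t (t ∘ₗ chainMap flipSnd) ∘ₗ diag (a + 1)

theorem twist_bd (a : ℕ) (c : Chain (X × (Fin (m + 1) → ℝ))) :
    twist t a (bd c) = twist t a (del c) := by
  rw [bd_eq, map_add, map_smul]
  simp only [twist, LinearMap.comp_apply]
  rw [diag_succ_nil, map_zero, map_zero, smul_zero, add_zero]

theorem tensMap_diag_zero_swap (i : ℕ) (c : Chain (X × (Fin (m + 1) → ℝ))) :
    shuffle (tensMap t (t ∘ₗ chainMap flipSnd) (swapPair (diag i c))) =
      chainMap Prod.swap (shuffle (tensMap t (t ∘ₗ chainMap flipSnd)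
        (diag i (chainMap flipSnd c)))) := by
  rw [tensMap_swapPair, shuffle_swapPair, diag_chainMap, tensMap_comp]
  have : (t ∘ₗ chainMap flipSnd) ∘ₗ chainMap flipSnd = t := by
    refine LinearMap.ext fun x => ?_
    simp only [LinearMap.comp_apply]
    rw [flipSnd_flipSnd]
  rw [this]

variable {t} (ht0 : t (gen []) = gen []) (ht : ∀ c, bd (t c) = t (bd c))
include ht0 ht

theorem del_twist_zero (c : Chain (X × (Fin (m + 1) → ℝ))) :
    del (twist t 0 c) = twist t 0 (bd c) := by
  have h0 : ∀ c, shuffle (tensMap t (t ∘ₗ chainMap flipSnd) (diag 0 c)) = 0 := fun c => by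
    refine LinearMap.congr_fun (f := shuffle ∘ₗ tensMap t (t ∘ₗ chainMap flipSnd) ∘ₗ diag 0)
      (g := 0) (lhom_ext fun l => ?_) c
    rw [LinearMap.comp_apply, LinearMap.comp_apply, diag_zero_gen, ← tens_gen, tensMap_tens,
      shuffle_tens, LinearMap.comp_apply, chainMap_nil, ht0, shuffle₂_nil_right]
    rfl
  simp only [twist, LinearMap.comp_apply]
  rw [del_shuffle, tensMap_bdPair ht (fun x => by
    rw [LinearMap.comp_apply, LinearMap.comp_apply, ht, bd_chainMap]), bd_diag_succ,
    map_add, map_add, map_add, map_add, tensMap_diag_zero_swap, h0, h0, map_zero, add_zero,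
    add_zero]

omit ht0 in
theorem del_twist_succ (a : ℕ) (c : Chain (X × (Fin (m + 1) → ℝ))) :
    del (twist t (a + 1) c) = twist t (a + 1) (bd c) +
      (twist t a c + chainMap Prod.swap (twist t a (chainMap flipSnd c))) := by
  simp only [twist, LinearMap.comp_apply]
  rw [del_shuffle, tensMap_bdPair ht (fun x => by
    rw [LinearMap.comp_apply, LinearMap.comp_apply, ht, bd_chainMap]), bd_diag_succ,
    map_add, map_add, map_add, map_add, tensMap_diag_zero_swap, add_assoc]

omit ht0 ht in
/-- The building blocks of the equivariant diagonal chains. -/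
def eqvBlock (t : Chain (X × (Fin (m + 1) → ℝ)) →ₗ[ZMod 2] Chain ((X × (Fin (m + 1) → ℝ)) × Y))
    (N a b : ℕ) : Chain X →ₗ[ZMod 2]
      Chain (((X × (Fin (m + 1) → ℝ)) × Y) × ((X × (Fin (m + 1) → ℝ)) × Y)) :=
  twist t a ∘ₗ ((chainMap flipSnd) ^ a : Module.End (ZMod 2) _) ∘ₗ prism m N b

omit ht0 ht in
/-- The equivariant diagonal chains. -/
def eqvChain (t : Chain (X × (Fin (m + 1) → ℝ)) →ₗ[ZMod 2] Chain ((X × (Fin (m + 1) → ℝ)) × Y))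
    (N i : ℕ) : Chain X →ₗ[ZMod 2]
      Chain (((X × (Fin (m + 1) → ℝ)) × Y) × ((X × (Fin (m + 1) → ℝ)) × Y)) :=
  ∑ p ∈ Finset.HasAntidiagonal.antidiagonal i, eqvBlock t N p.1 p.2

omit ht0 ht in
theorem bd_pow_flip (a : ℕ) (c : Chain (X × (Fin (m + 1) → ℝ))) :
    bd (((chainMap flipSnd) ^ a : Module.End (ZMod 2) _) c) =
      ((chainMap flipSnd) ^ a : Module.End (ZMod 2) _) (bd c) := by
  induction a with
  | zero => rfl
  | succ a ih => rw [pow_succ', Module.End.mul_apply, Module.End.mul_apply, bd_chainMap, ih]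

omit ht0 ht in
theorem twist_pow_flip_bd (a a' : ℕ) (c : Chain (X × (Fin (m + 1) → ℝ))) :
    twist t a (((chainMap flipSnd) ^ a' : Module.End (ZMod 2) _) (bd c)) =
      twist t a (((chainMap flipSnd) ^ a' : Module.End (ZMod 2) _) (del c)) := by
  have h : ((chainMap flipSnd) ^ a' : Module.End (ZMod 2) _)
      (gen ([] : List (X × (Fin (m + 1) → ℝ)))) = gen [] := by
    induction a' with
    | zero => rfl
    | succ a ih => rw [pow_succ', Module.End.mul_apply, ih, chainMap_nil]
  rw [bd_eq, map_add, map_smul, map_add, map_smul, h]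
  simp only [twist, LinearMap.comp_apply]
  rw [diag_succ_nil, map_zero, map_zero, smul_zero, add_zero]

theorem del_eqvChain_succ (N i : ℕ) (c : Chain X) :
    del (eqvChain t N (i + 1) c) = eqvChain t N (i + 1) (bd c) +
      (eqvChain t N i c + chainMap Prod.swap (eqvChain t N i c)) := by
  set τ : Module.End (ZMod 2) (Chain (X × (Fin (m + 1) → ℝ))) := chainMap flipSnd with hτ
  have hττ : ∀ x, τ (τ x) = x := flipSnd_flipSnd
  let G : ℕ → ℕ → Chain (((X × (Fin (m + 1) → ℝ)) × Y) × ((X × (Fin (m + 1) → ℝ)) × Y)) :=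
    fun a b => twist t a ((τ ^ (a + 1)) (prism m N b c))
  let p1 : ℕ × ℕ → Chain (((X × (Fin (m + 1) → ℝ)) × Y) × ((X × (Fin (m + 1) → ℝ)) × Y)) :=
    fun p => match p.2 with
      | 0 => 0
      | b + 1 => eqvBlock t N p.1 b c + G p.1 b
  let p2 : ℕ × ℕ → Chain (((X × (Fin (m + 1) → ℝ)) × Y) × ((X × (Fin (m + 1) → ℝ)) × Y)) :=
    fun p => match p.1 with
      | 0 => 0
      | a + 1 => G a p.2 + chainMap Prod.swap (eqvBlock t N a p.2 c)
  have key : ∀ p : ℕ × ℕ, del (eqvBlock t N p.1 p.2 c) =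
      eqvBlock t N p.1 p.2 (bd c) + p1 p + p2 p := by
    rintro ⟨a, b⟩
    have hP : twist t a (bd ((τ ^ a) (prism m N b c))) =
        eqvBlock t N a b (bd c) + p1 (a, b) := by
      rw [bd_pow_flip, twist_pow_flip_bd]
      cases b with
      | zero => rw [del_prism_zero]; simp only [p1, add_zero]; rfl
      | succ b =>
        rw [del_prism_succ, map_add, map_add, map_add, map_add]
        simp only [p1, G, pow_succ, Module.End.mul_apply]
        rfl
    change del (twist t a ((τ ^ a) (prism m N b c))) = _
    cases a with
    | zero => rw [del_twist_zero ht0 ht, hP]; simp only [p2, add_zero]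
    | succ a =>
      rw [del_twist_succ ht, hP]
      simp only [p2, G]
      rw [pow_succ' τ, Module.End.mul_apply]
      change _ + (_ + chainMap Prod.swap (twist t a (τ (τ ((τ ^ a) (prism m N b c)))))) = _
      rw [hττ]
      rfl
  simp only [eqvChain, LinearMap.sum_apply, map_sum]
  rw [Finset.sum_congr rfl fun p _ => key p, Finset.sum_add_distrib, Finset.sum_add_distrib,
    Finset.Nat.sum_antidiagonal_succ' (f := p1), Finset.Nat.sum_antidiagonal_succ (f := p2)]
  simp only [p1, p2, Finset.sum_add_distrib, zero_add]
  linear_combination (norm := module)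
    add_self_two (∑ x ∈ Finset.HasAntidiagonal.antidiagonal i, G x.1 x.2)

theorem del_eqvChain_zero (N : ℕ) (c : Chain X) :
    del (eqvChain t N 0 c) = eqvChain t N 0 (bd c) := by
  simp only [eqvChain, Finset.Nat.antidiagonal_zero, Finset.sum_singleton, eqvBlock,
    LinearMap.comp_apply, pow_zero, Module.End.one_apply]
  rw [del_twist_zero ht0 ht, twist_bd, del_prism_zero]

omit ht0 ht in
theorem eqvChain_nil (N i : ℕ) : eqvChain t N i (gen []) = 0 := by
  simp only [eqvChain, LinearMap.sum_apply]
  refine Finset.sum_eq_zero fun p _ => ?_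
  simp only [eqvBlock, LinearMap.comp_apply, prism, LinearMap.flip_apply]
  rw [shuffle₂_nil_left, map_zero, map_zero]

omit ht0 ht in
theorem eps_shuffle₂ {V W : Type*} {x : Chain V} {y : Chain W}
    (hx : x ∈ SuppOn fun l => l.length = 1) (hy : y ∈ SuppOn fun l => l.length = 1) :
    eps (shuffle₂ x y) = eps x * eps y := by
  refine eqOn_of_suppOn (eps ∘ₗ shuffle₂.flip y)
    (LinearMap.mulRight (ZMod 2) (eps y) ∘ₗ eps) (fun l hl => ?_) hx
  refine eqOn_of_suppOn (eps ∘ₗ shuffle₂ (gen l))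
    (LinearMap.mulLeft (ZMod 2) (eps (gen l)) ∘ₗ eps) (fun k hk => ?_) hy
  obtain ⟨v, rfl⟩ := List.length_eq_one_iff.1 hl
  obtain ⟨w, rfl⟩ := List.length_eq_one_iff.1 hk
  simp only [LinearMap.comp_apply, LinearMap.mulLeft_apply]
  rw [shuffle₂_singleton, eps_singleton, eps_singleton, eps_singleton, mul_one]

theorem eps_eqvChain_zero (hl : ∀ L, t (gen L) ∈ SuppOn fun M => M.length = L.length) (N : ℕ)
    (x : X) : eps (eqvChain t N 0 (gen [x])) = 1 := by
  have h1 : ∀ z, eps (t (gen [z])) = 1 := fun z => by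
    simp only [eps, LinearMap.comp_apply]
    rw [ht, bd_cons, bd_nil, map_zero, add_zero, ht0]; simp
  simp only [eqvChain, Finset.Nat.antidiagonal_zero, Finset.sum_singleton, eqvBlock,
    LinearMap.comp_apply, pow_zero, Module.End.one_apply, prism, LinearMap.flip_apply,
    subHemi_zero_zero]
  rw [shuffle₂_singleton]
  simp only [twist, LinearMap.comp_apply]
  have h3 (z : X × (Fin (m + 1) → ℝ)) : diag (0 + 1) (gen [z]) = gen ([z], [z]) := by
    rw [← cone_gen, diag_succ_cone, diag_succ_nil, diag_zero_nil, map_zero, zero_add]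
    simp only [lext_gen, Prod.swap_prod_mk]
  rw [h3, ← tens_gen, tensMap_tens, shuffle_tens, eps_shuffle₂ (hl _), h1, one_mul,
    LinearMap.comp_apply, lext_gen, List.map_singleton, h1]
  rw [LinearMap.comp_apply, lext_gen]
  exact hl _

end Lift

section Step

variable {m : ℕ}

theorem neg_mem_crossSphere {u : Fin (m + 1) → ℝ} (hu : u ∈ crossSphere m) :
    -u ∈ crossSphere m := by
  simpa [crossSphere] using hu

theorem eqvChain_mem {X Y : Type*}
    {t : Chain (X × (Fin (m + 1) → ℝ)) →ₗ[ZMod 2] Chain ((X × (Fin (m + 1) → ℝ)) × Y)}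
    {P : List (X × (Fin (m + 1) → ℝ)) → List ((X × (Fin (m + 1) → ℝ)) × Y) → Prop}
    (ht : ∀ L, t (gen L) ∈ SuppOn fun M => M.length = L.length ∧ P L M)
    {i : ℕ} (hi : i ≤ m) (N : ℕ) (L : List X) :
    eqvChain t N i (gen L) ∈ SuppOn fun M => M.length = L.length + i ∧
      ∃ p₁ p₂ M₁ M₂ D, MonoList ((1 / 2 : ℝ) ^ N) D ∧ (∀ x ∈ p₁, x.1 ∈ L ∧ x.2 ∈ D) ∧
        (∀ x ∈ p₂, x.1 ∈ L ∧ -x.2 ∈ D) ∧ P p₁ M₁ ∧ P p₂ M₂ ∧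
        ∀ z ∈ M, z.1 ∈ M₁ ∧ z.2 ∈ M₂ := by
  simp only [eqvChain, LinearMap.sum_apply]
  refine Submodule.sum_mem _ fun p hp => ?_
  have hp' : p.1 + p.2 = i := by simpa using hp
  simp only [eqvBlock, LinearMap.comp_apply]
  have hK : ((chainMap flipSnd) ^ p.1 : Module.End (ZMod 2) _) (prism m N p.2 (gen L)) ∈
      SuppOn fun K : List (X × (Fin (m + 1) → ℝ)) => K.length = L.length + p.2 ∧
        ∃ D : List (Fin (m + 1) → ℝ), MonoList ((1 / 2 : ℝ) ^ N) D ∧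
          ∀ k ∈ K, k.1 ∈ L ∧ k.2 ∈ D := by
    induction p.1 with
    | zero =>
      refine suppOn_mono ?_ (prism_mem (by omega) N L)
      rintro K ⟨h1, h2, D, hD, h3⟩
      exact ⟨h1, D, hD, fun k hk => ⟨h2 k hk, h3 k hk⟩⟩
    | succ a ih =>
      rw [pow_succ', Module.End.mul_apply]
      refine map_mem_of_suppOn _ ?_ ih
      rintro K ⟨h1, D, hD, h3⟩
      rw [lext_gen]
      refine gen_mem ⟨by simpa using h1, _, hD.neg, fun k hk => ?_⟩
      obtain ⟨k', hk', rfl⟩ := List.mem_map.1 hk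
      exact ⟨(h3 k' hk').1, List.mem_map.2 ⟨_, (h3 k' hk').2, rfl⟩⟩
  refine map_mem_of_suppOn _ ?_ hK
  rintro K ⟨h1, D, hD, h3⟩
  simp only [twist, LinearMap.comp_apply]
  refine map_mem_of_suppOn (shuffle ∘ₗ tensMap t (t ∘ₗ chainMap flipSnd)) ?_ (diag_mem _ K)
  rintro ⟨p₁, p₂⟩ ⟨h4, h5, h6⟩
  rw [LinearMap.comp_apply, ← tens_gen, tensMap_tens]
  refine map_mem_of_suppOn _ ?_ (tens_mem (ht p₁) (Q := fun M => M.length = p₂.length ∧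
    P (p₂.map flipSnd) M) ?_)
  · rintro ⟨M₁, M₂⟩ ⟨⟨h7, h8⟩, h9, h10⟩
    refine suppOn_mono ?_ (shuffle_mem (fun _ _ => True) (fun _ _ => True) (fun _ => trivial)
      (fun _ => trivial) M₁ M₂ (List.pairwise_of_forall fun _ _ => trivial)
      (List.pairwise_of_forall fun _ _ => trivial))
    rintro q ⟨h11, h12, -⟩
    dsimp only at *
    refine ⟨by omega, p₁, _, M₁, M₂, D, hD, fun x hx => h3 x (h5 x hx), ?_, h8, h10, h12⟩
    intro x hx
    obtain ⟨k', hk', rfl⟩ := List.mem_map.1 hx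
    have := h3 k' (h6 k' hk')
    exact ⟨this.1, by simpa [flipSnd] using this.2⟩
  · rw [LinearMap.comp_apply, lext_gen]
    exact suppOn_mono (fun M hM => ⟨by simpa using hM.1, hM.2⟩) (ht (p₂.map flipSnd))

open Classical in
/-- The comparison functions used for capping. -/
def capSign {X : Type*} (l : Fin m) (z : ((X × (Fin (m + 1) → ℝ)) × (Fin m → ℝ)) ×
    ((X × (Fin (m + 1) → ℝ)) × (Fin m → ℝ))) : ZMod 2 :=
  if z.2.2 l < z.1.2 l ∨ (z.1.2 l = z.2.2 l ∧ WellOrderingRel z.1.1.2 z.2.1.2) then 1 else 0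

theorem capSign_swap {X : Type*} (l : Fin m) {z : ((X × (Fin (m + 1) → ℝ)) × (Fin m → ℝ)) ×
    ((X × (Fin (m + 1) → ℝ)) × (Fin m → ℝ))} (hz : z.1.1.2 ≠ z.2.1.2) :
    capSign l z.swap = 1 + capSign l z := by
  have h2 : (1 : ZMod 2) + 1 = 0 := rfl
  simp only [capSign, Prod.fst_swap, Prod.snd_swap]
  rcases lt_trichotomy (z.1.2 l) (z.2.2 l) with h | h | h
  · simp [h, h.not_gt, h.ne, h.ne']
  · rcases trichotomous_of WellOrderingRel z.1.1.2 z.2.1.2 with h' | h' | h'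
    · simp [h, h', asymm h', h2]
    · exact absurd h' hz
    · simp [h, h', asymm h']
  · simp [h, h.not_gt, h.ne, h.ne', h2]

/-- The collapse of a pair of lifted points. -/
def collapse {X : Type*} (z : ((X × (Fin (m + 1) → ℝ)) × (Fin m → ℝ)) ×
    ((X × (Fin (m + 1) → ℝ)) × (Fin m → ℝ))) : X × (Fin m → ℝ) :=
  ((Quot.out s(z.1.1.1, z.2.1.1)).1, (1 / 2 : ℝ) • (z.1.2 + z.2.2))

theorem collapse_swap {X : Type*} : (collapse : _ → X × (Fin m → ℝ)) ∘ Prod.swap = collapse := by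
  funext z
  simp only [collapse, Function.comp_apply, Prod.fst_swap, Prod.snd_swap]
  rw [Sym2.eq_swap, add_comm z.2.2]

theorem collapse_fst {X : Type*} (z : ((X × (Fin (m + 1) → ℝ)) × (Fin m → ℝ)) ×
    ((X × (Fin (m + 1) → ℝ)) × (Fin m → ℝ))) :
    (collapse z).1 = z.1.1.1 ∨ (collapse z).1 = z.2.1.1 :=
  Sym2.mem_iff.1 (Sym2.out_fst_mem s(z.1.1.1, z.2.1.1))

/-- The two-point relation induced by a relation along antipodal pairs. -/
def AntipodalRel {B B' Y : Type*} (Ψ : B' → (Fin (m + 1) → ℝ) → B) (H : ℝ → B → Y → Prop)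
    (η : ℝ) (w : B') (y : Y) : Prop :=
  ∃ u ∈ crossSphere m, H η (Ψ w u) y ∧ H η (Ψ w (-u)) y

/-- Uniform continuity along the sphere. -/
def UnifSphere {B B' : Type*} [PseudoMetricSpace B] [PseudoMetricSpace B']
    (Ψ : B' → (Fin (m + 1) → ℝ) → B) : Prop :=
  ∀ η > 0, ∃ δ > 0, ∀ w w', ∀ u ∈ crossSphere m, ∀ u' ∈ crossSphere m,
    dist w w' ≤ δ → dist u u' ≤ δ → dist (Ψ w u) (Ψ w' u') ≤ η

variable {B B' Y : Type*} [PseudoMetricSpace B] [PseudoMetricSpace B'] [PseudoMetricSpace Y]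
  {Ψ : B' → (Fin (m + 1) → ℝ) → B}

theorem StableRel.antipodal {H : ℝ → B → Y → Prop} (hH : StableRel H) (hΨ : UnifSphere Ψ) :
    StableRel (AntipodalRel Ψ H) where
  mono := fun η η' h w y ⟨u, hu, h1, h2⟩ => ⟨u, hu, hH.mono h h1, hH.mono h h2⟩
  stable := fun η hη => by
    obtain ⟨η₁, h1, h2⟩ := hH.stable η hη
    obtain ⟨δ, h3, h4⟩ := hΨ η₁ h1
    refine ⟨min η₁ δ, lt_min h1 h3, ?_⟩
    rintro w w' y y' ⟨u, hu, h5, h6⟩ hw hy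
    have hw' := hw.trans (min_le_right _ _)
    have hy' := hy.trans (min_le_left _ _)
    exact ⟨u, hu, h2 (hH.mono (min_le_left _ _) h5) (h4 _ _ u hu u hu hw' (by simpa using h3.le)) hy',
      h2 (hH.mono (min_le_left _ _) h6) (h4 _ _ _ (neg_mem_crossSphere hu) _
        (neg_mem_crossSphere hu) hw' (by simpa using h3.le)) hy'⟩

section Chains

variable {X : Type*} {t : Chain (X × (Fin (m + 1) → ℝ)) →ₗ[ZMod 2]
  Chain ((X × (Fin (m + 1) → ℝ)) × (Fin m → ℝ))}

/-- The list of comparison functions. -/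
def capSigns (m : ℕ) (X : Type*) : List (((X × (Fin (m + 1) → ℝ)) × (Fin m → ℝ)) ×
    ((X × (Fin (m + 1) → ℝ)) × (Fin m → ℝ)) → ZMod 2) :=
  List.ofFn fun l : Fin m => capSign l

/-- The lift through a two-point relation. -/
def stepLift (t : Chain (X × (Fin (m + 1) → ℝ)) →ₗ[ZMod 2]
    Chain ((X × (Fin (m + 1) → ℝ)) × (Fin m → ℝ))) (N : ℕ) :
    Chain X →ₗ[ZMod 2] Chain (X × (Fin m → ℝ)) :=
  chainMap collapse ∘ₗ kaps (capSigns m X) ∘ₗ eqvChain t N m +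
    (LinearMap.toSpanSingleton (ZMod 2) _ (gen [])) ∘ₗ nilCoeff

theorem stepLift_nil (N : ℕ) : stepLift t N (gen []) = gen [] := by
  simp only [stepLift, LinearMap.add_apply, LinearMap.comp_apply]
  rw [eqvChain_nil]
  simp

variable (ht0 : t (gen []) = gen []) (ht : ∀ c, bd (t c) = t (bd c))
  (htl : ∀ L, t (gen L) ∈ SuppOn fun M => M.length = L.length ∧ ∀ z ∈ M, z.1 ∈ L)

include htl in
theorem eqvChain_capSign {i : ℕ} (hi : i ≤ m) (N : ℕ) (c : Chain X) : eqvChain t N i c ∈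
    SuppOn fun M => ∀ z ∈ M, ∀ s ∈ capSigns m X, s z.swap = 1 + s z := by
  refine map_mem_of_suppOn _ (fun L _ => ?_) (suppOn_true c)
  refine suppOn_mono ?_ (eqvChain_mem htl hi N L)
  rintro M ⟨-, p₁, p₂, M₁, M₂, D, hD, h1, h2, h3, h4, h5⟩ z hz s hs
  obtain ⟨l, rfl⟩ := (List.mem_ofFn' _ _).1 hs
  refine capSign_swap l fun h => ?_
  have h6 := (h1 _ (h3 _ (h5 z hz).1)).2
  have h7 := (h2 _ (h4 _ (h5 z hz).2)).2
  exact hD.ne_neg h6 h7 (by rw [neg_neg, h])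

include ht0 ht htl

theorem del_collapse_kaps (N : ℕ) (c : Chain X) :
    del (chainMap collapse (kaps (capSigns m X) (eqvChain t N m c))) =
      chainMap collapse (kaps (capSigns m X) (eqvChain t N m (bd c))) := by
  rw [del_chainMap, del_kaps]
  obtain _ | i := m
  · rw [del_eqvChain_zero ht0 ht]
  · rw [del_eqvChain_succ ht0 ht, map_add, map_add, map_add, map_add,
      kaps_chainMap (eqvChain_capSign htl (by omega) N c), push_comp]
    have : List.map collapse ∘ List.map Prod.swap = List.map (collapse : _ → X × (Fin (i + 1) → ℝ)) := by
      funext l; simp [collapse_swap]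
    rw [this, add_self_two, add_zero]

theorem eps_collapse_kaps (N : ℕ) (L : List X) :
    eps (chainMap collapse (kaps (capSigns m X) (eqvChain t N m (gen L)))) =
      nilCoeff (bd (gen L)) := by
  rw [eps_chainMap]
  match L with
  | [] => rw [eqvChain_nil, map_zero, map_zero, bd_nil, map_zero]
  | [x] =>
    have hlen : (capSigns m X).length = m := by simp [capSigns]
    have := eps_kaps (capSigns m X) (φ := Prod.swap) (fun i => eqvChain t N i (gen [x]))
      (fun i hi => by
        rw [del_eqvChain_succ ht0 ht, bd_cons, bd_nil, map_zero, add_zero, eqvChain_nil,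
          zero_add])
      (fun i hi => eqvChain_capSign htl (by omega) N _)
    rw [hlen] at this
    rw [this, eps_eqvChain_zero ht0 ht (fun L => suppOn_mono (fun _ h => h.1) (htl L))]
    simp
  | x :: x' :: L =>
    have h1 : nilCoeff (bd (gen (x :: x' :: L))) = 0 := by
      by_contra h
      have := suppOn_mem (bd_length (n := L.length + 1) (gen_mem (a := x :: x' :: L) rfl)) (a := []) h
      simp at this
    rw [h1]
    refine eps_eq_zero_of_length (n := L.length) (map_mem_of_suppOn _ (fun M hM => ?_)
      (eqvChain_mem htl le_rfl N (x :: x' :: L)))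
    refine suppOn_mono (fun q hq => ?_) (kaps_mem _ M)
    have := hq.1
    rw [hM.1] at this
    simp [capSigns] at this
    omega

theorem bd_stepLift (N : ℕ) (c : Chain X) : bd (stepLift t N c) = stepLift t N (bd c) := by
  refine LinearMap.congr_fun (f := bd ∘ₗ stepLift t N) (g := stepLift t N ∘ₗ bd)
    (lhom_ext fun L => ?_) c
  simp only [stepLift, LinearMap.add_apply, LinearMap.comp_apply, map_add bd]
  rw [bd_eq_eps (chainMap collapse _), del_collapse_kaps ht0 ht htl, eps_collapse_kaps ht0 ht htl,
    LinearMap.toSpanSingleton_apply, LinearMap.toSpanSingleton_apply, map_smul, bd_nil, smul_zero,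
    add_zero]

end Chains

theorem Lifts.antipodal {H : ℝ → B → (Fin m → ℝ) → Prop} (hH : Lifts H) (hS : StableRel H)
    (hΨ : UnifSphere Ψ) : Lifts (AntipodalRel Ψ H) := by
  intro η hη
  obtain ⟨η₁, hη₁, hst⟩ := hS.stable η hη
  set η₂ := min η η₁ with hη₂
  have hη₂' : 0 < η₂ := lt_min hη hη₁
  obtain ⟨δ', hδ', hlift⟩ := hH η₂ hη₂'
  obtain ⟨δ, hδ, hδΨ⟩ := hΨ (min δ' η₁) (lt_min hδ' hη₁)
  obtain ⟨N, hN⟩ := exists_pow_lt_of_lt_one (half_pos hδ) (by norm_num : (1 / 2 : ℝ) < 1)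
  refine ⟨δ, hδ, fun X β => ?_⟩
  obtain ⟨t, ht0, ht, hts⟩ := hlift (X × (Fin (m + 1) → ℝ)) fun x => Ψ (β x.1) x.2
  have htl : ∀ L, t (gen L) ∈ SuppOn fun M => M.length = L.length ∧ ∀ z ∈ M, z.1 ∈ L :=
    fun L => suppOn_mono (fun _ h => ⟨h.1, h.2.1⟩) (hts L)
  refine ⟨stepLift t N, stepLift_nil N, bd_stepLift ht0 ht htl N, fun L => ?_⟩
  simp only [stepLift, LinearMap.add_apply, LinearMap.comp_apply]
  refine Submodule.add_mem _ ?_ ?_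
  swap
  · rw [LinearMap.toSpanSingleton_apply]
    cases L with
    | nil => exact Submodule.smul_mem _ _ (gen_mem (by simp))
    | cons x L => simp
  refine map_mem_of_suppOn (chainMap collapse ∘ₗ kaps (capSigns m X)) (fun M hM => ?_)
    (eqvChain_mem hts le_rfl N L)
  rw [LinearMap.comp_apply]
  refine map_mem_of_suppOn _ (fun q hq => ?_) (kaps_mem (capSigns m X) M)
  obtain ⟨h1, p₁, p₂, M₁, M₂, D, hD, hp1, hp2, ⟨hM1, hM1'⟩, ⟨hM2, hM2'⟩, h5⟩ := hM
  obtain ⟨hq1, hq2, hq3⟩ := hq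
  rw [lext_gen]
  have hmem : ∀ z ∈ M, (collapse z).1 ∈ L := fun z hz => by
    rcases collapse_fst z with h | h <;> rw [h]
    · exact (hp1 _ (hM1 _ (h5 z hz).1)).1
    · exact (hp2 _ (hM2 _ (h5 z hz).2)).1
  refine gen_mem ⟨?_, ?_, fun hsmall => ?_⟩
  · simp [capSigns] at hq1 ⊢; omega
  · intro y hy
    obtain ⟨z, hz, rfl⟩ := List.mem_map.1 hy
    exact hmem z (hq2 z hz)
  have hh : (0 : ℝ) ≤ (1 / 2) ^ N := by positivity
  have hsph : ∀ u ∈ D, u ∈ crossSphere m := fun u hu => by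
    obtain ⟨e, -, h, -⟩ := hD
    exact (h u hu).2
  have hDd : ∀ u ∈ D, ∀ u' ∈ D, dist u u' ≤ δ := fun u hu u' hu' =>
    (hD.dist_le hh hu hu').trans (by linarith)
  have hsph' : ∀ u, -u ∈ D → u ∈ crossSphere m := fun u hu => by
    simpa using neg_mem_crossSphere (hsph _ hu)
  obtain ⟨hd1, hH1⟩ := hM1' fun x hx x' hx' => (hδΨ _ _ _ (hsph _ (hp1 x hx).2) _
    (hsph _ (hp1 x' hx').2) (hsmall _ (hp1 x hx).1 _ (hp1 x' hx').1)
    (hDd _ (hp1 x hx).2 _ (hp1 x' hx').2)).trans (min_le_left _ _)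
  obtain ⟨hd2, hH2⟩ := hM2' fun x hx x' hx' => (hδΨ _ _ _ (hsph' _ (hp2 x hx).2) _
    (hsph' _ (hp2 x' hx').2) (hsmall _ (hp2 x hx).1 _ (hp2 x' hx').1)
    (by simpa [dist_neg_neg] using hDd _ (hp2 x hx).2 _ (hp2 x' hx').2)).trans (min_le_left _ _)
  have hc1 : ∀ z ∈ M, ∀ z' ∈ M, ∀ l, |z.1.2 l - z'.1.2 l| ≤ η₂ := fun z hz z' hz' l =>
    (dist_le_pi_dist z.1.2 z'.1.2 l).trans (hd1 _ (h5 z hz).1 _ (h5 z' hz').1)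
  have hc2 : ∀ z ∈ M, ∀ z' ∈ M, ∀ l, |z.2.2 l - z'.2.2 l| ≤ η₂ := fun z hz z' hz' l =>
    (dist_le_pi_dist z.2.2 z'.2.2 l).trans (hd2 _ (h5 z hz).2 _ (h5 z' hz').2)
  have hc3 : ∀ z ∈ M, ∀ l, |z.1.2 l - z.2.2 l| ≤ 2 * η₂ := fun z hz l => by
    obtain ⟨⟨z0, hz0, h0⟩, z1, hz1, h1⟩ := hq3 (capSign l) ((List.mem_ofFn' _ _).2 ⟨l, rfl⟩)
    have h0' : z0.1.2 l ≤ z0.2.2 l := by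
      by_contra! h
      simp [capSign, h] at h0
    have h1' : z1.2.2 l ≤ z1.1.2 l := by
      by_contra! h
      simp [capSign, h.not_gt, h.ne] at h1
    have a1 := abs_le.1 (hc1 z hz z0 hz0 l)
    have a2 := abs_le.1 (hc2 z hz z0 hz0 l)
    have a3 := abs_le.1 (hc1 z hz z1 hz1 l)
    have a4 := abs_le.1 (hc2 z hz z1 hz1 l)
    rw [abs_le]; constructor <;> linarith
  have hcol : ∀ z l, (collapse z : X × (Fin m → ℝ)).2 l = (z.1.2 l + z.2.2 l) / 2 := fun z l => by
    simp [collapse]; ring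
  constructor
  · intro y hy y' hy'
    obtain ⟨z, hz, rfl⟩ := List.mem_map.1 hy
    obtain ⟨z', hz', rfl⟩ := List.mem_map.1 hy'
    refine (dist_pi_le_iff hη.le).2 fun l => ?_
    have a1 := abs_le.1 (hc1 z (hq2 z hz) z' (hq2 z' hz') l)
    have a2 := abs_le.1 (hc2 z (hq2 z hz) z' (hq2 z' hz') l)
    have a3 : η₂ ≤ η := min_le_left _ _
    rw [Real.dist_eq, hcol, hcol, abs_le]
    constructor <;> linarith
  · intro y hy
    obtain ⟨z, hz, rfl⟩ := List.mem_map.1 hy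
    have hzM := hq2 z hz
    have hz1 := h5 z hzM
    have hx1 := hp1 _ (hM1 _ hz1.1)
    have hx2 := hp2 _ (hM2 _ hz1.2)
    have a3 : η₂ ≤ η₁ := min_le_right _ _
    refine ⟨z.1.1.2, hsph _ hx1.2, hst (hS.mono a3 (hH1 _ hz1.1)) ?_ ?_,
      hst (hS.mono a3 (hH2 _ hz1.2)) ?_ ?_⟩
    · exact (hδΨ _ _ _ (hsph _ hx1.2) _ (hsph _ hx1.2) (hsmall _ hx1.1 _ (hmem z hzM))
        (by simpa using hδ.le)).trans (min_le_right _ _)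
    · refine (dist_pi_le_iff hη₁.le).2 fun l => ?_
      have := abs_le.1 (hc3 z hzM l)
      rw [Real.dist_eq, hcol, abs_le]
      constructor <;> linarith
    · refine (hδΨ _ _ _ (hsph' _ hx2.2) _ (neg_mem_crossSphere (hsph _ hx1.2))
        (hsmall _ hx2.1 _ (hmem z hzM)) ?_).trans (min_le_right _ _)
      have := hDd _ hx2.2 _ hx1.2
      rw [← dist_neg_neg]
      simpa using this
    · refine (dist_pi_le_iff hη₁.le).2 fun l => ?_
      have := abs_le.1 (hc3 z hzM l)
      rw [Real.dist_eq, hcol, abs_le]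
      constructor <;> linarith

theorem stableRel_dist {f : B → Y} (hf : UniformContinuous f) :
    StableRel fun η v y => dist (f v) y ≤ η where
  mono := fun η η' h v y h' => h'.trans h
  stable := fun η hη => by
    obtain ⟨δ, hδ, h⟩ := Metric.uniformContinuous_iff.1 hf (η / 3) (by positivity)
    refine ⟨min (δ / 2) (η / 3), by positivity, fun v v' y y' h1 h2 h3 => ?_⟩
    have h4 : dist (f v) (f v') < η / 3 :=
      h (lt_of_le_of_lt (h2.trans (min_le_left _ _)) (by linarith))
    have h5 := h1.trans (min_le_right _ _)
    have h6 := h3.trans (min_le_right _ _)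
    rw [dist_comm] at h4
    linarith [dist_triangle4 (f v') (f v) y y']

theorem lifts_dist {f : B → Y} (hf : UniformContinuous f) :
    Lifts fun η v y => dist (f v) y ≤ η := by
  intro η hη
  obtain ⟨δ, hδ, h⟩ := Metric.uniformContinuous_iff.1 hf η hη
  refine ⟨δ / 2, by positivity, fun X β => ⟨chainMap fun x => (x, f (β x)), chainMap_nil _,
    fun c => bd_chainMap _ c, fun L => ?_⟩⟩
  rw [lext_gen]
  refine gen_mem ⟨by simp, ?_, fun hs => ⟨?_, ?_⟩⟩
  · intro z hz
    obtain ⟨x, hx, rfl⟩ := List.mem_map.1 hz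
    exact hx
  · intro z hz z' hz'
    obtain ⟨x, hx, rfl⟩ := List.mem_map.1 hz
    obtain ⟨x', hx', rfl⟩ := List.mem_map.1 hz'
    exact (h (lt_of_le_of_lt (hs x hx x' hx') (by linarith))).le
  · intro z hz
    obtain ⟨x, hx, rfl⟩ := List.mem_map.1 hz
    simpa using hη.le

/-- Every point is related to something by a liftable family of relations. -/
theorem Lifts.exists_rel {H : ℝ → B → Y → Prop} (hH : Lifts H) {η : ℝ} (hη : 0 < η) (w : B) :
    ∃ y, H η w y := by
  obtain ⟨δ, hδ, h⟩ := hH η hη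
  obtain ⟨t, ht0, ht, hts⟩ := h Unit fun _ => w
  have h1 : t (gen [()]) ≠ 0 := fun h0 => by
    have := ht (gen [()])
    rw [h0, map_zero, bd_cons, bd_nil, map_zero, add_zero, ht0] at this
    exact one_ne_zero (Finsupp.single_eq_zero.1 this.symm)
  obtain ⟨M, hM⟩ := Finsupp.ne_iff.1 h1
  obtain ⟨h2, -, h3⟩ := suppOn_mem (hts [()]) (a := M) (by simpa using hM)
  obtain ⟨z, rfl⟩ := List.length_eq_one_iff.1 h2
  exact ⟨z.2, (h3 fun _ _ _ _ => by simpa using hδ.le).2 z (by simp)⟩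

end Step

section BorsukUlam

/-- Approximate Borsuk–Ulam theorem. -/
theorem borsuk_ulam_approx {m : ℕ} {f : (Fin (m + 1) → ℝ) → Fin m → ℝ} (hf : UniformContinuous f)
    {η : ℝ} (hη : 0 < η) : ∃ u ∈ crossSphere m, dist (f u) (f (-u)) ≤ η := by
  have hΨ : UnifSphere (m := m) fun (_ : Unit) u => u := fun η hη =>
    ⟨η, hη, fun _ _ _ _ _ _ _ h => h⟩
  obtain ⟨y, u, hu, h1, h2⟩ := ((lifts_dist hf).antipodal (stableRel_dist hf) hΨ).exists_rel
    (half_pos hη) ()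
  refine ⟨u, hu, ?_⟩
  rw [dist_comm (f (-u))] at h2
  linarith [dist_triangle (f u) y (f (-u))]

end BorsukUlam

section Miranda

/-- Coordinatewise truncation to `[a, b]`. -/
def clip {ι : Type*} (a b : ℝ) (u : ι → ℝ) : ι → ℝ := fun i => max a (min b (u i))

theorem clip_mem {ι : Type*} {a b : ℝ} (h : a ≤ b) (u : ι → ℝ) (i : ι) : clip a b u i ∈ Set.Icc a b :=
  ⟨le_max_left _ _, max_le h (min_le_left _ _)⟩

theorem clip_eq_self {ι : Type*} {a b : ℝ} {u : ι → ℝ} (h : ∀ i, u i ∈ Set.Icc a b) :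
    clip a b u = u := by
  funext i
  simp [clip, (h i).1, (h i).2]

theorem dist_clip_le {ι : Type*} [Fintype ι] (a b : ℝ) (u v : ι → ℝ) :
    dist (clip a b u) (clip a b v) ≤ dist u v := by
  refine (dist_pi_le_iff dist_nonneg).2 fun i => ?_
  have h : LipschitzWith 1 fun x : ℝ => max a (min b x) := (LipschitzWith.id.const_min b).const_max a
  have h1 := h.dist_le_mul (u i) (v i)
  rw [NNReal.coe_one, one_mul] at h1
  exact h1.trans (dist_le_pi_dist u v i)

theorem uniformContinuous_clip {ι : Type*} [Fintype ι] (a b : ℝ) :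
    UniformContinuous (clip a b : (ι → ℝ) → ι → ℝ) :=
  (LipschitzWith.of_dist_le_mul (K := 1) fun u v => by simpa using dist_clip_le a b u v).uniformContinuous

theorem uniformContinuous_comp_clip {ι Y : Type*} [Fintype ι] [PseudoMetricSpace Y]
    {f : (ι → ℝ) → Y} {a b : ℝ} (h : a ≤ b)
    (hf : ContinuousOn f (Set.pi Set.univ fun _ => Set.Icc a b)) :
    UniformContinuous fun u => f (clip a b u) := by
  have h1 := (isCompact_univ_pi fun _ : ι => isCompact_Icc (a := a) (b := b)).uniformContinuousOn_of_continuous hf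
  rw [← uniformContinuousOn_univ]
  exact h1.comp (uniformContinuous_clip a b).uniformContinuousOn fun u _ => fun i _ => clip_mem h u i

theorem isCompact_crossSphere (m : ℕ) : IsCompact (crossSphere m) := by
  refine (isCompact_univ_pi fun _ : Fin (m + 1) => isCompact_Icc (a := (-1 : ℝ)) (b := 1)).of_isClosed_subset
    (isClosed_eq (by fun_prop) continuous_const) fun u hu i _ => ?_
  have h : |u i| ≤ 1 := (Finset.single_le_sum (f := fun i => |u i|) (fun _ _ => abs_nonneg _) (Finset.mem_univ i)).trans_eq hu
  exact abs_le.1 h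

theorem abs_le_one_of_mem_crossSphere {m : ℕ} {u : Fin (m + 1) → ℝ} (hu : u ∈ crossSphere m)
    (i : Fin (m + 1)) : |u i| ≤ 1 :=
  (Finset.single_le_sum (f := fun i => |u i|) (fun _ _ => abs_nonneg _)
    (Finset.mem_univ i)).trans_eq hu

/-- The Borsuk–Ulam theorem. -/
theorem borsuk_ulam {m : ℕ} {f : (Fin (m + 1) → ℝ) → Fin m → ℝ} (hf : Continuous f) :
    ∃ u ∈ crossSphere m, f u = f (-u) := by
  obtain ⟨u, hu, hmin⟩ := (isCompact_crossSphere m).exists_isMinOn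
    ⟨_, crossVertex_mem (Nat.zero_le m)⟩
    (f := fun u => dist (f u) (f (-u))) (by fun_prop)
  refine ⟨u, hu, ?_⟩
  by_contra h
  have h0 : 0 < dist (f u) (f (-u)) := dist_pos.2 h
  obtain ⟨v, hv, h1⟩ := borsuk_ulam_approx (uniformContinuous_comp_clip (f := f)
    (by norm_num : (-1 : ℝ) ≤ 1) hf.continuousOn) (half_pos h0)
  rw [clip_eq_self fun i => abs_le.1 (abs_le_one_of_mem_crossSphere hv i),
    clip_eq_self fun i => abs_le.1 (abs_le_one_of_mem_crossSphere (neg_mem_crossSphere hv) i)] at h1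
  have := hmin hv
  simp only [Set.mem_ofPred_eq] at this
  linarith

/-- The Poincaré–Miranda theorem. -/
theorem poincare_miranda {n : ℕ} {G : (Fin n → ℝ) → Fin n → ℝ} (hG : Continuous G)
    (hneg : ∀ v i, (∀ j, v j ∈ Set.Icc (-1 : ℝ) 1) → v i = -1 → G v i < 0)
    (hpos : ∀ v i, (∀ j, v j ∈ Set.Icc (-1 : ℝ) 1) → v i = 1 → 0 < G v i) :
    ∃ v, (∀ j, v j ∈ Set.Icc (-1 : ℝ) 1) ∧ G v = 0 := by
  let τ : ℝ → ℝ := fun t => max 0 (min 1 (1 + 2 * t))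
  let c : (Fin (n + 1) → ℝ) → Fin n → ℝ := fun u => clip (-1) 1 fun i => 2 * n * u i.succ
  have hc : Continuous c := (uniformContinuous_clip _ _).continuous.comp (by fun_prop)
  have hcm : ∀ u i, c u i ∈ Set.Icc (-1 : ℝ) 1 := fun u i => clip_mem (by norm_num) _ i
  have key : ∃ u ∈ crossSphere n, 0 ≤ u 0 ∧ τ (u 0) • G (c u) = τ (-u 0) • G (c (-u)) := by
    obtain ⟨u, hu, h⟩ := borsuk_ulam (f := fun u => τ (u 0) • G (c u)) (by fun_prop)
    rcases le_total 0 (u 0) with h0 | h0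
    · exact ⟨u, hu, h0, by simpa using h⟩
    · exact ⟨-u, neg_mem_crossSphere hu, by simpa using h0, by simpa using h.symm⟩
  obtain ⟨u, hu, h0, h⟩ := key
  have h1 : τ (u 0) = 1 := by simp only [τ]; rw [min_eq_left (by linarith)]; norm_num
  rw [h1, one_smul] at h
  rcases le_or_gt (1 / 2) (u 0) with h2 | h2
  · have h3 : τ (-u 0) = 0 := by
      simp only [τ]
      exact max_eq_left ((min_le_right _ _).trans (by linarith))
    exact ⟨c u, hcm u, by rw [h, h3, zero_smul]⟩
  exfalso
  have h3 : ∃ i : Fin n, 1 ≤ |2 * n * u i.succ| := by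
    by_contra! hlt
    have h4 : |u 0| + ∑ i : Fin n, |u i.succ| = 1 := by
      have h5 : ∑ i, |u i| = 1 := hu
      rwa [Fin.sum_univ_succ] at h5
    rw [abs_of_nonneg h0] at h4
    have h6 : ∑ i : Fin n, |2 * n * u i.succ| ≤ ∑ i : Fin n, 1 := Finset.sum_le_sum fun i _ => (hlt i).le
    simp only [abs_mul, Nat.abs_ofNat, Nat.abs_cast, ← Finset.mul_sum] at h6
    simp at h6
    rcases Nat.eq_zero_or_pos n with rfl | hn
    · simp at h4; linarith
    · have : (0 : ℝ) < n := by exact_mod_cast hn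
      nlinarith
  obtain ⟨i, hi⟩ := h3
  have hτ : 0 ≤ τ (-u 0) := le_max_left _ _
  have hi' := congrFun h i
  simp only [Pi.smul_apply, smul_eq_mul] at hi'
  rcases le_abs.1 hi with h4 | h4
  · have e1 : c u i = 1 := by simp [c, clip, h4]
    have e2 : c (-u) i = -1 := by
      simp only [c, clip, Pi.neg_apply]
      exact max_eq_left ((min_le_right _ _).trans (by linarith))
    have := hpos _ i (hcm u) e1
    have := hneg _ i (hcm (-u)) e2
    nlinarith
  · have e2 : c (-u) i = 1 := by
      simp only [c, clip, Pi.neg_apply]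
      rw [min_eq_left (by linarith)]; norm_num
    have e1 : c u i = -1 := by
      simp only [c, clip]
      exact max_eq_left ((min_le_right _ _).trans (by linarith))
    have := hneg _ i (hcm u) e1
    have := hpos _ i (hcm (-u)) e2
    nlinarith

end Miranda

/-! ### Blending maps along partitions of an interval -/

section Blend

/-- The distance to the nearest even integer. -/
def fold (x : ℝ) : ℝ := |x - 2 * round (x / 2)|

theorem fold_nonneg (x : ℝ) : 0 ≤ fold x := abs_nonneg _

theorem fold_le_abs (x : ℝ) (z : ℤ) : fold x ≤ |x - 2 * z| := by
  have h := round_le (x / 2) z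
  have e : ∀ y : ℝ, |x - 2 * y| = 2 * |x / 2 - y| := fun y => by
    rw [← abs_of_pos (two_pos (α := ℝ)), ← abs_mul, abs_of_pos (two_pos (α := ℝ))]; congr 1; ring
  rw [fold, e, e]
  linarith

theorem fold_le_one (x : ℝ) : fold x ≤ 1 := by
  have h := abs_sub_round (x / 2)
  have e : |x - 2 * round (x / 2)| = 2 * |x / 2 - round (x / 2)| := by
    rw [← abs_of_pos (two_pos (α := ℝ)), ← abs_mul, abs_of_pos (two_pos (α := ℝ))]; congr 1; ring
  rw [fold, e]
  linarith

theorem abs_fold_sub_le (x y : ℝ) : |fold x - fold y| ≤ |x - y| := by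
  have key : ∀ x y, fold x - fold y ≤ |x - y| := fun x y => by
    have h := fold_le_abs x (round (y / 2))
    have h2 : |x - 2 * round (y / 2)| ≤ |x - y| + |y - 2 * round (y / 2)| := abs_sub_le _ _ _
    rw [fold] at *
    rw [fold]
    linarith
  rw [abs_le]
  have h1 := key x y
  have h2 := key y x
  rw [abs_sub_comm] at h2
  constructor <;> linarith

theorem continuous_fold : Continuous fold :=
  (LipschitzWith.of_dist_le_mul (K := 1) fun x y => by
    simpa [Real.dist_eq] using abs_fold_sub_le x y).continuous

/-- On an interval between consecutive integers `fold` is an isometry. -/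
theorem fold_of_mem (p : ℤ) : (∀ x ∈ Set.Icc (p : ℝ) (p + 1), fold x = x - p) ∨
    ∀ x ∈ Set.Icc (p : ℝ) (p + 1), fold x = p + 1 - x := by
  rcases Int.even_or_odd' p with ⟨q, rfl | rfl⟩
  · left
    rintro x ⟨h1, h2⟩
    push_cast at *
    refine le_antisymm ?_ ?_
    · have := fold_le_abs x q
      rwa [abs_of_nonneg (by linarith)] at this
    · rw [fold]
      rcases le_or_gt (round (x / 2)) q with h | h
      · have : (round (x / 2) : ℝ) ≤ q := by exact_mod_cast h
        exact le_trans (by linarith) (le_abs_self _)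
      · have : (q : ℝ) + 1 ≤ round (x / 2) := by exact_mod_cast h
        exact le_trans (by linarith) (neg_le_abs _)
  · right
    rintro x ⟨h1, h2⟩
    push_cast at *
    refine le_antisymm ?_ ?_
    · have := fold_le_abs x (q + 1)
      push_cast at this
      rw [abs_of_nonpos (by linarith)] at this
      linarith
    · rw [fold]
      rcases le_or_gt (round (x / 2)) q with h | h
      · have : (round (x / 2) : ℝ) ≤ q := by exact_mod_cast h
        exact le_trans (by linarith) (le_abs_self _)
      · have : (q : ℝ) + 1 ≤ round (x / 2) := by exact_mod_cast h
        exact le_trans (by linarith) (neg_le_abs _)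

/-- The ramp function increasing from `0` at `l` to `1` at `l + 1`. -/
def ramp (l : ℕ) (x : ℝ) : ℝ := max 0 (min 1 (x - l))

theorem ramp_nonneg (l : ℕ) (x : ℝ) : 0 ≤ ramp l x := le_max_left _ _

theorem ramp_le_one (l : ℕ) (x : ℝ) : ramp l x ≤ 1 := max_le zero_le_one (min_le_left _ _)

theorem ramp_mono (l : ℕ) : Monotone (ramp l) := fun x y h => by unfold ramp; gcongr

theorem ramp_of_le {l : ℕ} {x : ℝ} (h : x ≤ l) : ramp l x = 0 :=
  max_eq_left ((min_le_right _ _).trans (by linarith))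

theorem ramp_of_ge {l : ℕ} {x : ℝ} (h : (l : ℝ) + 1 ≤ x) : ramp l x = 1 := by
  rw [ramp, min_eq_left (by linarith)]; norm_num

theorem abs_ramp_sub_le (l : ℕ) (x y : ℝ) : |ramp l x - ramp l y| ≤ |x - y| := by
  have h : LipschitzWith 1 fun x : ℝ => max 0 (min 1 x) :=
    (LipschitzWith.id.const_min 1).const_max 0
  have := h.dist_le_mul (x - l) (y - l)
  rw [NNReal.coe_one, one_mul, dist_sub_right] at this
  exact this

variable {m n j : ℕ}

/-- The share of the `i`-th piece of a partition in the `l`-th unit interval. -/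
def share (P : ℕ → ℝ) (l i : ℕ) : ℝ := ramp l (P (i + 1)) - ramp l (P i)

/-- Partitions of `[0, n]` into `m + 1` pieces. -/
structure IsPartition (m n : ℕ) (P : ℕ → ℝ) : Prop where
  mono : Monotone P
  zero : P 0 = 0
  top : ∀ k, m < k → P k = n

theorem IsPartition.share_nonneg {P : ℕ → ℝ} (hP : IsPartition m n P) (l i : ℕ) : 0 ≤ share P l i :=
  sub_nonneg.2 (ramp_mono l (hP.mono (Nat.le_succ i)))

theorem IsPartition.sum_share {P : ℕ → ℝ} (hP : IsPartition m n P) {l : ℕ} (hl : l < n) :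
    ∑ i : Fin (m + 1), share P l i = 1 := by
  rw [Fin.sum_univ_eq_sum_range (fun i => share P l i)]
  simp only [share]
  have h0 : ramp l 0 = 0 := ramp_of_le (by positivity)
  have h1 : ramp l n = 1 := ramp_of_ge (by exact_mod_cast hl)
  rw [Finset.sum_range_sub (fun i => ramp l (P i)), hP.zero, hP.top _ (Nat.lt_succ_self m),
    h0, h1, sub_zero]

/-- The indices of branches. -/
abbrev Br (m : ℕ) := Bool × Fin (m + 1)

/-- The indices of the coordinates at the `j`-th level of the tree. -/
abbrev Idx (n m j : ℕ) := Fin n × (Fin j → Br m)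

/-- Extending an index by a branch. -/
def Idx.ext (a : Idx n m j) (b : Br m) : Idx n m (j + 1) := (a.1, Fin.cons b a.2)

theorem Idx.ext_inj {a a' : Idx n m j} {b b' : Br m} (h : a.ext b = a'.ext b') : a = a' ∧ b = b' := by
  obtain ⟨h1, h2⟩ := Prod.ext_iff.1 h
  obtain ⟨h3, h4⟩ := Fin.cons_injective2 (α := fun _ => Br m) h2
  exact ⟨Prod.ext h1 h4, h3⟩

/-- Truncation to `[0, K]`. -/
def trunc (K x : ℝ) : ℝ := max 0 (min K x)

theorem abs_trunc_sub_le (K x y : ℝ) : |trunc K x - trunc K y| ≤ |x - y| := by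
  have h : LipschitzWith 1 fun x : ℝ => max 0 (min K x) :=
    (LipschitzWith.id.const_min K).const_max 0
  have := h.dist_le_mul x y
  rw [NNReal.coe_one, one_mul] at this
  exact this

theorem abs_trunc_le {K : ℝ} (hK : 0 ≤ K) (x : ℝ) : |trunc K x| ≤ K := by
  rw [abs_of_nonneg (le_max_left _ _)]
  exact max_le hK (min_le_left _ _)

theorem trunc_of_mem {K x : ℝ} (hx : x ∈ Set.Icc 0 K) : trunc K x = x := by
  simp [trunc, hx.1, hx.2]

/-- The mixture of the truncated values `w` according to shares. -/
def mix (K : ℝ) (P : ℕ → ℝ) (s : Fin (m + 1) → Bool) (l : ℕ) (w : Br m → ℝ) : ℝ :=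
  ∑ i : Fin (m + 1), share P l i * trunc K (w (s i, i))

/-- The blending map of the tree. -/
def blend (P : ℕ → ℝ) (s : Fin (m + 1) → Bool) (w : Idx n m (j + 1) → ℝ) (a : Idx n m j) : ℝ :=
  2 ^ j * fold (mix (2 ^ (j + 1)) P s a.1 fun b => w (a.ext b))

theorem blend_mem (P : ℕ → ℝ) (s : Fin (m + 1) → Bool) (w : Idx n m (j + 1) → ℝ)
    (a : Idx n m j) : blend P s w a ∈ Set.Icc (0 : ℝ) (2 ^ j) :=
  ⟨mul_nonneg (by positivity) (fold_nonneg _),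
    mul_le_of_le_one_right (by positivity) (fold_le_one _)⟩

theorem abs_blend_sub_le {P P' : ℕ → ℝ} {s s' : Fin (m + 1) → Bool} {w w' : Idx n m (j + 1) → ℝ}
    (a : Idx n m j) : |blend P s w a - blend P' s' w' a| ≤ 2 ^ j *
      |mix (2 ^ (j + 1)) P s a.1 (fun b => w (a.ext b)) -
        mix (2 ^ (j + 1)) P' s' a.1 fun b => w' (a.ext b)| := by
  rw [blend, blend, ← mul_sub, abs_mul, abs_of_pos (by positivity : (0 : ℝ) < 2 ^ j)]
  exact mul_le_mul_of_nonneg_left (abs_fold_sub_le _ _) (by positivity)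

theorem IsPartition.abs_blend_sub_le {P : ℕ → ℝ} (hP : IsPartition m n P) {s : Fin (m + 1) → Bool}
    {w w' : Idx n m (j + 1) → ℝ} {κ : Fin n → ℝ} (h : ∀ a, |w a - w' a| ≤ κ a.1)
    (a : Idx n m j) : |blend P s w a - blend P s w' a| ≤ 2 ^ j * κ a.1 := by
  refine (_root_.abs_blend_sub_le a).trans ?_
  gcongr
  rw [mix, mix, ← Finset.sum_sub_distrib]
  refine (Finset.abs_sum_le_sum_abs _ _).trans ?_
  calc _ ≤ ∑ i : Fin (m + 1), share P a.1 i * κ a.1 := Finset.sum_le_sum fun i _ => by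
        rw [← mul_sub, abs_mul, abs_of_nonneg (hP.share_nonneg _ _)]
        exact mul_le_mul_of_nonneg_left ((abs_trunc_sub_le _ _ _).trans (h _)) (hP.share_nonneg _ _)
    _ = κ a.1 := by rw [← Finset.sum_mul, hP.sum_share a.1.2, one_mul]

/-- The number of partition points in the `l`-th unit interval. -/
def cuts (m : ℕ) (P : ℕ → ℝ) (l : ℕ) : ℕ :=
  (Finset.univ.filter fun k : Fin m => ⌊P (k + 1)⌋₊ = l).card

theorem sum_cuts_le (P : ℕ → ℝ) (n : ℕ) : ∑ l : Fin n, cuts m P l ≤ m := by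
  classical
  have h : ∑ l : Fin n, cuts m P l = ((Finset.univ : Finset (Fin n)).biUnion fun l =>
      Finset.univ.filter fun k : Fin m => ⌊P (k + 1)⌋₊ = l).card := by
    refine (Finset.card_biUnion fun l _ l' _ hne => ?_).symm
    refine Finset.disjoint_filter.2 fun k _ h h' => hne (Fin.ext (h.symm.trans h'))
  rw [h]
  exact (Finset.card_le_univ _).trans_eq (Fintype.card_fin m)

/-- Rounding a partition down to the grid of mesh `1 / g`. -/
def grid (g : ℕ) (P : ℕ → ℝ) (k : ℕ) : ℝ := (⌊g * P k⌋₊ : ℝ) / g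

theorem IsPartition.nonneg {P : ℕ → ℝ} (hP : IsPartition m n P) (k : ℕ) : 0 ≤ P k :=
  hP.zero ▸ hP.mono (Nat.zero_le k)

theorem IsPartition.grid {P : ℕ → ℝ} (hP : IsPartition m n P) {g : ℕ} (hg : 0 < g) :
    IsPartition m n (grid g P) where
  mono := fun k k' h => by unfold _root_.grid; gcongr; exact hP.mono h
  zero := by simp [_root_.grid, hP.zero]
  top := fun k hk => by
    have : (g : ℝ) ≠ 0 := by positivity
    rw [_root_.grid, hP.top k hk, ← Nat.cast_mul, Nat.floor_natCast]
    push_cast; field_simp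

theorem grid_le {P : ℕ → ℝ} {k : ℕ} (hP : 0 ≤ P k) {g : ℕ} (hg : 0 < g) : grid g P k ≤ P k := by
  have : (0 : ℝ) < g := by exact_mod_cast hg
  rw [grid, div_le_iff₀ this, mul_comm]
  exact Nat.floor_le (by positivity)

theorem le_grid_add {P : ℕ → ℝ} {k : ℕ} {g : ℕ} (hg : 0 < g) : P k ≤ grid g P k + 1 / g := by
  have : (0 : ℝ) < g := by exact_mod_cast hg
  rw [grid, ← add_div, le_div_iff₀ this, mul_comm]
  exact (Nat.lt_floor_add_one _).le

theorem natCast_le_grid {P : ℕ → ℝ} {k l : ℕ} {g : ℕ} (hg : 0 < g) (h : (l : ℝ) ≤ P k) :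
    (l : ℝ) ≤ grid g P k := by
  have : (0 : ℝ) < g := by exact_mod_cast hg
  rw [grid, le_div_iff₀ this, ← Nat.cast_mul, Nat.cast_le]
  refine Nat.le_floor ?_
  push_cast
  rw [mul_comm]
  gcongr

theorem floor_grid {P : ℕ → ℝ} {k : ℕ} (hP : 0 ≤ P k) {g : ℕ} (hg : 0 < g) :
    ⌊grid g P k⌋₊ = ⌊P k⌋₊ :=
  le_antisymm (Nat.floor_mono (grid_le hP hg))
    (Nat.le_floor (natCast_le_grid hg (Nat.floor_le hP)))

theorem cuts_grid {P : ℕ → ℝ} (hP : IsPartition m n P) {g : ℕ} (hg : 0 < g) (l : ℕ) :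
    cuts m (grid g P) l = cuts m P l := by
  simp only [cuts, floor_grid (hP.nonneg _) hg]

theorem IsPartition.abs_blend_grid_sub_le {P : ℕ → ℝ} (hP : IsPartition m n P) {g : ℕ}
    (hg : 0 < g) (s : Fin (m + 1) → Bool) (w : Idx n m (j + 1) → ℝ) (a : Idx n m j) :
    |blend P s w a - blend (_root_.grid g P) s w a| ≤
      2 ^ j * (2 ^ (j + 1) * (2 * cuts m P a.1 / g)) := by
  have hg' : (0 : ℝ) < g := by exact_mod_cast hg
  refine (_root_.abs_blend_sub_le a).trans ?_
  gcongr
  set l : ℕ := a.1.val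
  have hr : ∀ k, |ramp l (P k) - ramp l (_root_.grid g P k)| ≤
      if ⌊P k⌋₊ = l then 1 / (g : ℝ) else 0 := fun k => by
    split_ifs with h
    · refine (abs_ramp_sub_le _ _ _).trans ?_
      rw [abs_of_nonneg (sub_nonneg.2 (grid_le (hP.nonneg k) hg))]
      linarith [le_grid_add (P := P) (k := k) hg]
    · rcases lt_or_gt_of_ne h with h | h
      · have h1 : P k ≤ l := ((Nat.floor_lt (hP.nonneg k)).1 h).le
        rw [ramp_of_le h1, ramp_of_le ((grid_le (hP.nonneg k) hg).trans h1)]; simp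
      · have h1 : ((l + 1 : ℕ) : ℝ) ≤ P k := (Nat.le_floor_iff (hP.nonneg k)).1 h
        have h2 := natCast_le_grid hg h1
        push_cast at h1 h2
        rw [ramp_of_ge h1, ramp_of_ge h2]; simp
  set d : ℕ → ℝ := fun k => |ramp l (P k) - ramp l (_root_.grid g P k)| with hd
  have hd0 : d 0 = 0 := by simp [hd, hP.zero, (hP.grid hg).zero]
  have hdm : d (m + 1) = 0 := by
    simp [hd, hP.top (m + 1) (by omega), (hP.grid hg).top (m + 1) (by omega)]
  have hsum : ∑ k : Fin m, d (k + 1) ≤ cuts m P l / g := by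
    refine (Finset.sum_le_sum fun k _ => hr _).trans_eq ?_
    rw [Finset.sum_ite, Finset.sum_const_zero, add_zero, Finset.sum_const, nsmul_eq_mul, cuts]
    ring
  rw [mix, mix, ← Finset.sum_sub_distrib]
  calc _ ≤ ∑ i : Fin (m + 1), 2 ^ (j + 1) * (d (i + 1) + d i) := by
        refine (Finset.abs_sum_le_sum_abs _ _).trans (Finset.sum_le_sum fun i _ => ?_)
        rw [← sub_mul, abs_mul, mul_comm]
        refine mul_le_mul (abs_trunc_le (by positivity) _) ?_ (abs_nonneg _) (by positivity)
        rw [share, share, sub_sub_sub_comm]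
        exact abs_sub _ _
    _ = 2 ^ (j + 1) * (2 * ∑ k : Fin m, d (k + 1)) := by
        rw [← Finset.mul_sum, Finset.sum_add_distrib, Fin.sum_univ_castSucc,
          Fin.sum_univ_succ (fun i : Fin (m + 1) => d i)]
        simp only [Fin.val_castSucc, Fin.val_last, hdm, Fin.val_zero, hd0, Fin.val_succ]
        ring
    _ ≤ _ := by rw [mul_div_assoc]; gcongr

/-- Some share is at least the reciprocal of the number of cuts plus one. -/
theorem IsPartition.exists_share {P : ℕ → ℝ} (hP : IsPartition m n P) {l : ℕ} (hl : l < n) :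
    ∃ i : Fin (m + 1), 1 / ((cuts m P l : ℝ) + 1) ≤ share P l i := by
  classical
  by_contra! hlt
  let S : Finset (Fin (m + 1)) := Finset.univ.filter fun i => i = 0 ∨ ⌊P i⌋₊ < l
  have hS : S.Nonempty := ⟨0, by simp [S]⟩
  set i₀ := S.max' hS with hi₀
  have hi₀S : i₀ = 0 ∨ ⌊P i₀⌋₊ < l := by simpa [S] using S.max'_mem hS
  let R : Finset (Fin (m + 1)) := insert i₀
    ((Finset.univ.filter fun k : Fin m => ⌊P (k + 1)⌋₊ = l).image Fin.succ)
  have hsupp : ∀ i ∉ R, share P l i = 0 := fun i hi => by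
    by_contra hne
    have h1 : P i < l + 1 := by
      by_contra! h
      refine hne ?_
      rw [share, ramp_of_ge h, ramp_of_ge (h.trans (hP.mono (Nat.le_succ _))), sub_self]
    have h2 : (l : ℝ) < P (i + 1) := by
      by_contra! h
      refine hne ?_
      rw [share, ramp_of_le h, ramp_of_le ((hP.mono (Nat.le_succ _)).trans h), sub_self]
    have h3 : ⌊P i⌋₊ ≤ l := Nat.lt_succ_iff.1 ((Nat.floor_lt (hP.nonneg _)).2 (by push_cast; exact h1))
    have hiS : i ∈ S := by
      simp only [S, Finset.mem_filter, Finset.mem_univ, true_and]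
      by_contra! h4
      obtain ⟨k, rfl⟩ := Fin.exists_succ_eq.2 h4.1
      refine hi (Finset.mem_insert_of_mem (Finset.mem_image_of_mem _ ?_))
      simp only [Finset.mem_filter, Finset.mem_univ, true_and]
      rw [Fin.val_succ] at h3 h4
      omega
    have h5 : i ≤ i₀ := S.le_max' i hiS
    have h6 : i ≠ i₀ := fun h => hi (h ▸ Finset.mem_insert_self _ _)
    have h7 : i < i₀ := lt_of_le_of_ne h5 h6
    rcases hi₀S with h8 | h8
    · rw [h8] at h7; exact absurd h7 (Fin.not_lt_zero _)
    · have h9 : P (i + 1) ≤ P i₀ := hP.mono (Nat.succ_le_of_lt h7)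
      have h10 := (Nat.floor_lt (hP.nonneg _)).1 h8
      linarith
  have h1 := hP.sum_share hl
  rw [← Finset.sum_subset (Finset.subset_univ R) fun i _ hi => hsupp i hi] at h1
  have hR : R.Nonempty := ⟨i₀, Finset.mem_insert_self _ _⟩
  have h2 := Finset.sum_lt_sum_of_nonempty hR fun i _ => hlt i
  rw [h1, Finset.sum_const, nsmul_eq_mul] at h2
  have h3 : (R.card : ℝ) ≤ cuts m P l + 1 := by
    have := (Finset.card_insert_le i₀ ((Finset.univ.filter fun k : Fin m =>
      ⌊P (k + 1)⌋₊ = l).image Fin.succ)).trans (Nat.succ_le_succ Finset.card_image_le)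
    exact_mod_cast this
  have h4 : (0 : ℝ) < cuts m P l + 1 := by positivity
  have : (R.card : ℝ) * (1 / ((cuts m P l : ℝ) + 1)) ≤ 1 := by
    rw [mul_one_div, div_le_one h4]; exact h3
  linarith

end Blend

section TreeMap

variable {m n j : ℕ}

/-- The partition associated with a point of the sphere. -/
def treePart (n : ℕ) (u : Fin (m + 1) → ℝ) (k : ℕ) : ℝ := n * cumAbs k u

/-- The signs of the coordinates. -/
def treeSign (u : Fin (m + 1) → ℝ) (i : Fin (m + 1)) : Bool := decide (0 ≤ u i)

/-- The map inducing the antipodal relations of the tree. -/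
def treeMap (w : Idx n m (j + 1) → ℝ) (u : Fin (m + 1) → ℝ) : Idx n m j → ℝ :=
  blend (treePart n u) (treeSign u) w

theorem isPartition_treePart {u : Fin (m + 1) → ℝ} (hu : u ∈ crossSphere m) :
    IsPartition m n (treePart n u) where
  mono := fun k k' h => mul_le_mul_of_nonneg_left
    (Finset.sum_le_sum_of_subset_of_nonneg (fun i hi => by simp at hi ⊢; omega)
      fun _ _ _ => abs_nonneg _) (Nat.cast_nonneg n)
  zero := by simp [treePart, cumAbs]
  top := fun k hk => by
    rw [treePart, cumAbs_eq_sum fun i hi => absurd i.2 (by omega), show ∑ i, |u i| = 1 from hu,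
      mul_one]

theorem treePart_neg (u : Fin (m + 1) → ℝ) : treePart n (-u) = treePart n u := by
  ext k; simp [treePart, cumAbs]

theorem share_treePart_le (u : Fin (m + 1) → ℝ) (l : ℕ) (i : Fin (m + 1)) :
    |share (treePart n u) l i| ≤ n * |u i| := by
  refine (abs_ramp_sub_le _ _ _).trans_eq ?_
  rw [treePart, treePart, cumAbs_succ, ← mul_sub, add_sub_cancel_left, abs_mul, abs_abs, Nat.abs_cast]

theorem treeMap_neg (w : Idx n m (j + 1) → ℝ) (u : Fin (m + 1) → ℝ) :
    treeMap w (-u) = blend (treePart n u) (fun i => !treeSign u i) w := by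
  ext a
  rw [treeMap, treePart_neg, blend, blend]
  congr 2
  refine Finset.sum_congr rfl fun i _ => ?_
  rcases eq_or_ne (u i) 0 with h | h
  · have := share_treePart_le (n := n) u a.1 i
    rw [h, abs_zero, mul_zero] at this
    rw [abs_nonpos_iff.1 this, zero_mul, zero_mul]
  · have : treeSign (-u) i = !treeSign u i := by
      simp only [treeSign, Pi.neg_apply, Left.nonneg_neg_iff]
      rcases lt_or_gt_of_ne h with h | h
      · simp [h.le, h]
      · simp [h.le, h]
    rw [this]

theorem abs_treePart_sub_le (u u' : Fin (m + 1) → ℝ) (k : ℕ) :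
    |treePart n u k - treePart n u' k| ≤ n * ((m + 1) * dist u u') := by
  rw [treePart, treePart, ← mul_sub, abs_mul, Nat.abs_cast]
  refine mul_le_mul_of_nonneg_left ?_ (Nat.cast_nonneg n)
  rw [cumAbs, cumAbs, ← Finset.sum_sub_distrib]
  refine (Finset.abs_sum_le_sum_abs _ _).trans ?_
  refine (Finset.sum_le_sum fun i _ => (abs_abs_sub_abs_le _ _).trans
    (dist_le_pi_dist u u' i)).trans ?_
  rw [Finset.sum_const, nsmul_eq_mul]
  refine mul_le_mul_of_nonneg_right ?_ dist_nonneg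
  have := Finset.card_le_univ (Finset.univ.filter fun i : Fin (m + 1) => i.val < k)
  rw [Fintype.card_fin] at this
  exact_mod_cast this

theorem unifSphere_treeMap : UnifSphere (treeMap (n := n) (m := m) (j := j)) := by
  intro η hη
  set K : ℝ := 2 ^ (j + 1)
  set D : ℝ := 2 ^ j * ((m + 1) * (1 + 2 * (n * (m + 1)) * K + 2 * n * K)) with hD
  have hD0 : 0 < D := by positivity
  refine ⟨η / D, by positivity, fun w w' u hu u' hu' hw huu => ?_⟩
  set δ := η / D with hδ
  have hδ0 : 0 < δ := by positivity
  have hP := isPartition_treePart (n := n) hu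
  have hP' := isPartition_treePart (n := n) hu'
  refine (dist_pi_le_iff hη.le).2 fun a => ?_
  rw [Real.dist_eq]
  refine (abs_blend_sub_le a).trans ?_
  have hterm : ∀ i : Fin (m + 1), |share (treePart n u) a.1 i *
      trunc K (w (a.ext (treeSign u i, i))) - share (treePart n u') a.1 i *
      trunc K (w' (a.ext (treeSign u' i, i)))| ≤ (1 + 2 * (n * (m + 1)) * K + 2 * n * K) * δ := by
    intro i
    have hK : 0 ≤ K := by positivity
    by_cases hs : treeSign u i = treeSign u' i
    · rw [hs]
      set x := trunc K (w (a.ext (treeSign u' i, i)))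
      set x' := trunc K (w' (a.ext (treeSign u' i, i)))
      have h1 : |x - x'| ≤ δ := (abs_trunc_sub_le _ _ _).trans ((dist_le_pi_dist w w' _).trans hw)
      have h2 : |x'| ≤ K := abs_trunc_le hK _
      have h3 : share (treePart n u) a.1 i ≤ 1 := by
        unfold share
        linarith [ramp_le_one a.1 (treePart n u (i + 1)), ramp_nonneg a.1 (treePart n u i)]
      have h4 := hP.share_nonneg a.1 i
      have h5 : |share (treePart n u) a.1 i - share (treePart n u') a.1 i| ≤
          2 * (n * (m + 1)) * δ := by
        have e1 : ∀ k, |ramp a.1 (treePart n u k) - ramp a.1 (treePart n u' k)| ≤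
            n * (m + 1) * δ := fun k => by
          refine (abs_ramp_sub_le _ _ _).trans ((abs_treePart_sub_le _ _ _).trans ?_)
          rw [mul_assoc]; gcongr
        unfold share
        rw [sub_sub_sub_comm]
        refine (abs_sub _ _).trans ?_
        linarith [e1 i, e1 (i + 1)]
      calc _ = |share (treePart n u) a.1 i * (x - x') +
            (share (treePart n u) a.1 i - share (treePart n u') a.1 i) * x'| := by congr 1; ring
        _ ≤ 1 * δ + 2 * (n * (m + 1)) * δ * K := by
          refine (abs_add_le _ _).trans ?_
          rw [abs_mul, abs_mul, abs_of_nonneg h4]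
          gcongr
        _ ≤ _ := by
          have : 0 ≤ 2 * n * K * δ := by positivity
          linarith
    · have hd : |u i - u' i| ≤ δ := (dist_le_pi_dist u u' i).trans huu
      have hab : |u i| ≤ δ ∧ |u' i| ≤ δ := by
        have hs' : (0 ≤ u i ∧ u' i < 0) ∨ (u i < 0 ∧ 0 ≤ u' i) := by
          simp only [treeSign, decide_eq_decide] at hs
          by_cases h1 : 0 ≤ u i <;> by_cases h2 : 0 ≤ u' i <;> simp_all
        rw [abs_le] at hd
        rcases hs' with ⟨h1, h2⟩ | ⟨h1, h2⟩
        · rw [abs_of_nonneg h1, abs_of_neg h2]; constructor <;> linarith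
        · rw [abs_of_neg h1, abs_of_nonneg h2]; constructor <;> linarith
      calc _ ≤ n * δ * K + n * δ * K := by
            refine (abs_sub _ _).trans ?_
            rw [abs_mul, abs_mul]
            gcongr
            · exact (share_treePart_le _ _ _).trans (by gcongr; exact hab.1)
            · exact abs_trunc_le hK _
            · exact (share_treePart_le _ _ _).trans (by gcongr; exact hab.2)
            · exact abs_trunc_le hK _
        _ ≤ _ := by
          have : 0 ≤ (1 + 2 * (n * (m + 1)) * K) * δ := by positivity
          linarith
  have hsum : |mix K (treePart n u) (treeSign u) a.1 (fun b => w (a.ext b)) -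
      mix K (treePart n u') (treeSign u') a.1 fun b => w' (a.ext b)| ≤
      (m + 1) * ((1 + 2 * (n * (m + 1)) * K + 2 * n * K) * δ) := by
    rw [mix, mix, ← Finset.sum_sub_distrib]
    refine (Finset.abs_sum_le_sum_abs _ _).trans ((Finset.sum_le_sum fun i _ => hterm i).trans ?_)
    rw [Finset.sum_const, nsmul_eq_mul, Finset.card_univ, Fintype.card_fin]
    push_cast; exact le_rfl
  calc _ ≤ 2 ^ j * ((m + 1) * ((1 + 2 * (n * (m + 1)) * K + 2 * n * K) * δ)) := by gcongr
    _ = D * δ := by rw [hD]; ring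
    _ = η := by rw [hδ]; field_simp

/-- The property that some binary tree of blends has all its leaves in `S`. -/
def BlendTree (S : (Idx n m 0 → ℝ) → Prop) : ∀ j, (Idx n m j → ℝ) → Prop
  | 0, w => S w
  | j + 1, w => ∃ P s, IsPartition m n P ∧ BlendTree S j (blend P s w) ∧
      BlendTree S j (blend P (fun i => !s i) w)

theorem BlendTree.mono {S S' : (Idx n m 0 → ℝ) → Prop} (h : ∀ w, S w → S' w) :
    ∀ {j w}, BlendTree S j w → BlendTree S' j w
  | 0, w, hw => h w hw
  | _ + 1, _, ⟨P, s, hP, h1, h2⟩ => ⟨P, s, hP, h1.mono h, h2.mono h⟩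

/-- Iterated antipodal relations of a map. -/
def treeRel (f : (Idx n m 0 → ℝ) → Fin m → ℝ) : ∀ j, ℝ → (Idx n m j → ℝ) → (Fin m → ℝ) → Prop
  | 0, η, w, y => dist (f w) y ≤ η
  | j + 1, η, w, y => AntipodalRel treeMap (treeRel f j) η w y

theorem BlendTree.of_treeRel {f : (Idx n m 0 → ℝ) → Fin m → ℝ} {η : ℝ} {y : Fin m → ℝ} :
    ∀ {j w}, treeRel f j η w y → BlendTree (fun w => dist (f w) y ≤ η) j w
  | 0, _, h => h
  | _ + 1, _, ⟨u, hu, h1, h2⟩ => ⟨treePart n u, treeSign u, isPartition_treePart hu,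
      BlendTree.of_treeRel h1, treeMap_neg _ u ▸ BlendTree.of_treeRel h2⟩

/-- Every family of parameters is the root of a tree whose leaves lie in a single fibre. -/
theorem exists_tree {f : (Idx n m 0 → ℝ) → Fin m → ℝ} (hf : UniformContinuous f) {η : ℝ}
    (hη : 0 < η) (j : ℕ) (w : Idx n m j → ℝ) : ∃ y, BlendTree (fun w => dist (f w) y ≤ η) j w := by
  have h : ∀ j, StableRel (treeRel f j) ∧ Lifts (treeRel f j) := by
    intro j
    induction j with
    | zero => exact ⟨stableRel_dist hf, lifts_dist hf⟩
    | succ j ih => exact ⟨ih.1.antipodal unifSphere_treeMap, ih.2.antipodal ih.1 unifSphere_treeMap⟩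
  obtain ⟨y, hy⟩ := (h j).2.exists_rel hη w
  exact ⟨y, BlendTree.of_treeRel hy⟩

theorem exists_tree_mem {f : (Idx n m 0 → ℝ) → Fin m → ℝ} {η : ℝ} {y : Fin m → ℝ} :
    ∀ {j w}, BlendTree (fun w => dist (f w) y ≤ η) j w → ∃ v, dist (f v) y ≤ η
  | 0, w, h => ⟨w, h⟩
  | _ + 1, _, ⟨_, _, _, h1, _⟩ => exists_tree_mem h1

/-- The product of the Lipschitz constants of the blending maps. -/
def lipTree (j : ℕ) : ℝ := ∏ i ∈ Finset.range j, 2 ^ i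

theorem lipTree_pos (j : ℕ) : 0 < lipTree j := Finset.prod_pos fun _ _ => by positivity

/-- The union of boxes with the given centres and half-sizes. -/
def Boxes {M : ℕ} (p : Fin M → Fin n → ℝ) (e : Fin n → ℝ) (x : Idx n m 0 → ℝ) : Prop :=
  ∃ i, ∀ a, |trunc 1 (x a) - p i a.1| ≤ e a.1

theorem BlendTree.perturb {M : ℕ} {p : Fin M → Fin n → ℝ} : ∀ {j} {w w' : Idx n m j → ℝ}
    {e κ : Fin n → ℝ}, BlendTree (Boxes p e) j w → (∀ a, |w a - w' a| ≤ κ a.1) →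
    BlendTree (Boxes p fun l => e l + lipTree j * κ l) j w'
  | 0, w, w', e, κ, ⟨i, hi⟩, h => ⟨i, fun a => by
      have h1 := hi a
      have h2 := abs_trunc_sub_le 1 (w' a) (w a)
      have h3 := h a
      rw [abs_sub_comm] at h3
      have h4 := abs_sub_le (trunc 1 (w' a)) (trunc 1 (w a)) (p i a.1)
      simp only [lipTree, Finset.range_zero, Finset.prod_empty, one_mul]
      linarith⟩
  | j + 1, w, w', e, κ, ⟨P, s, hP, h1, h2⟩, h => by
      have key : ∀ l, lipTree (j + 1) * κ l = lipTree j * (2 ^ j * κ l) := fun l => by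
        rw [lipTree, Finset.prod_range_succ, ← lipTree]; ring
      simp only [key]
      exact ⟨P, s, hP, h1.perturb fun a => hP.abs_blend_sub_le h a,
        h2.perturb fun a => hP.abs_blend_sub_le h a⟩

end TreeMap

section Probability

open MeasureTheory ProbabilityTheory

/-- Grouping independent variables into blocks. -/
theorem iIndepFun_curry {Ω ι κ : Type*} [MeasurableSpace Ω] {ν : Measure Ω} [IsProbabilityMeasure ν]
    {X : ι × κ → Ω → ℝ} (hX : ∀ p, Measurable (X p)) (h : iIndepFun X ν) :
    iIndepFun (fun i ω k => X (i, k) ω) ν := by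
  have hX' : ∀ i, Measurable fun ω k => X (i, k) ω := fun i => measurable_pi_iff.2 fun k => hX _
  have hpr : ∀ p, IsProbabilityMeasure (ν.map (X p)) := fun p =>
    Measure.isProbabilityMeasure_map (hX p).aemeasurable
  rw [iIndepFun_iff_map_fun_eq_infinitePi_map hX']
  have h1 : ∀ i, ν.map (fun ω k => X (i, k) ω) = Measure.infinitePi fun k => ν.map (X (i, k)) :=
    fun i => (h.precomp (g := fun k => (i, k)) (Prod.mk_right_injective i)).map_fun_eq_infinitePi_map
      fun k => hX _
  simp only [h1]
  rw [← Measure.infinitePi_map_curry (fun i k => ν.map (X (i, k))),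
    ← h.map_fun_eq_infinitePi_map hX, Measure.map_map (MeasurableEquiv.measurable _)
      (measurable_pi_iff.2 hX)]
  rfl

/-- Bounding the measure of a set by the measures of its sections in one coordinate. -/
theorem pi_le_of_update {J : Type*} [Fintype J] [DecidableEq J] {μ : J → Measure ℝ}
    [∀ i, IsProbabilityMeasure (μ i)] {A : Set (J → ℝ)} (hA : MeasurableSet A) (b : J) {r : ℝ≥0∞}
    (h : ∀ w, μ b {y | Function.update w b y ∈ A} ≤ r) : Measure.pi μ A ≤ r := by
  rw [← lintegral_indicator_one hA, lintegral_eq_lmarginal_univ (fun _ => 0),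
    lmarginal_erase' _ (measurable_one.indicator hA) (Finset.mem_univ b)]
  have h1 : (fun x => ∫⁻ y, A.indicator 1 (Function.update x b y) ∂μ b) ≤ fun _ => r := fun w => by
    have e := lintegral_indicator_one (μ := μ b) (s := {y | Function.update w b y ∈ A})
      (measurable_update w hA)
    exact e.trans_le (h w)
  refine (lmarginal_mono h1 _).trans_eq ?_
  simp [lmarginal]

/-- Small ball estimate after scaling, shifting and folding. -/
theorem measure_fold_le {μ : Measure ℝ} {K ρ : ℝ} (hK : 0 < K) (hρ : 0 ≤ ρ)
    (hsupp : μ (Set.Icc 0 K)ᶜ = 0)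
    (hball : ∀ x t, 0 ≤ t → μ (Set.Icc x (x + t)) ≤ ENNReal.ofReal (ρ * t / K))
    {c : ℝ} (hc : 0 < c) (R b : ℝ) {t : ℝ} (ht : 0 ≤ t) :
    μ {y | fold (c * trunc K y + R) ∈ Set.Icc b (b + t)} ≤
      ENNReal.ofReal ((c * K + 2) * (ρ * (t / c) / K)) := by
  set I : Finset ℤ := Finset.Icc ⌊R⌋ ⌊R + c * K⌋ with hI
  have hcover : ∀ p : ℤ, ∃ z : ℝ, ∀ y, c * y + R ∈ Set.Icc (p : ℝ) (p + 1) →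
      fold (c * y + R) ∈ Set.Icc b (b + t) → y ∈ Set.Icc z (z + t / c) := fun p => by
    have e : ∀ z y, z ≤ c * y + R → c * y + R ≤ z + t → y ∈ Set.Icc ((z - R) / c) ((z - R) / c + t / c) :=
      fun z y h1 h2 => by
        rw [Set.mem_Icc, ← add_div, div_le_iff₀ hc, le_div_iff₀ hc]
        constructor <;> linarith
    rcases fold_of_mem p with h | h
    · refine ⟨(p + b - R) / c, fun y hy hf => ?_⟩
      rw [h _ hy] at hf
      exact e _ _ (by linarith [hf.1]) (by linarith [hf.2])
    · refine ⟨(p + 1 - b - t - R) / c, fun y hy hf => ?_⟩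
      rw [h _ hy] at hf
      exact e _ _ (by linarith [hf.2]) (by linarith [hf.1])
  choose z hz using hcover
  have hsub : {y | fold (c * trunc K y + R) ∈ Set.Icc b (b + t)} ⊆
      (Set.Icc 0 K)ᶜ ∪ ⋃ p ∈ I, Set.Icc (z p) (z p + t / c) := by
    intro y hy
    by_cases hyK : y ∈ Set.Icc 0 K
    · right
      simp only [Set.mem_ofPred_eq, trunc_of_mem hyK] at hy
      refine Set.mem_biUnion (x := ⌊c * y + R⌋) ?_ (hz _ y ⟨Int.floor_le _, (Int.lt_floor_add_one _).le⟩ hy)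
      rw [hI, Finset.mem_coe, Finset.mem_Icc]
      have h1 : 0 ≤ c * y := mul_nonneg hc.le hyK.1
      have h2 : c * y ≤ c * K := mul_le_mul_of_nonneg_left hyK.2 hc.le
      exact ⟨Int.floor_mono (by linarith), Int.floor_mono (by linarith)⟩
    · exact Or.inl hyK
  have hcard : (I.card : ℝ) ≤ c * K + 2 := by
    have h0 : ⌊R⌋ ≤ ⌊R + c * K⌋ := Int.floor_mono (by linarith [mul_pos hc hK])
    rw [hI, Int.card_Icc]
    have h1 : (((⌊R + c * K⌋ + 1 - ⌊R⌋).toNat : ℤ) : ℝ) = ⌊R + c * K⌋ + 1 - ⌊R⌋ := by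
      rw [Int.toNat_of_nonneg (by omega)]; push_cast; rfl
    rw [Int.cast_natCast] at h1
    rw [h1]
    linarith [Int.floor_le (R + c * K), Int.lt_floor_add_one R]
  have hr : 0 ≤ ρ * (t / c) / K := by positivity
  calc _ ≤ μ ((Set.Icc 0 K)ᶜ ∪ ⋃ p ∈ I, Set.Icc (z p) (z p + t / c)) := measure_mono hsub
    _ ≤ μ (Set.Icc 0 K)ᶜ + μ (⋃ p ∈ I, Set.Icc (z p) (z p + t / c)) := measure_union_le _ _
    _ ≤ 0 + ∑ p ∈ I, ENNReal.ofReal (ρ * (t / c) / K) := by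
      rw [hsupp]
      gcongr
      exact (measure_biUnion_finset_le _ _).trans
        (Finset.sum_le_sum fun p _ => hball _ _ (by positivity))
    _ = ENNReal.ofReal (I.card * (ρ * (t / c) / K)) := by
      rw [zero_add, Finset.sum_const, nsmul_eq_mul, ENNReal.ofReal_mul (by positivity),
        ENNReal.ofReal_natCast]
    _ ≤ _ := ENNReal.ofReal_le_ofReal (by gcongr)

variable {m n j : ℕ}

/-- Laws with a small ball estimate. -/
structure SmallBall (K ρ : ℝ) (μ : Measure ℝ) : Prop where
  supp : μ (Set.Icc 0 K)ᶜ = 0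
  ball : ∀ x t, 0 ≤ t → μ (Set.Icc x (x + t)) ≤ ENNReal.ofReal (ρ * t / K)

theorem measurable_fold : Measurable fold := continuous_fold.measurable

theorem measurable_trunc (K : ℝ) : Measurable (trunc K) :=
  measurable_const.max (measurable_const.min measurable_id)

theorem measurable_mix (K : ℝ) (P : ℕ → ℝ) (s : Fin (m + 1) → Bool) (l : ℕ) :
    Measurable (mix K P s l) :=
  Finset.measurable_sum _ fun _ _ => ((measurable_trunc K).comp (measurable_pi_apply _)).const_mul _

theorem measurable_blend (P : ℕ → ℝ) (s : Fin (m + 1) → Bool) (a : Idx n m j) :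
    Measurable fun w => blend P s w a :=
  (measurable_fold.comp ((measurable_mix _ _ _ _).comp
    (measurable_pi_iff.2 fun _ => measurable_pi_apply _))).const_mul _

theorem measurable_blend' (P : ℕ → ℝ) (s : Fin (m + 1) → Bool) :
    Measurable (blend (n := n) (j := j) P s) :=
  measurable_pi_iff.2 fun a => measurable_blend P s a

theorem smallBall_blend {μ : Idx n m (j + 1) → Measure ℝ} [∀ a, IsProbabilityMeasure (μ a)]
    {ρ : Fin n → ℝ} (hρ : ∀ l, 0 ≤ ρ l) (hμ : ∀ a, SmallBall (2 ^ (j + 1)) (ρ a.1) (μ a))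
    {P : ℕ → ℝ} (hP : IsPartition m n P) (s : Fin (m + 1) → Bool) (a : Idx n m j) :
    SmallBall (2 ^ j) (ρ a.1 * (1 + 2 * (cuts m P a.1 + 1) / 2 ^ (j + 1)))
      ((Measure.pi μ).map fun w => blend P s w a) where
  supp := by
    rw [Measure.map_apply (measurable_blend P s a) measurableSet_Icc.compl]
    convert measure_empty (μ := Measure.pi μ)
    ext w
    simp [blend_mem P s w a, -Set.mem_Icc]
  ball := fun x t ht => by
    classical
    rw [Measure.map_apply (measurable_blend P s a) measurableSet_Icc]
    obtain ⟨i, hi⟩ := hP.exists_share a.1.2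
    set c := share P a.1 i with hc
    set q : ℝ := cuts m P a.1 + 1
    have hq : 0 < q := by positivity
    have hc0 : 0 < c := lt_of_lt_of_le (by positivity) hi
    refine pi_le_of_update (measurable_blend P s a measurableSet_Icc) (a.ext (s i, i)) fun w => ?_
    set K : ℝ := 2 ^ (j + 1) with hK
    set R : ℝ := ∑ i' ∈ Finset.univ.erase i, share P a.1 i' * trunc K (w (a.ext (s i', i')))
    have hblend : ∀ y, blend P s (Function.update w (a.ext (s i, i)) y) a =
        2 ^ j * fold (c * trunc K y + R) := fun y => by
      rw [blend, mix, ← Finset.add_sum_erase _ _ (Finset.mem_univ i), Function.update_self]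
      congr 3
      refine Finset.sum_congr rfl fun i' hi' => ?_
      rw [Function.update_of_ne]
      exact fun h => (Finset.mem_erase.1 hi').1 (Prod.ext_iff.1 (Idx.ext_inj h).2).2
    have hp : (0 : ℝ) < 2 ^ j := by positivity
    have hset : {y | Function.update w (a.ext (s i, i)) y ∈
        (fun w => blend P s w a) ⁻¹' Set.Icc x (x + t)} =
        {y | fold (c * trunc K y + R) ∈ Set.Icc (x / 2 ^ j) (x / 2 ^ j + t / 2 ^ j)} := by
      ext y
      simp only [Set.mem_preimage, Set.mem_ofPred_eq, hblend, Set.mem_Icc]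
      rw [← add_div, div_le_iff₀ hp, le_div_iff₀ hp, mul_comm]
    rw [hset]
    refine (measure_fold_le (by positivity) (hρ a.1) (hμ _).supp (hμ _).ball hc0 _ _
      (by positivity)).trans (ENNReal.ofReal_le_ofReal ?_)
    have hK0 : 0 < K := by positivity
    have h1 : 1 / c ≤ q := by rw [div_le_iff₀ hc0]; rw [div_le_iff₀ hq] at hi; linarith
    change (c * K + 2) * (ρ a.1 * (t / 2 ^ j / c) / K) ≤ _
    calc _ = ρ a.1 * (t / 2 ^ j) * (1 + 2 * (1 / c) / K) := by field_simp
      _ ≤ ρ a.1 * (t / 2 ^ j) * (1 + 2 * q / K) := by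
        have := hρ a.1
        gcongr
      _ = _ := by ring

/-- The two halves of a blended family are independent with independent components. -/
theorem pi_blend_le {μ : Idx n m (j + 1) → Measure ℝ} [∀ a, IsProbabilityMeasure (μ a)]
    (P : ℕ → ℝ) (s : Fin (m + 1) → Bool) (T : (Idx n m j → ℝ) → Prop) :
    Measure.pi μ {w | T (blend P s w) ∧ T (blend P (fun i => !s i) w)} ≤
      (Measure.pi fun a => (Measure.pi μ).map fun w => blend P s w a) {v | T v} *
      (Measure.pi fun a => (Measure.pi μ).map fun w => blend P (fun i => !s i) w a) {v | T v} := by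
  classical
  let S : Bool → Fin (m + 1) → Bool := fun σ i => if σ then s i else !s i
  have h0 : iIndepFun (fun (a : Idx n m (j + 1)) (w : Idx n m (j + 1) → ℝ) => w a) (Measure.pi μ) :=
    iIndepFun_pi (X := fun _ => id) fun _ => aemeasurable_id
  let g : (Bool × Idx n m j) × Fin (m + 1) → Idx n m (j + 1) := fun p => p.1.2.ext (S p.1.1 p.2, p.2)
  have hg : Function.Injective g := by
    rintro ⟨⟨σ, a⟩, i⟩ ⟨⟨σ', a'⟩, i'⟩ h
    obtain ⟨h1, h2⟩ := Idx.ext_inj h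
    obtain ⟨h3, h4⟩ := Prod.ext_iff.1 h2
    dsimp only at h1 h3 h4
    subst h1 h4
    have : σ = σ' := by
      by_contra hne
      revert h3
      cases σ <;> cases σ' <;> simp_all [S]
    rw [this]
  have h1 := iIndepFun_curry (fun p => measurable_pi_apply (g p)) (h0.precomp hg)
  let φ : Bool × Idx n m j → (Fin (m + 1) → ℝ) → ℝ := fun p v =>
    2 ^ j * fold (∑ i : Fin (m + 1), share P p.2.1 i * trunc (2 ^ (j + 1)) (v i))
  have hφ : ∀ p, Measurable (φ p) := fun p => (measurable_fold.comp (Finset.measurable_sum _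
    fun i _ => ((measurable_trunc _).comp (measurable_pi_apply i)).const_mul _)).const_mul _
  have h2 : iIndepFun (fun (p : Bool × Idx n m j) w => blend P (S p.1) w p.2) (Measure.pi μ) :=
    h1.comp φ hφ
  have h3 := iIndepFun_curry (fun p => measurable_blend P (S p.1) p.2) h2
  have h4 : IndepFun (fun w => blend (n := n) (j := j) P s w) (fun w => blend P (fun i => !s i) w)
      (Measure.pi μ) :=
    h3.indepFun (i := true) (j := false) (by simp)
  have hlaw : ∀ σ, (Measure.pi μ).map (fun w => blend P (S σ) w) =
      Measure.pi fun a : Idx n m j => (Measure.pi μ).map fun w => blend P (S σ) w a := fun σ =>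
    (iIndepFun_iff_map_fun_eq_pi_map fun a => (measurable_blend P (S σ) a).aemeasurable).1
      (h2.precomp (g := fun a => (σ, a)) (Prod.mk_right_injective σ))
  have e1 := hlaw true
  have e2 := hlaw false
  simp only [S, if_true, Bool.false_eq_true, if_false] at e1 e2
  set ν₁ := Measure.pi fun a : Idx n m j => (Measure.pi μ).map fun w => blend P s w a
  set ν₂ := Measure.pi fun a : Idx n m j => (Measure.pi μ).map fun w => blend P (fun i => !s i) w a
  have hm1 := measurableSet_toMeasurable ν₁ {v | T v}
  have hm2 := measurableSet_toMeasurable ν₂ {v | T v}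
  calc _ ≤ Measure.pi μ ((fun w => blend P s w) ⁻¹' toMeasurable ν₁ {v | T v} ∩
        (fun w => blend P (fun i => !s i) w) ⁻¹' toMeasurable ν₂ {v | T v}) :=
      measure_mono fun w hw => ⟨subset_toMeasurable _ _ hw.1, subset_toMeasurable _ _ hw.2⟩
    _ = ν₁ (toMeasurable ν₁ {v | T v}) * ν₂ (toMeasurable ν₂ {v | T v}) := by
      rw [h4.measure_inter_preimage_eq_mul _ _ hm1 hm2, ← Measure.map_apply (measurable_blend' _ _) hm1,
        ← Measure.map_apply (measurable_blend' _ _) hm2, e1, e2]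
    _ = _ := by rw [measure_toMeasurable, measure_toMeasurable]

end Probability

section Waist

open MeasureTheory ProbabilityTheory

variable {m n j : ℕ}

/-- The set of partitions with points on the grid of mesh `1 / g`. -/
def gridSet (m n g : ℕ) : Set (ℕ → ℝ) := {G | ∃ P, IsPartition m n P ∧ G = grid g P}

theorem floor_mul_grid (P : ℕ → ℝ) (k : ℕ) {g : ℕ} (hg : 0 < g) :
    ⌊g * grid g P k⌋₊ = ⌊g * P k⌋₊ := by
  have : (g : ℝ) ≠ 0 := by positivity
  rw [grid, mul_div_cancel₀ _ this, Nat.floor_natCast]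

theorem gridSet_finite_card (m n : ℕ) {g : ℕ} (hg : 0 < g) :
    (gridSet m n g).Finite ∧ (gridSet m n g).ncard ≤ 2 ^ (n + m) * g ^ m := by
  classical
  let cd : (ℕ → ℝ) → Finset ℕ × (Fin m → Fin g) := fun G =>
    (Finset.univ.image fun k : Fin m => ⌊g * G (k + 1)⌋₊ / g + k,
      fun k => ⟨⌊g * G (k + 1)⌋₊ % g, Nat.mod_lt _ hg⟩)
  let T : Finset (Finset ℕ × (Fin m → Fin g)) := (Finset.range (n + m)).powerset ×ˢ Finset.univ
  have hmem : ∀ G ∈ gridSet m n g, cd G ∈ (T : Set (Finset ℕ × (Fin m → Fin g))) := by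
    rintro G ⟨P, hP, rfl⟩
    simp only [T, Finset.mem_coe, Finset.mem_product, Finset.mem_powerset, Finset.mem_univ, and_true]
    intro x hx
    obtain ⟨k, -, rfl⟩ := Finset.mem_image.1 hx
    rw [floor_mul_grid _ _ hg]
    have h1 : P (k + 1) ≤ n := by
      rw [← hP.top (m + 1) (Nat.lt_succ_self m)]
      exact hP.mono (by omega)
    have h2 : ⌊g * P (k + 1)⌋₊ ≤ g * n := by
      refine Nat.floor_le_of_le ?_
      push_cast; gcongr
    have h3 := (Nat.div_le_div_right (c := g) h2).trans_eq (Nat.mul_div_cancel_left n hg)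
    rw [Finset.mem_range]
    omega
  have hinj : Set.InjOn cd (gridSet m n g) := by
    rintro _ ⟨P, hP, rfl⟩ _ ⟨P', hP', rfl⟩ h
    obtain ⟨h1, h2⟩ := Prod.ext_iff.1 h
    have hmono : ∀ {P}, IsPartition m n P →
        StrictMono fun k : Fin m => ⌊g * P (k + 1)⌋₊ / g + (k : ℕ) := fun {P} hP k k' hk => by
      refine add_lt_add_of_le_of_lt (Nat.div_le_div_right (Nat.floor_mono ?_)) hk
      have := hP.mono (Nat.succ_le_succ (Nat.le_of_lt hk))
      gcongr
    simp only [cd, floor_mul_grid _ _ hg] at h1 h2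
    have h3 := congrArg (fun s : Finset ℕ => (s : Set ℕ)) h1
    simp only [Finset.coe_image, Finset.coe_univ, Set.image_univ] at h3
    have h4 := ((hmono hP).range_inj (hmono hP')).1 h3
    have h5 : ∀ k : Fin m, grid g P (k + 1) = grid g P' (k + 1) := fun k => by
      have e1 : ⌊g * P (k + 1)⌋₊ / g = ⌊g * P' (k + 1)⌋₊ / g := by
        have := congrFun h4 k
        simpa using this
      have e2 : ⌊g * P (k + 1)⌋₊ % g = ⌊g * P' (k + 1)⌋₊ % g := by
        have := congrFun h2 k
        exact Fin.mk.inj_iff.1 this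
      rw [grid, grid, ← Nat.div_add_mod ⌊g * P (k + 1)⌋₊ g, e1, e2, Nat.div_add_mod]
    ext k
    rcases Nat.eq_zero_or_pos k with rfl | hk
    · rw [(hP.grid hg).zero, (hP'.grid hg).zero]
    · rcases lt_or_ge m k with hk' | hk'
      · rw [(hP.grid hg).top k hk', (hP'.grid hg).top k hk']
      · obtain ⟨k, rfl⟩ := Nat.exists_eq_succ_of_ne_zero hk.ne'
        exact h5 ⟨k, hk'⟩
  refine ⟨Set.Finite.of_injOn hmem hinj T.finite_toSet, ?_⟩
  refine (Set.ncard_le_ncard_of_injOn cd hmem hinj T.finite_toSet).trans_eq ?_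
  rw [Set.ncard_coe_finset]
  simp [T]

/-- The exponent in the bound for the measure of the set of roots of trees. -/
def growth (j : ℕ) : ℝ := ∑ i ∈ Finset.range j, 10 * ((i : ℝ) + 1) ^ 2 / 2 ^ i

theorem exists_growth_le : ∃ Γ : ℝ, 0 ≤ Γ ∧ ∀ j, growth j ≤ Γ := by
  have h : Summable fun i : ℕ => 10 * ((i : ℝ) + 1) ^ 2 / 2 ^ i := by
    have h1 := (summable_nat_add_iff 1).2
      (summable_pow_mul_geometric_of_norm_lt_one 2 (r := (1 / 2 : ℝ)) (by norm_num))
    refine (h1.mul_left 20).congr fun i => ?_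
    push_cast
    rw [pow_succ, one_div, inv_pow]
    ring
  exact ⟨_, tsum_nonneg fun i => by positivity,
    fun j => h.sum_le_tsum _ fun i _ => by positivity⟩

theorem one_le_lipTree (j : ℕ) : 1 ≤ lipTree j := by
  refine le_trans (by simp) (Finset.prod_le_prod (s := Finset.range j) (f := fun _ => (1 : ℝ))
    (fun _ _ => zero_le_one) fun i _ => one_le_pow₀ (n := i) (by norm_num : (1 : ℝ) ≤ 2))

theorem lipTree_le (j : ℕ) : lipTree j ≤ 2 ^ (j * j) := by
  refine (Finset.prod_le_prod (fun i _ => by positivity) fun i hi =>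
    pow_le_pow_right₀ (by norm_num : (1 : ℝ) ≤ 2) (Finset.mem_range.1 hi).le).trans_eq ?_
  rw [Finset.prod_const, Finset.card_range, ← pow_mul]

theorem two_pow_le_exp (k : ℕ) : (2 : ℝ) ^ k ≤ Real.exp k := by
  rw [← Real.exp_one_pow]
  gcongr
  linarith [Real.add_one_le_exp 1]

theorem measure_boxes_le {μ : Idx n m 0 → Measure ℝ} [∀ a, IsProbabilityMeasure (μ a)]
    {M : ℕ} (p : Fin M → Fin n → ℝ) {e ρ : Fin n → ℝ} (he : ∀ l, 0 ≤ e l) (hρ : ∀ l, 0 ≤ ρ l)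
    (hμ : ∀ a, SmallBall 1 (ρ a.1) (μ a)) :
    Measure.pi μ {w | Boxes p e w} ≤ ENNReal.ofReal (M * ∏ l, 2 * ρ l * e l) := by
  have h1 : {w : Idx n m 0 → ℝ | Boxes p e w} = ⋃ i ∈ (Finset.univ : Finset (Fin M)),
      Set.univ.pi fun a : Idx n m 0 => {x | |trunc 1 x - p i a.1| ≤ e a.1} := by
    ext w; simp [Boxes]
  have h2 : ∀ i (a : Idx n m 0), μ a {x | |trunc 1 x - p i a.1| ≤ e a.1} ≤
      ENNReal.ofReal (2 * ρ a.1 * e a.1) := fun i a => by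
    have hsub : {x | |trunc 1 x - p i a.1| ≤ e a.1} ⊆ (Set.Icc 0 1)ᶜ ∪
        Set.Icc (p i a.1 - e a.1) (p i a.1 - e a.1 + 2 * e a.1) := by
      intro x hx
      by_cases h : x ∈ Set.Icc 0 1
      · right
        simp only [Set.mem_ofPred_eq, trunc_of_mem h, abs_le] at hx
        constructor <;> linarith [hx.1, hx.2]
      · exact Or.inl h
    refine (measure_mono hsub).trans ((measure_union_le _ _).trans ?_)
    rw [(hμ a).supp, zero_add]
    refine ((hμ a).ball _ _ (by linarith [he a.1])).trans_eq ?_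
    congr 1; ring
  rw [h1]
  refine (measure_biUnion_finset_le _ _).trans ?_
  calc _ ≤ ∑ i : Fin M, ENNReal.ofReal (∏ l, 2 * ρ l * e l) := Finset.sum_le_sum fun i _ => by
        rw [Measure.pi_pi, ENNReal.ofReal_prod_of_nonneg fun l _ => by
          have := he l; have := hρ l; positivity]
        refine (Finset.prod_le_prod' fun a _ => h2 i a).trans_eq ?_
        exact Fintype.prod_equiv (Equiv.prodUnique (Fin n) (Fin 0 → Br m)) _ _ fun a => rfl
    _ = _ := by
      rw [Finset.sum_const, nsmul_eq_mul, Finset.card_univ, Fintype.card_fin,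
        ENNReal.ofReal_mul (Nat.cast_nonneg M), ENNReal.ofReal_natCast]

/-- The measure of the set of roots of trees with leaves in a union of boxes. -/
theorem measure_blendTree_le (hmn : m ≤ n) (hn : 1 ≤ n) {ε : ℝ} (hε : 0 < ε) (hε1 : ε < 1)
    {M : ℕ} (p : Fin M → Fin n → ℝ) : ∀ (j : ℕ) (μ : Idx n m j → Measure ℝ)
    [∀ a, IsProbabilityMeasure (μ a)] (e ρ : Fin n → ℝ), (∀ l, ε ≤ e l) → (∀ l, 0 ≤ ρ l) →
    (∀ a, SmallBall (2 ^ j) (ρ a.1) (μ a)) →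
    Measure.pi μ {w | BlendTree (Boxes p e) j w} ≤ ENNReal.ofReal (ε ^ m *
      (Real.exp (growth j * n) * (M / ε ^ m * ∏ l, 2 * ρ l * e l)) ^ 2 ^ j) := by
  classical
  intro j
  induction j with
  | zero =>
    intro μ _ e ρ he hρ hμ
    refine (measure_boxes_le p (fun l => hε.le.trans (he l)) hρ fun a => by simpa using hμ a).trans_eq ?_
    congr 1
    have : ε ^ m ≠ 0 := by positivity
    simp only [growth, Finset.range_zero, Finset.sum_empty, zero_mul, Real.exp_zero, pow_zero, pow_one]
    field_simp
  | succ j ih =>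
    intro μ _ e ρ he hρ hμ
    have he0 : ∀ l, 0 < e l := fun l => hε.trans_le (he l)
    set D : ℝ := lipTree j * 2 ^ (3 * j + 2) with hD
    have hD1 : 1 ≤ D := one_le_mul_of_one_le_of_one_le (one_le_lipTree j) (one_le_pow₀ (by norm_num))
    have hDε : 1 ≤ D / ε := by rw [le_div_iff₀ hε]; linarith
    set g : ℕ := ⌈D / ε⌉₊ with hg
    have hg1 : D / ε ≤ g := Nat.le_ceil _
    have hg2 : (g : ℝ) ≤ 2 * D / ε := by
      have := Nat.ceil_lt_add_one (a := D / ε) (by linarith)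
      rw [mul_div_assoc]; linarith
    have hg0 : 0 < g := by exact_mod_cast (by linarith : (0 : ℝ) < g)
    have hg0' : (0 : ℝ) < g := by exact_mod_cast hg0
    obtain ⟨hfin, hcard⟩ := gridSet_finite_card m n hg0
    have h2j : (0 : ℝ) < 2 ^ j := by positivity
    let e' : (ℕ → ℝ) → Fin n → ℝ := fun G l => e l * (1 + cuts m G l / 2 ^ j)
    let ρ' : (ℕ → ℝ) → Fin n → ℝ := fun G l => ρ l * (1 + 2 * (cuts m G l + 1) / 2 ^ (j + 1))
    have hsub : {w | BlendTree (Boxes p e) (j + 1) w} ⊆ ⋃ q ∈ hfin.toFinset ×ˢ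
        (Finset.univ : Finset (Fin (m + 1) → Bool)),
        {w | BlendTree (Boxes p (e' q.1)) j (blend q.1 q.2 w) ∧
          BlendTree (Boxes p (e' q.1)) j (blend q.1 (fun i => !q.2 i) w)} := by
      rintro w ⟨P, s, hP, h1, h2⟩
      refine Set.mem_biUnion (x := (grid g P, s)) (by
        rw [Finset.mem_coe, Finset.mem_product]
        exact ⟨hfin.mem_toFinset.2 ⟨P, hP, rfl⟩, Finset.mem_univ _⟩) ?_
      have key : ∀ s, BlendTree (Boxes p e) j (blend P s w) →
          BlendTree (Boxes p (e' (grid g P))) j (blend (grid g P) s w) := fun s h => by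
        refine (h.perturb (κ := fun l => 2 ^ j * (2 ^ (j + 1) * (2 * cuts m P l / g)))
          fun a => hP.abs_blend_grid_sub_le hg0 s w a).mono fun v ⟨i, hi⟩ => ⟨i, fun a => (hi a).trans ?_⟩
        simp only [e', cuts_grid hP hg0]
        have h1 : D / g ≤ e a.1 := by
          rw [div_le_iff₀ hg0']
          rw [div_le_iff₀ hε] at hg1
          have := mul_le_mul_of_nonneg_right (he a.1) hg0'.le
          linarith
        calc _ = e a.1 + D / g * (cuts m P a.1 / 2 ^ j) := by
              rw [hD]; field_simp; ring
          _ ≤ e a.1 + e a.1 * (cuts m P a.1 / 2 ^ j) := by gcongr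
          _ = _ := by ring
      exact ⟨key s h1, key _ h2⟩
    set B : ℝ := M / ε ^ m * ∏ l, 2 * ρ l * e l with hB
    have hprod0 : 0 ≤ ∏ l, 2 * ρ l * e l := Finset.prod_nonneg fun l _ => by
      have := he0 l; have := hρ l; positivity
    have hB0 : 0 ≤ B := by positivity
    set X : ℝ := ε ^ m * (Real.exp (growth j * n) * (B * Real.exp (3 * n / 2 ^ j))) ^ 2 ^ j with hX
    have hX0 : 0 ≤ X := by positivity
    have hstep : ∀ q ∈ hfin.toFinset ×ˢ (Finset.univ : Finset (Fin (m + 1) → Bool)),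
        Measure.pi μ {w | BlendTree (Boxes p (e' q.1)) j (blend q.1 q.2 w) ∧
          BlendTree (Boxes p (e' q.1)) j (blend q.1 (fun i => !q.2 i) w)} ≤
          ENNReal.ofReal (X * X) := by
      rintro ⟨G, s⟩ hq
      obtain ⟨P, hP, rfl⟩ := hfin.mem_toFinset.1 (Finset.mem_product.1 hq).1
      have hG := hP.grid hg0
      dsimp only
      set G := grid g P
      have hbound : ε ^ m * (Real.exp (growth j * n) *
          (M / ε ^ m * ∏ l, 2 * ρ' G l * e' G l)) ^ 2 ^ j ≤ X := by
        have hpr : ∏ l, 2 * ρ' G l * e' G l ≤ (∏ l, 2 * ρ l * e l) * Real.exp (3 * n / 2 ^ j) := by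
          have hQ : (∑ l : Fin n, (cuts m G l : ℝ)) ≤ n := by
            have := (sum_cuts_le (m := m) G n).trans hmn
            exact_mod_cast this
          calc _ ≤ ∏ l, (2 * ρ l * e l) * Real.exp ((2 * cuts m G l + 1) / 2 ^ j) := by
                refine Finset.prod_le_prod (fun l _ => ?_) fun l _ => ?_
                · have := he0 l; have := hρ l
                  simp only [e', ρ']; positivity
                · have h1 : 1 + 2 * ((cuts m G l : ℝ) + 1) / 2 ^ (j + 1) ≤
                      Real.exp ((cuts m G l + 1) / 2 ^ j) := by
                    refine le_trans (le_of_eq ?_) (Real.add_one_le_exp _)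
                    field_simp; ring
                  have h2 : 1 + (cuts m G l : ℝ) / 2 ^ j ≤ Real.exp (cuts m G l / 2 ^ j) := by
                    refine le_trans (le_of_eq (add_comm _ _)) (Real.add_one_le_exp _)
                  have h3 := mul_le_mul h1 h2 (by positivity) (Real.exp_nonneg _)
                  rw [← Real.exp_add] at h3
                  have h4 : 0 ≤ 2 * ρ l * e l := by
                    have := he0 l; have := hρ l; positivity
                  calc _ = 2 * ρ l * e l * ((1 + 2 * ((cuts m G l : ℝ) + 1) / 2 ^ (j + 1)) *
                        (1 + (cuts m G l : ℝ) / 2 ^ j)) := by simp only [e', ρ']; ring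
                    _ ≤ _ := by
                      refine mul_le_mul_of_nonneg_left (h3.trans_eq ?_) h4
                      congr 1; ring
            _ = (∏ l, 2 * ρ l * e l) * Real.exp (∑ l : Fin n, (2 * (cuts m G l : ℝ) + 1) / 2 ^ j) := by
                rw [Finset.prod_mul_distrib, Real.exp_sum]
            _ ≤ _ := by
                refine mul_le_mul_of_nonneg_left (Real.exp_le_exp.2 ?_) hprod0
                rw [← Finset.sum_div, Finset.sum_add_distrib, ← Finset.mul_sum]
                simp only [Finset.sum_const, Finset.card_univ, Fintype.card_fin, nsmul_eq_mul, mul_one]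
                gcongr
                linarith
        have hpr0 : 0 ≤ ∏ l, 2 * ρ' G l * e' G l := Finset.prod_nonneg fun l _ => by
          have := he0 l; have := hρ l
          simp only [e', ρ']; positivity
        rw [hX, hB, mul_assoc (M / ε ^ m : ℝ)]
        gcongr
      have hone : ∀ s', (Measure.pi fun a => (Measure.pi μ).map fun w => blend G s' w a)
          {v | BlendTree (Boxes p (e' G)) j v} ≤ ENNReal.ofReal X := fun s' => by
        have : ∀ a, IsProbabilityMeasure ((Measure.pi μ).map fun w => blend G s' w a) := fun a =>
          Measure.isProbabilityMeasure_map (measurable_blend G s' a).aemeasurable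
        refine (ih _ (e' G) (ρ' G) (fun l => (he l).trans ?_) (fun l => ?_)
          fun a => smallBall_blend hρ hμ hG s' a).trans (ENNReal.ofReal_le_ofReal hbound)
        · exact le_mul_of_one_le_right (he0 l).le (le_add_of_nonneg_right (by positivity))
        · exact mul_nonneg (hρ l) (by positivity)
      refine (pi_blend_le G s _).trans ?_
      rw [ENNReal.ofReal_mul hX0]
      exact mul_le_mul' (hone s) (hone _)
    refine (measure_mono hsub).trans ((measure_biUnion_finset_le _ _).trans
      ((Finset.sum_le_sum hstep).trans ?_))
    rw [Finset.sum_const, nsmul_eq_mul, ← ENNReal.ofReal_natCast, ← ENNReal.ofReal_mul (by positivity)]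
    refine ENNReal.ofReal_le_ofReal ?_
    have hc : (((hfin.toFinset ×ˢ (Finset.univ : Finset (Fin (m + 1) → Bool))).card : ℕ) : ℝ) ≤
        Real.exp (7 * (j + 1) ^ 2 * n) / ε ^ m := by
      rw [Finset.card_product, ← Set.ncard_eq_toFinset_card _ hfin]
      simp only [Finset.card_univ, Fintype.card_pi, Fintype.card_bool, Finset.prod_const,
        Fintype.card_fin]
      push_cast
      have h1 : ((gridSet m n g).ncard : ℝ) ≤ 2 ^ (n + m) * (2 * D / ε) ^ m := by
        have : ((gridSet m n g).ncard : ℝ) ≤ 2 ^ (n + m) * (g : ℝ) ^ m := by exact_mod_cast hcard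
        refine this.trans ?_
        gcongr
      calc _ ≤ 2 ^ (n + m) * (2 * D / ε) ^ m * 2 ^ (m + 1) := by gcongr
        _ = 2 ^ (n + m + (m + 1)) * (2 * D) ^ m / ε ^ m := by rw [div_pow]; ring
        _ ≤ (2 ^ (4 * n) * (2 * D) ^ n) / ε ^ m := by
          gcongr
          · norm_num
          · omega
          · linarith
        _ = (lipTree j * 2 ^ (3 * j + 7)) ^ n / ε ^ m := by
          rw [pow_mul, ← mul_pow, hD]; congr 2; ring
        _ ≤ (2 ^ (7 * (j + 1) ^ 2)) ^ n / ε ^ m := by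
          have hl := lipTree_pos j
          gcongr
          calc _ ≤ (2 : ℝ) ^ (j * j) * 2 ^ (3 * j + 7) := by
                gcongr; exact lipTree_le j
            _ = 2 ^ (j * j + (3 * j + 7)) := by rw [← pow_add]
            _ ≤ _ := pow_le_pow_right₀ (by norm_num) (by nlinarith)
        _ ≤ (Real.exp (7 * (j + 1) ^ 2)) ^ n / ε ^ m := by
          gcongr
          have := two_pow_le_exp (7 * (j + 1) ^ 2)
          push_cast at this
          exact this
        _ = _ := by
          rw [← Real.exp_nat_mul]; congr 2; ring
    refine (mul_le_mul_of_nonneg_right hc (by positivity)).trans ?_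
    have hεm : ε ^ m ≠ 0 := by positivity
    have e1 : Real.exp (7 * (j + 1) ^ 2 * n) / ε ^ m * (X * X) = ε ^ m *
        (Real.exp (growth j * n + 3 * n / 2 ^ j + 7 * (j + 1) ^ 2 * n / 2 ^ (j + 1)) * B) ^ 2 ^ (j + 1) := by
      have e2 : Real.exp (7 * (j + 1) ^ 2 * n) =
          Real.exp (7 * (j + 1) ^ 2 * n / 2 ^ (j + 1)) ^ 2 ^ (j + 1) := by
        rw [← Real.exp_nat_mul]; congr 1; push_cast; field_simp
      have e3 : X * X = ε ^ m * ε ^ m *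
          (Real.exp (growth j * n) * (B * Real.exp (3 * n / 2 ^ j))) ^ 2 ^ (j + 1) := by
        rw [hX, pow_succ 2 j, pow_mul, sq]; ring
      rw [e2, e3, Real.exp_add, Real.exp_add]
      clear_value B
      generalize Real.exp (growth j * n) = E₁, Real.exp (3 * n / 2 ^ j) = E₂,
        Real.exp (7 * (j + 1) ^ 2 * n / 2 ^ (j + 1)) = E₃
      simp only [mul_pow]
      field_simp
    rw [e1]
    gcongr
    have hgr : growth (j + 1) = growth j + 10 * ((j : ℝ) + 1) ^ 2 / 2 ^ j :=
      Finset.sum_range_succ _ _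
    rw [hgr, add_mul, add_assoc]
    refine add_le_add le_rfl ?_
    have hj : (1 : ℝ) ≤ ((j : ℝ) + 1) ^ 2 := one_le_pow₀ (by linarith [Nat.cast_nonneg (α := ℝ) j])
    have hn0 : (0 : ℝ) ≤ n := Nat.cast_nonneg n
    have := mul_le_mul_of_nonneg_right hj hn0
    have e4 : 3 * (n : ℝ) / 2 ^ j + 7 * (j + 1) ^ 2 * n / 2 ^ (j + 1) =
        (6 * n + 7 * ((j + 1) ^ 2 * n)) / 2 ^ (j + 1) := by
      field_simp; ring
    have e5 : 10 * ((j : ℝ) + 1) ^ 2 / 2 ^ j * n = 20 * ((j + 1) ^ 2 * n) / 2 ^ (j + 1) := by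
      field_simp; ring
    rw [e4, e5]
    gcongr
    linarith

end Waist

section Waist

open MeasureTheory ProbabilityTheory

variable {m n j : ℕ}

/-- The uniform distribution on `[0, K]`. -/
def uniformLaw (K : ℝ) : Measure ℝ := (ENNReal.ofReal K)⁻¹ • volume.restrict (Set.Icc 0 K)

theorem isProbabilityMeasure_uniformLaw {K : ℝ} (hK : 0 < K) :
    IsProbabilityMeasure (uniformLaw K) := by
  constructor
  rw [uniformLaw, Measure.smul_apply, Measure.restrict_apply_univ, Real.volume_Icc, sub_zero,
    smul_eq_mul]
  exact ENNReal.inv_mul_cancel (by simpa using hK) ENNReal.ofReal_ne_top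

theorem smallBall_uniformLaw {K : ℝ} (hK : 0 < K) : SmallBall K 1 (uniformLaw K) where
  supp := by
    rw [uniformLaw, Measure.smul_apply, Measure.restrict_apply measurableSet_Icc.compl]
    simp
  ball x t ht := by
    rw [uniformLaw, Measure.smul_apply, smul_eq_mul, one_mul, ENNReal.ofReal_div_of_pos hK,
      ENNReal.div_eq_inv_mul]
    gcongr
    refine (Measure.restrict_apply_le _ _).trans_eq ?_
    rw [Real.volume_Icc, add_sub_cancel_left]

/-- A weak waist inequality for maps from the cube to a Euclidean space, in terms of coverings
of the fibres by small boxes. -/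
theorem exists_waist : ∃ C : ℝ, 1 ≤ C ∧ ∀ n m : ℕ, 1 ≤ n → m ≤ n →
    ∀ f : (Fin n → ℝ) → Fin m → ℝ, ContinuousOn f (Set.pi Set.univ fun _ => Set.Icc 0 1) →
    ∀ δ > 0, ∀ ε : ℝ, 0 < ε → ε < 1 → ∀ M : ℕ,
    (∀ y, ∃ p : Fin M → Fin n → ℝ, ∀ x ∈ Set.pi Set.univ fun _ => Set.Icc (0 : ℝ) 1,
      dist (f x) y ≤ δ → ∃ i, ∀ l, |x l - p i l| ≤ ε) →
    1 ≤ C ^ n * (ε ^ n / ε ^ m) * M := by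
  obtain ⟨Γ, hΓ0, hΓ⟩ := exists_growth_le
  refine ⟨2 * Real.exp Γ, by linarith [Real.one_le_exp hΓ0], ?_⟩
  intro n m hn hmn f hf δ hδ ε hε hε1 M hM
  set Q : Set (Fin n → ℝ) := Set.pi Set.univ fun _ => Set.Icc 0 1 with hQ
  have hQc : IsCompact Q := isCompact_univ_pi fun _ => isCompact_Icc
  let r : (Idx n m 0 → ℝ) → Fin n → ℝ := fun v l => v (l, default)
  have hr : UniformContinuous r := uniformContinuous_pi.2 fun l => Pi.uniformContinuous_proj _ _
  let F : (Idx n m 0 → ℝ) → Fin m → ℝ := fun v => f (clip 0 1 (r v))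
  have hF : UniformContinuous F := (uniformContinuous_comp_clip zero_le_one hf).comp hr
  have hcl : ∀ v, clip 0 1 (r v) ∈ Q := fun v l _ => clip_mem zero_le_one _ l
  obtain ⟨Z, -, hZfin, hZ⟩ := (hQc.image_of_continuousOn hf).finite_cover_balls
    (e := δ / 3) (by positivity)
  choose p hp using hM
  have htree : ∀ k (w : Idx n m k → ℝ), ∃ z ∈ hZfin.toFinset,
      BlendTree (Boxes (p z) fun _ => ε) k w := by
    intro k w
    obtain ⟨y, hy⟩ := exists_tree hF (η := δ / 3) (by positivity) k w
    obtain ⟨v, hv⟩ := exists_tree_mem hy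
    obtain ⟨z, hz, hvz⟩ := Set.mem_iUnion₂.1 (hZ (Set.mem_image_of_mem f (hcl v)))
    refine ⟨z, hZfin.mem_toFinset.2 hz, hy.mono fun u hu => ?_⟩
    have hd : dist (f (clip 0 1 (r u))) z ≤ δ := by
      have h1 : dist (F u) y ≤ δ / 3 := hu
      have h2 : dist (F v) z < δ / 3 := hvz
      have h3 := dist_triangle4 (F u) y (F v) z
      rw [dist_comm y] at h3
      change dist (F u) z ≤ δ
      linarith
    obtain ⟨i, hi⟩ := hp z _ (hcl u) hd
    refine ⟨i, fun a => ?_⟩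
    obtain ⟨l, e⟩ := a
    obtain rfl := Subsingleton.elim e default
    exact hi l
  set x : ℝ := Real.exp (Γ * n) * (M / ε ^ m * (2 * ε) ^ n) with hx
  have hx0 : 0 ≤ x := by positivity
  have hxC : x = (2 * Real.exp Γ) ^ n * (ε ^ n / ε ^ m) * M := by
    rw [hx, mul_pow, mul_pow, mul_comm Γ, Real.exp_nat_mul]
    ring
  rw [← hxC]
  by_contra! hlt
  have hk : ∀ k, 1 ≤ hZfin.toFinset.card * ε ^ m * x ^ 2 ^ k := by
    intro k
    have h2k : (0 : ℝ) < 2 ^ k := by positivity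
    have : IsProbabilityMeasure (uniformLaw (2 ^ k)) := isProbabilityMeasure_uniformLaw h2k
    have h1 := fun z => measure_blendTree_le hmn hn hε hε1 (p z) k (fun _ => uniformLaw (2 ^ k))
      (fun _ => ε) (fun _ => 1) (fun _ => le_rfl) (fun _ => zero_le_one)
      fun _ => smallBall_uniformLaw h2k
    have h2 : ε ^ m * (Real.exp (growth k * n) * (M / ε ^ m * ∏ _l : Fin n, 2 * 1 * ε)) ^ 2 ^ k ≤
        ε ^ m * x ^ 2 ^ k := by
      rw [hx, Finset.prod_const, Finset.card_univ, Fintype.card_fin, mul_one]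
      gcongr
      exact hΓ k
    have h3 : (1 : ℝ≥0∞) ≤ ∑ z ∈ hZfin.toFinset, ENNReal.ofReal (ε ^ m * x ^ 2 ^ k) := by
      calc (1 : ℝ≥0∞) = Measure.pi (fun _ : Idx n m k => uniformLaw (2 ^ k)) Set.univ :=
            measure_univ.symm
        _ ≤ Measure.pi (fun _ : Idx n m k => uniformLaw (2 ^ k))
            (⋃ z ∈ hZfin.toFinset, {w | BlendTree (Boxes (p z) fun _ => ε) k w}) := by
          refine measure_mono fun w _ => ?_
          obtain ⟨z, hz, h⟩ := htree k w
          exact Set.mem_biUnion hz h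
        _ ≤ _ := (measure_biUnion_finset_le _ _).trans
            (Finset.sum_le_sum fun z _ => (h1 z).trans (ENNReal.ofReal_le_ofReal h2))
    rw [Finset.sum_const, nsmul_eq_mul, ← ENNReal.ofReal_natCast,
      ← ENNReal.ofReal_mul (by positivity), ENNReal.one_le_ofReal, ← mul_assoc] at h3
    exact h3
  have hlim : Tendsto (fun k : ℕ => hZfin.toFinset.card * ε ^ m * x ^ 2 ^ k) atTop (𝓝 0) := by
    have h1 : Tendsto (fun k : ℕ => 2 ^ k) atTop (atTop : Filter ℕ) :=
      tendsto_pow_atTop_atTop_of_one_lt one_lt_two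
    simpa using ((tendsto_pow_atTop_nhds_zero_of_lt_one hx0 hlt).comp h1).const_mul
      (hZfin.toFinset.card * ε ^ m : ℝ)
  linarith [ge_of_tendsto' hlim hk]

end Waist

section Toeplitz

/-- The data for a Toeplitz subshift with holes of density decreasing to `σ`. At stage `k` the
sequence has period `L k`, with `h k` holes per period; the blocks of the next period are, in this
order, `J k` blocks filled with patterns, `p k` blocks left as they are, and blocks filled with
zeros. -/
structure Toeplitz (a : ℕ) (σ : ℝ) where
  (L h q J p : ℕ → ℕ)
  pat : ℕ → ℕ → ℤ → Cube a
  L_zero : L 0 = 1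
  h_zero : h 0 = 1
  L_succ : ∀ k, L (k + 1) = q k * L k
  h_succ : ∀ k, h (k + 1) = p k * h k
  one_le_J : ∀ k, 1 ≤ J k
  one_le_p : ∀ k, 1 ≤ p k
  lt_q : ∀ k, J k + p k < q k
  lt_h : ∀ k, σ * L k < h k
  h_le : ∀ k, (h (k + 1) : ℝ) ≤ (σ + 1 / (k + 1)) * L (k + 1)
  dyadic : ∀ k c n i, ∃ z : ℤ, (pat k c n i : ℝ) * 2 ^ k = z
  dense : ∀ k (g : ℤ → Cube a), ∃ c < J k, ∀ n : ℤ, 0 ≤ n → n < L k →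
    ∀ i, |(g n i : ℝ) - pat k c n i| ≤ 1 / 2 ^ k

theorem exists_patterns (a k l : ℕ) : ∃ (J : ℕ) (pat : ℕ → ℤ → Cube a), 1 ≤ J ∧
    (∀ c n i, ∃ z : ℤ, (pat c n i : ℝ) * 2 ^ k = z) ∧
    ∀ g : ℤ → Cube a, ∃ c < J, ∀ n : ℤ, 0 ≤ n → n < l → ∀ i, |(g n i : ℝ) - pat c n i| ≤ 1 / 2 ^ k := by
  have h2 : (0 : ℝ) < 2 ^ k := by positivity
  let val : Fin (2 ^ k + 1) → unitInterval := fun v => ⟨v / 2 ^ k, by positivity,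
    (div_le_one h2).2 (by exact_mod_cast Nat.lt_succ_iff.1 v.2)⟩
  let E := Fintype.equivFin (Fin l → Fin a → Fin (2 ^ k + 1))
  let pat : ℕ → ℤ → Cube a := fun c n i => if h : c < Fintype.card (Fin l → Fin a → Fin (2 ^ k + 1)) ∧
    n.toNat < l then val (E.symm ⟨c, h.1⟩ ⟨n.toNat, h.2⟩ i) else 0
  refine ⟨_, pat, Fintype.card_pos (α := Fin l → Fin a → Fin (2 ^ k + 1)), fun c n i => ?_, fun g => ?_⟩
  · by_cases h : c < Fintype.card (Fin l → Fin a → Fin (2 ^ k + 1)) ∧ n.toNat < l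
    · refine ⟨E.symm ⟨c, h.1⟩ ⟨n.toNat, h.2⟩ i, ?_⟩
      simp only [pat, dif_pos h, val]
      push_cast
      field_simp
    · refine ⟨0, ?_⟩
      simp only [pat, dif_neg h]
      simp
  · have hf : ∀ z : unitInterval, ⌊(z : ℝ) * 2 ^ k⌋₊ < 2 ^ k + 1 := fun z => by
      refine Nat.lt_succ_iff.2 (Nat.floor_le_of_le ?_)
      push_cast
      exact mul_le_of_le_one_left h2.le z.2.2
    let φ : Fin l → Fin a → Fin (2 ^ k + 1) := fun n i => ⟨⌊(g n i : ℝ) * 2 ^ k⌋₊, hf _⟩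
    refine ⟨E φ, (E φ).2, fun n hn hnl i => ?_⟩
    have h : ((E φ : ℕ) < Fintype.card (Fin l → Fin a → Fin (2 ^ k + 1))) ∧ n.toNat < l :=
      ⟨(E φ).2, by omega⟩
    have e : pat (E φ) n i = val (φ ⟨n.toNat, h.2⟩ i) := by
      simp only [pat, dif_pos h, Fin.eta, Equiv.symm_apply_apply]
    have e' : ((n.toNat : ℕ) : ℤ) = n := Int.toNat_of_nonneg hn
    rw [e]
    simp only [φ, val, e']
    have h3 := Nat.floor_le (a := (g n i : ℝ) * 2 ^ k) (mul_nonneg (g n i).2.1 h2.le)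
    have h4 := Nat.lt_floor_add_one ((g n i : ℝ) * 2 ^ k)
    have e3 : (g n i : ℝ) - ⌊(g n i : ℝ) * 2 ^ k⌋₊ / 2 ^ k =
        ((g n i : ℝ) * 2 ^ k - ⌊(g n i : ℝ) * 2 ^ k⌋₊) / 2 ^ k := by field_simp
    rw [e3, abs_of_nonneg (div_nonneg (by linarith) h2.le)]
    gcongr
    linarith

theorem exists_stage {σ : ℝ} (hσ : 0 ≤ σ) (k J l h : ℕ) (hl : σ * l < h) (hh : h ≤ l) (h0 : 0 < h) :
    ∃ q p : ℕ, 1 ≤ p ∧ J + p < q ∧ σ * (q * l : ℕ) < (p * h : ℕ) ∧ p * h ≤ q * l ∧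
      ((p * h : ℕ) : ℝ) ≤ (σ + 1 / (k + 1)) * (q * l : ℕ) := by
  have hh0 : (0 : ℝ) < h := by exact_mod_cast h0
  have hl0 : (0 : ℝ) < l := by exact_mod_cast h0.trans_le hh
  set τ : ℝ := σ * l / h with hτ
  have hτ0 : 0 ≤ τ := by positivity
  have hτ1 : τ < 1 := (div_lt_one hh0).2 hl
  have hτh : τ * h = σ * l := by rw [hτ]; field_simp
  obtain ⟨q, hq⟩ := exists_nat_ge (max (k + 1 : ℝ) ((J + 2) / (1 - τ)))
  have hq1 : (k : ℝ) + 1 ≤ q := (le_max_left _ _).trans hq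
  have hq2 : (J : ℝ) + 2 ≤ q * (1 - τ) := (div_le_iff₀ (by linarith)).1 ((le_max_right _ _).trans hq)
  have hτq : 0 ≤ τ * q := by positivity
  have hp1 := Nat.floor_le hτq
  have hp2 := Nat.lt_floor_add_one (τ * q)
  have hJ : J + (⌊τ * q⌋₊ + 1) < q := by
    have : ((J + (⌊τ * q⌋₊ + 1) : ℕ) : ℝ) < q := by push_cast; linarith
    exact_mod_cast this
  refine ⟨q, ⌊τ * q⌋₊ + 1, by omega, hJ, ?_, ?_, ?_⟩
  · push_cast
    calc σ * (q * l) = (τ * q) * h := by linear_combination -(q : ℝ) * hτh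
      _ < _ := by gcongr
  · exact Nat.mul_le_mul (by omega) hh
  · push_cast
    have h1 : (h : ℝ) ≤ l := by exact_mod_cast hh
    calc ((⌊τ * q⌋₊ : ℝ) + 1) * h ≤ (τ * q + 1) * h := by gcongr
      _ = σ * (q * l) + h := by linear_combination (q : ℝ) * hτh
      _ ≤ σ * (q * l) + q / (k + 1) * l := by
        gcongr
        refine h1.trans (le_mul_of_one_le_left hl0.le ((one_le_div (by positivity)).2 hq1))
      _ = _ := by ring

theorem exists_toeplitz (a : ℕ) {σ : ℝ} (hσ : 0 ≤ σ) (hσ1 : σ < 1) : Nonempty (Toeplitz a σ) := by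
  choose J pat hJ hdy hde using exists_patterns a
  let St := {x : ℕ × ℕ // σ * x.1 < x.2 ∧ x.2 ≤ x.1 ∧ 0 < x.2}
  have hstage := fun (k : ℕ) (x : St) => exists_stage hσ k (J k x.1.1) x.1.1 x.1.2 x.2.1 x.2.2.1 x.2.2.2
  choose q p h1 h2 h3 h4 h5 using hstage
  let st : ℕ → St := fun k => Nat.rec ⟨(1, 1), by simpa using hσ1, le_rfl, one_pos⟩
    (fun k x => ⟨(q k x * x.1.1, p k x * x.1.2), h3 k x, h4 k x,
      Nat.mul_pos (h1 k x) x.2.2.2⟩) k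
  exact ⟨{
    L := fun k => (st k).1.1
    h := fun k => (st k).1.2
    q := fun k => q k (st k)
    J := fun k => J k (st k).1.1
    p := fun k => p k (st k)
    pat := fun k => pat k (st k).1.1
    L_zero := rfl
    h_zero := rfl
    L_succ := fun _ => rfl
    h_succ := fun _ => rfl
    one_le_J := fun _ => hJ _ _
    one_le_p := fun _ => h1 _ _
    lt_q := fun _ => h2 _ _
    lt_h := fun k => (st k).2.1
    h_le := fun k => h5 k (st k)
    dyadic := fun _ => hdy _ _
    dense := fun _ => hde _ _ }⟩

end Toeplitz

section Toeplitz

namespace Toeplitz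

variable {a : ℕ} {σ : ℝ} (S : Toeplitz a σ)

/-- The index of the block of length `L k` containing `n` in its period of length `L (k + 1)`. -/
def block (k : ℕ) (n : ℤ) : ℤ := n / S.L k % S.q k

/-- The holes of the Toeplitz sequence at stage `k`. -/
def hole : ℕ → Set ℤ
  | 0 => Set.univ
  | k + 1 => {n | n ∈ hole k ∧ (S.J k : ℤ) ≤ S.block k n ∧ S.block k n < S.J k + S.p k}

open Classical in
/-- The values of the Toeplitz sequence at stage `k`; they are only relevant outside the holes. -/
def val : ℕ → ℤ → Cube a
  | 0, _ => 0
  | k + 1, n => if n ∈ S.hole k then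
      (if S.block k n < S.J k then S.pat k (S.block k n).toNat (n % S.L k) else 0) else val k n

theorem q_pos (k : ℕ) : 0 < S.q k := (Nat.zero_le _).trans_lt (S.lt_q k)

theorem L_pos : ∀ k, 0 < S.L k
  | 0 => S.L_zero ▸ one_pos
  | k + 1 => S.L_succ k ▸ Nat.mul_pos (S.q_pos k) (L_pos k)

theorem two_pow_le_L : ∀ k, 2 ^ k ≤ S.L k
  | 0 => S.L_zero ▸ le_rfl
  | k + 1 => by
    rw [S.L_succ, pow_succ, mul_comm]
    have := S.lt_q k
    have := S.one_le_J k
    exact Nat.mul_le_mul (by omega) (two_pow_le_L k)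

theorem cast_L_succ (k : ℕ) : (S.L (k + 1) : ℤ) = S.L k * S.q k := by
  rw [S.L_succ]; push_cast; ring

theorem cast_L_pos (k : ℕ) : (0 : ℤ) < S.L k := by exact_mod_cast S.L_pos k

theorem block_add (k : ℕ) (n t : ℤ) : S.block k (n + S.L (k + 1) * t) = S.block k n := by
  rw [block, cast_L_succ, mul_assoc, Int.add_mul_ediv_left _ _ (S.cast_L_pos k).ne',
    Int.add_mul_emod_self_left, block]

theorem block_mul_add (k : ℕ) {c r : ℤ} (hc : 0 ≤ c) (hc' : c < S.q k) (hr : 0 ≤ r)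
    (hr' : r < S.L k) : S.block k (r + S.L k * c) = c := by
  rw [block, Int.add_mul_ediv_left _ _ (S.cast_L_pos k).ne', Int.ediv_eq_zero_of_lt hr hr', zero_add,
    Int.emod_eq_of_lt hc hc']

theorem hole_add (k : ℕ) (n t : ℤ) : n + S.L k * t ∈ S.hole k ↔ n ∈ S.hole k := by
  induction k generalizing t with
  | zero => exact Iff.rfl
  | succ k ih =>
    have h := ih (S.q k * t)
    rw [← mul_assoc, ← cast_L_succ] at h
    simp only [hole, Set.mem_ofPred_eq, block_add, h]

theorem val_add (k : ℕ) (n t : ℤ) : S.val k (n + S.L k * t) = S.val k n := by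
  induction k generalizing t with
  | zero => rfl
  | succ k ih =>
    classical
    have h := S.hole_add k n (S.q k * t)
    have h' := ih (S.q k * t)
    have h'' := Int.add_mul_emod_self_left n (S.L k) (S.q k * t)
    rw [← mul_assoc, ← cast_L_succ] at h h' h''
    simp only [val, block_add, h', h'']
    exact if_congr h rfl rfl

theorem hole_emod (k : ℕ) (n : ℤ) : n % S.L k ∈ S.hole k ↔ n ∈ S.hole k := by
  conv_rhs => rw [← Int.emod_add_mul_ediv n (S.L k)]
  exact (S.hole_add k _ _).symm

theorem hole_succ_subset (k : ℕ) : S.hole (k + 1) ⊆ S.hole k := fun _ h => h.1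

theorem antitone_hole : Antitone S.hole := antitone_nat_of_succ_le S.hole_succ_subset

theorem val_succ_of_notMem {k : ℕ} {n : ℤ} (h : n ∉ S.hole k) : S.val (k + 1) n = S.val k n := by
  rw [val, if_neg h]

theorem dyadic_val (k : ℕ) (n : ℤ) (i : Fin a) : ∃ z : ℤ, (S.val k n i : ℝ) * 2 ^ k = z := by
  induction k with
  | zero => exact ⟨0, by simp [val]⟩
  | succ k ih =>
    have key : ∀ x : ℝ, (∃ z : ℤ, x * 2 ^ k = z) → ∃ z : ℤ, x * 2 ^ (k + 1) = z := by
      rintro x ⟨z, hz⟩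
      exact ⟨2 * z, by push_cast; rw [← hz]; ring⟩
    rw [val]
    split_ifs
    · exact key _ (S.dyadic k _ _ i)
    · exact ⟨0, by simp⟩
    · exact key _ ih

open Classical in
/-- The holes at stage `k` in an interval. -/
def holes (k : ℕ) (m M : ℤ) : Finset ℤ := (Finset.Ico m M).filter (· ∈ S.hole k)

theorem mem_holes {k : ℕ} {m M n : ℤ} : n ∈ S.holes k m M ↔ (m ≤ n ∧ n < M) ∧ n ∈ S.hole k := by
  simp [holes]

theorem card_holes_period (k : ℕ) (m : ℤ) :
    (S.holes k m (m + S.L k)).card = (S.holes k 0 (S.L k)).card := by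
  classical
  refine Finset.card_nbij (· % (S.L k : ℤ)) (fun n hn => ?_) (fun n hn n' hn' h => ?_) fun r hr => ?_
  · rw [Finset.mem_coe, S.mem_holes] at hn
    exact S.mem_holes.2 ⟨⟨Int.emod_nonneg _ (S.cast_L_pos k).ne', Int.emod_lt_of_pos _ (S.cast_L_pos k)⟩,
      (S.hole_emod k n).2 hn.2⟩
  · simp only [Finset.mem_coe, mem_holes] at hn hn'
    obtain ⟨t, ht⟩ := Int.ModEq.dvd (n := (S.L k : ℤ)) (a := n) (b := n') h
    have hL := S.cast_L_pos k
    have h1 : t < 1 := by nlinarith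
    have h2 : -1 < t := by nlinarith
    obtain rfl : t = 0 := by omega
    linarith
  · have hr' := S.mem_holes.1 (Finset.mem_coe.1 hr)
    have h1 := Int.image_Ico_emod m (S.L k) (S.cast_L_pos k).le
    have h2 : r ∈ (Finset.Ico m (m + S.L k)).image (· % (S.L k : ℤ)) := by
      rw [h1]; simpa using hr'.1
    obtain ⟨n, hn, rfl⟩ := Finset.mem_image.1 h2
    exact ⟨n, S.mem_holes.2 ⟨Finset.mem_Ico.1 hn, (S.hole_emod k n).1 hr'.2⟩, rfl⟩

theorem card_holes_L : ∀ k, (S.holes k 0 (S.L k)).card = S.h k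
  | 0 => by
    rw [S.L_zero, S.h_zero]
    have : S.holes 0 0 (1 : ℕ) = {0} := by
      ext n
      simp only [mem_holes, Finset.mem_singleton, hole, Set.mem_univ, and_true]
      push_cast
      omega
    rw [this, Finset.card_singleton]
  | k + 1 => by
    classical
    have hL := S.cast_L_pos k
    have hq := S.lt_q k
    have : S.holes (k + 1) 0 (S.L (k + 1)) =
        (Finset.Ico (S.J k : ℤ) (S.J k + S.p k) ×ˢ S.holes k 0 (S.L k)).image
          fun x => x.2 + (S.L k : ℤ) * x.1 := by
      ext n
      simp only [mem_holes, Finset.mem_image, Finset.mem_product, Finset.mem_Ico, Prod.exists]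
      constructor
      · rintro ⟨⟨h0, h1⟩, h2, h3⟩
        have hb : S.block k n = n / S.L k := by
          refine Int.emod_eq_of_lt (Int.ediv_nonneg h0 hL.le) ?_
          rw [cast_L_succ] at h1
          exact Int.ediv_lt_of_lt_mul hL (by linarith)
        rw [hb] at h3
        exact ⟨n / S.L k, n % S.L k, ⟨h3, ⟨Int.emod_nonneg _ hL.ne', Int.emod_lt_of_pos _ hL⟩,
          (S.hole_emod k n).2 h2⟩, Int.emod_add_mul_ediv _ _⟩
      · rintro ⟨c, r, ⟨⟨h1, h2⟩, ⟨h3, h4⟩, h5⟩, rfl⟩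
        have hb := S.block_mul_add k (c := c) (r := r) (by omega) (by omega) h3 h4
        refine ⟨⟨?_, ?_⟩, (S.hole_add k r c).2 h5, by rw [hb]; exact ⟨h1, h2⟩⟩
        · have : 0 ≤ c := by omega
          positivity
        · rw [cast_L_succ]
          have : c + 1 ≤ S.q k := by omega
          nlinarith
    rw [this, Finset.card_image_of_injOn, Finset.card_product, card_holes_L k, S.h_succ]
    · simp
    · rintro ⟨c, r⟩ hx ⟨c', r'⟩ hx' h
      simp only [Finset.coe_product, Set.mem_prod, Finset.mem_coe, mem_holes, Finset.mem_Ico] at hx hx'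
      have h1 := S.block_mul_add k (c := c) (r := r) (by omega) (by omega) hx.2.1.1 hx.2.1.2
      have h2 := S.block_mul_add k (c := c') (r := r') (by omega) (by omega) hx'.2.1.1 hx'.2.1.2
      have h3 : r + S.L k * c = r' + S.L k * c' := h
      rw [h3, h2] at h1
      subst h1
      simp only [add_left_inj] at h3
      rw [h3]

theorem card_holes_mul (k : ℕ) (m : ℤ) (t : ℕ) :
    (S.holes k m (m + S.L k * t)).card = t * S.h k := by
  classical
  induction t with
  | zero => simp [holes]
  | succ t ih =>
    have hL := S.cast_L_pos k
    have : S.holes k m (m + S.L k * (t + 1 : ℕ)) = S.holes k m (m + S.L k * t) ∪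
        S.holes k (m + S.L k * t) (m + S.L k * t + S.L k) := by
      rw [holes, holes, holes, ← Finset.filter_union, Finset.Ico_union_Ico_eq_Ico]
      · push_cast; ring_nf
      · have : (0 : ℤ) ≤ S.L k * t := by positivity
        linarith
      · linarith
    rw [this, Finset.card_union_of_disjoint, ih, card_holes_period, card_holes_L]
    · ring
    · exact Finset.disjoint_filter_filter (Finset.Ico_disjoint_Ico_consecutive _ _ _)

/-- The Toeplitz subshift. -/
def space : Set (FullShift a) :=
  {x | ∀ k, ∃ j : ℤ, ∀ n, n + j ∉ S.hole k → x n = S.val k (n + j)}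

theorem exists_phase {x : FullShift a} (hx : x ∈ S.space) (k : ℕ) :
    ∃ j : ℤ, 0 ≤ j ∧ j < S.L k ∧ ∀ n, n + j ∉ S.hole k → x n = S.val k (n + j) := by
  obtain ⟨j, hj⟩ := hx k
  have e : ∀ n, n + j = n + j % S.L k + S.L k * (j / S.L k) := fun n => by
    rw [add_assoc, Int.emod_add_mul_ediv]
  refine ⟨j % S.L k, Int.emod_nonneg _ (S.cast_L_pos k).ne', Int.emod_lt_of_pos _ (S.cast_L_pos k),
    fun n hn => ?_⟩
  have h := hj n
  rw [e, hole_add, val_add] at h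
  exact h hn

theorem isClosed_space : IsClosed S.space := by
  have : S.space = ⋂ k, ⋃ j ∈ Set.Ico (0 : ℤ) (S.L k),
      ⋂ n, ⋂ _ : n + j ∉ S.hole k, {x : FullShift a | x n = S.val k (n + j)} := by
    ext x
    simp only [Set.mem_iInter, Set.mem_iUnion, Set.mem_ofPred_eq, Set.mem_Ico, exists_prop]
    refine ⟨fun hx k => ?_, fun hx k => ?_⟩
    · obtain ⟨j, h1, h2, h3⟩ := S.exists_phase hx k
      exact ⟨j, ⟨h1, h2⟩, h3⟩
    · obtain ⟨j, -, h⟩ := hx k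
      exact ⟨j, h⟩
  rw [this]
  refine isClosed_iInter fun k => (Set.finite_Ico _ _).isClosed_biUnion fun j _ =>
    isClosed_iInter fun n => isClosed_iInter fun _ => isClosed_eq (continuous_apply n) continuous_const

theorem shift_image_space : shift '' S.space = S.space := by
  ext x
  constructor
  · rintro ⟨x, hx, rfl⟩ k
    obtain ⟨j, hj⟩ := hx k
    refine ⟨j + 1, fun n hn => ?_⟩
    rw [show n + (j + 1) = n + 1 + j by ring] at hn ⊢
    exact hj _ hn
  · intro hx
    refine ⟨fun n => x (n - 1), fun k => ?_, ?_⟩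
    · obtain ⟨j, hj⟩ := hx k
      refine ⟨j - 1, fun n hn => ?_⟩
      rw [show n + (j - 1) = n - 1 + j by ring] at hn ⊢
      exact hj _ hn
    · ext n
      simp [shift]

end Toeplitz

end Toeplitz

section Toeplitz

namespace Toeplitz

variable {a : ℕ} {σ : ℝ} (S : Toeplitz a σ)

/-- The positions that remain holes at all stages for the sequence of phases `j`. -/
def freeSet (j : ℕ → ℤ) : Set ℤ := {n | ∀ k, n + j k ∈ S.hole k}

open Classical in
/-- The values outside of the free positions for the sequence of phases `j`. -/
def freeVal (j : ℕ → ℤ) (n : ℤ) : Cube a :=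
  if h : ∃ k, n + j k ∉ S.hole k then S.val (Nat.find h) (n + j (Nat.find h)) else 0

variable {S} in
theorem hole_phase_mono {j : ℕ → ℤ} (hj : ∀ k, ∃ t, j (k + 1) = j k + S.L k * t) {n : ℤ} {k k' : ℕ}
    (hk : k ≤ k') (h : n + j k ∉ S.hole k) :
    n + j k' ∉ S.hole k' ∧ S.val k' (n + j k') = S.val k (n + j k) := by
  induction k', hk using Nat.le_induction with
  | base => exact ⟨h, rfl⟩
  | succ k' hk ih =>
    obtain ⟨t, ht⟩ := hj k'
    have h1 : n + j (k' + 1) ∉ S.hole k' := by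
      rw [ht, ← add_assoc, S.hole_add]; exact ih.1
    refine ⟨fun h2 => h1 (S.hole_succ_subset k' h2), ?_⟩
    rw [S.val_succ_of_notMem h1, ht, ← add_assoc, S.val_add]
    exact ih.2

open Classical in
theorem piecewise_mem_space {j : ℕ → ℤ} (hj : ∀ k, ∃ t, j (k + 1) = j k + S.L k * t)
    (θ : FullShift a) : (S.freeSet j).piecewise θ (S.freeVal j) ∈ S.space := by
  refine fun k => ⟨j k, fun n hn => ?_⟩
  have h : ∃ k, n + j k ∉ S.hole k := ⟨k, hn⟩
  rw [Set.piecewise_eq_of_notMem _ _ _ fun hf : n ∈ S.freeSet j => hn (hf k), freeVal, dif_pos h]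
  exact (hole_phase_mono hj (Nat.find_min' h hn) (Nat.find_spec h)).2.symm

/-- The subshift contains cubes whose free coordinates contain the holes of a period. -/
theorem exists_free (K : ℕ) : ∃ (F : Set ℤ) (_ : DecidablePred (· ∈ F)) (v : FullShift a),
    (∀ θ : FullShift a, F.piecewise θ v ∈ S.space) ∧ ∀ n ∈ S.holes K 0 (S.L K), n ∈ F := by
  classical
  let j : ℕ → ℤ := fun k => ∑ i ∈ Finset.Ico K k, S.L i * S.J i
  have hj0 : ∀ k ≤ K, j k = 0 := fun k hk => by simp [j, Finset.Ico_eq_empty_of_le hk]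
  have hj1 : ∀ k, K ≤ k → j (k + 1) = j k + S.L k * S.J k := fun k hk => Finset.sum_Ico_succ_top hk _
  have hj : ∀ k, ∃ t, j (k + 1) = j k + S.L k * t := fun k => by
    rcases le_or_gt K k with hk | hk
    · exact ⟨_, hj1 k hk⟩
    · exact ⟨0, by rw [hj0 _ hk, hj0 _ hk.le, mul_zero, add_zero]⟩
  refine ⟨S.freeSet j, inferInstance, S.freeVal j, S.piecewise_mem_space hj, fun n hn k => ?_⟩
  rw [S.mem_holes] at hn
  rcases le_total k K with hk | hk
  · rw [hj0 k hk, add_zero]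
    exact S.antitone_hole hk hn.2
  · suffices h : (0 ≤ n + j k ∧ n + j k < S.L k) ∧ n + j k ∈ S.hole k from h.2
    induction k, hk using Nat.le_induction with
    | base => rw [hj0 K le_rfl, add_zero]; exact hn
    | succ k hk ih =>
      have hq := S.lt_q k
      have hp := S.one_le_p k
      have hL := S.cast_L_pos k
      rw [hj1 k hk, ← add_assoc]
      refine ⟨⟨?_, ?_⟩, (S.hole_add k _ _).2 ih.2, ?_⟩
      · have := ih.1.1
        positivity
      · rw [cast_L_succ]
        have : (S.J k + 1 : ℤ) ≤ S.q k := by omega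
        nlinarith [ih.1.2]
      · rw [S.block_mul_add k (by omega) (by omega) ih.1.1 ih.1.2]
        omega

theorem nonempty_space : S.space.Nonempty := by
  obtain ⟨F, _, v, h, -⟩ := S.exists_free 0
  exact ⟨_, h v⟩

theorem notMem_hole_of_near (k : ℕ) {n t : ℤ} (h1 : t * S.L (k + 1) - S.L k ≤ n)
    (h2 : n < t * S.L (k + 1) + S.L k) : n ∉ S.hole (k + 1) := by
  have hL := S.cast_L_pos k
  have hq := S.lt_q k
  have hJ := S.one_le_J k
  rintro ⟨-, h3, h4⟩
  obtain ⟨r, rfl⟩ : ∃ r, n = r + S.L (k + 1) * t := ⟨n - S.L (k + 1) * t, by ring⟩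
  rw [block_add] at h3 h4
  rcases lt_or_ge r 0 with hr | hr
  · have e := S.block_mul_add k (c := S.q k - 1) (r := r + S.L k) (by omega) (by omega)
      (by linarith) (by linarith)
    rw [show r + (S.L k : ℤ) + S.L k * (S.q k - 1) = r + S.L (k + 1) * 1 by rw [cast_L_succ]; ring,
      block_add] at e
    omega
  · have e := S.block_mul_add k (c := 0) (r := r) (by omega) (by omega) hr (by linarith)
    rw [mul_zero, add_zero] at e
    omega

theorem exists_shift_near {x y : FullShift a} (hx : x ∈ S.space) (hy : y ∈ S.space) (k W : ℕ)
    (hW : 2 * W < S.L k) : ∃ m : ℤ, ∀ n, -(W : ℤ) ≤ n → n ≤ W → ∀ i,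
      |(y n i : ℝ) - x (n + m) i| ≤ 1 / 2 ^ k := by
  classical
  have hL := S.cast_L_pos (k + 1)
  obtain ⟨j, hj⟩ := hy (k + 1)
  by_cases hstr : ∃ t : ℤ, j - W < t * S.L (k + 1) ∧ t * S.L (k + 1) ≤ j + W
  · obtain ⟨t, ht1, ht2⟩ := hstr
    obtain ⟨j', hj'⟩ := hx (k + 1)
    refine ⟨j - j', fun n h1 h2 i => ?_⟩
    have h3 := S.notMem_hole_of_near k (n := n + j) (t := t) (by linarith) (by linarith)
    have h4 := hj' (n + (j - j'))
    rw [show n + (j - j') + j' = n + j by ring] at h4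
    rw [hj n h3, h4 h3, sub_self, abs_zero]
    positivity
  · push Not at hstr
    set t : ℤ := (j - W) / S.L (k + 1) with ht
    have ht1 : t * S.L (k + 1) ≤ j - W := Int.ediv_mul_le _ hL.ne'
    have ht2 : j - W < (t + 1) * S.L (k + 1) := Int.lt_ediv_add_one_mul_self _ hL
    have ht3 := hstr (t + 1) ht2
    obtain ⟨c, hc, hcg⟩ := S.dense (k + 1) fun r => y (r + t * S.L (k + 1) - j)
    obtain ⟨j', hj'⟩ := hx (k + 2)
    have hq := S.lt_q (k + 1)
    refine ⟨c * S.L (k + 1) - j' - (t * S.L (k + 1) - j), fun n h1 h2 i => ?_⟩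
    set r : ℤ := n + j - t * S.L (k + 1) with hr
    have hr0 : 0 ≤ r := by linarith
    have hr1 : r < S.L (k + 1) := by linarith
    have hb := S.block_mul_add (k + 1) (c := c) (r := r) (by omega) (by omega) hr0 hr1
    have hnot : r + S.L (k + 1) * c ∉ S.hole (k + 2) := fun h => by
      have := h.2.1
      rw [hb] at this
      omega
    have e1 : n + (c * S.L (k + 1) - j' - (t * S.L (k + 1) - j)) + j' = r + S.L (k + 1) * c := by
      rw [hr]; ring
    have h3 := hj' (n + (c * S.L (k + 1) - j' - (t * S.L (k + 1) - j)))
    rw [e1] at h3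
    rw [h3 hnot, val, hb]
    split_ifs with h4 h5
    · rw [Int.add_mul_emod_self_left, Int.emod_eq_of_lt hr0 hr1, Int.toNat_natCast]
      have h6 := hcg r hr0 hr1 i
      rw [show r + t * S.L (k + 1) - j = n by rw [hr]; ring] at h6
      refine h6.trans ?_
      exact one_div_le_one_div_of_le (by positivity) (pow_le_pow_right₀ (by norm_num) (by omega))
    · exact absurd (by exact_mod_cast hc) h5
    · rw [S.val_add]
      rw [S.hole_add] at h4
      have h7 : n + j = r + S.L (k + 1) * t := by rw [hr]; ring
      have h8 := hj n
      rw [h7, S.hole_add, S.val_add] at h8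
      rw [h8 h4, sub_self, abs_zero]
      positivity

theorem space_subset_closure {x : FullShift a} (hx : x ∈ S.space) :
    S.space ⊆ closure {y : FullShift a | ∃ n : ℤ, y = fun k => x (k + n)} := by
  intro y hy
  have hW : ∀ k, ∃ m : ℤ, ∀ n, -(((2 ^ k - 1) / 2 : ℕ) : ℤ) ≤ n → n ≤ ((2 ^ k - 1) / 2 : ℕ) → ∀ i,
      |(y n i : ℝ) - x (n + m) i| ≤ 1 / 2 ^ k := fun k => by
    refine S.exists_shift_near hx hy k _ ?_
    have := S.two_pow_le_L k
    have := Nat.one_le_two_pow (n := k)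
    omega
  choose m hm using hW
  refine mem_closure_of_tendsto (f := fun k n => x (n + m k)) (b := atTop) ?_
    (Eventually.of_forall fun k => ⟨m k, rfl⟩)
  rw [tendsto_pi_nhds]
  intro n
  rw [tendsto_pi_nhds]
  intro i
  rw [tendsto_subtype_rng, tendsto_iff_dist_tendsto_zero]
  refine squeeze_zero' (Eventually.of_forall fun _ => dist_nonneg) ?_
    (tendsto_pow_atTop_nhds_zero_of_lt_one (by norm_num : (0 : ℝ) ≤ 1 / 2) (by norm_num))
  filter_upwards [eventually_ge_atTop (2 * n.natAbs + 2)] with k hk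
  have h1 : k < 2 ^ k := Nat.lt_two_pow_self
  rw [dist_comm, Real.dist_eq, one_div, inv_pow, ← one_div]
  refine hm k n ?_ ?_ i <;> omega

end Toeplitz

end Toeplitz

section Metric

theorem cubeDist_le_iff {a : ℕ} {x y : Cube a} {r : ℝ} (hr : 0 ≤ r) :
    cubeDist x y ≤ r ↔ ∀ i, |(x i : ℝ) - y i| ≤ r := pi_norm_le_iff_of_nonneg hr

theorem cubeDist_nonneg {a : ℕ} (x y : Cube a) : 0 ≤ cubeDist x y := norm_nonneg _

theorem abs_sub_le_cubeDist {a : ℕ} (x y : Cube a) (i : Fin a) : |(x i : ℝ) - y i| ≤ cubeDist x y :=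
  (cubeDist_le_iff (cubeDist_nonneg x y)).1 le_rfl i

theorem cubeDist_le_one {a : ℕ} (x y : Cube a) : cubeDist x y ≤ 1 :=
  (cubeDist_le_iff zero_le_one).2 fun i => abs_le.2
    ⟨by linarith [(x i).2.1, (y i).2.2], by linarith [(x i).2.2, (y i).2.1]⟩

theorem summable_weight : Summable fun n : ℤ => (2 : ℝ) ^ (-|n|) := by
  have h : Summable fun n : ℕ => (2 : ℝ) ^ (-|(n : ℤ)|) := by
    refine (summable_geometric_of_lt_one (r := (1 / 2 : ℝ)) (by norm_num) (by norm_num)).congr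
      fun n => ?_
    simp
  exact Summable.of_nat_of_neg h (by simpa using h)

/-- The sum of the weights in the metric of the full shift. -/
def weightSum : ℝ := ∑' n : ℤ, (2 : ℝ) ^ (-|n|)

theorem weightSum_pos : 0 < weightSum :=
  summable_weight.tsum_pos (fun _ => by positivity) 0 (by positivity)

variable {a : ℕ}

theorem summable_shiftDist (x y : FullShift a) :
    Summable fun n : ℤ => (2 : ℝ) ^ (-|n|) * cubeDist (x n) (y n) :=
  summable_weight.of_nonneg_of_le (fun n => mul_nonneg (by positivity) (cubeDist_nonneg _ _))
    fun n => mul_le_of_le_one_right (by positivity) (cubeDist_le_one _ _)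

theorem shiftDist_nonneg (x y : FullShift a) : 0 ≤ shiftDist x y :=
  tsum_nonneg fun n => mul_nonneg (by positivity) (cubeDist_nonneg _ _)

theorem abs_sub_le_shiftDist (x y : FullShift a) (i : Fin a) :
    |(x 0 i : ℝ) - y 0 i| ≤ shiftDist x y := by
  refine (abs_sub_le_cubeDist _ _ i).trans ?_
  have h := (summable_shiftDist x y).le_tsum 0 fun n _ =>
    mul_nonneg (by positivity) (cubeDist_nonneg _ _)
  simpa [shiftDist] using h

theorem shiftDist_comm (x y : FullShift a) : shiftDist x y = shiftDist y x := by
  simp only [shiftDist, cubeDist, norm_sub_rev]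

theorem shiftDist_triangle (x y z : FullShift a) :
    shiftDist x z ≤ shiftDist x y + shiftDist y z := by
  rw [shiftDist, shiftDist, shiftDist, ← (summable_shiftDist x y).tsum_add (summable_shiftDist y z)]
  refine (summable_shiftDist x z).tsum_le_tsum (fun n => ?_)
    ((summable_shiftDist x y).add (summable_shiftDist y z))
  rw [← mul_add]
  exact mul_le_mul_of_nonneg_left (norm_sub_le_norm_sub_add_norm_sub _ _ _) (by positivity)

theorem exists_shiftDist_le {η : ℝ} (hη : 0 < η) : ∃ W : ℕ, ∀ (x y : FullShift a) (r : ℝ), 0 ≤ r →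
    (∀ n : ℤ, -(W : ℤ) ≤ n → n ≤ W → ∀ i, |(x n i : ℝ) - y n i| ≤ r) →
    shiftDist x y ≤ weightSum * r + η := by
  classical
  obtain ⟨s, hs⟩ := ((summable_weight.hasSum.eventually_const_lt
    (show weightSum - η < weightSum by linarith))).exists
  refine ⟨s.sup Int.natAbs, fun x y r hr h => ?_⟩
  have h1 : ∀ n : ℤ, cubeDist (x n) (y n) ≤ r + (1 - if n ∈ s then 1 else 0) := fun n => by
    split_ifs with hn
    · have := Finset.le_sup (f := Int.natAbs) hn
      rw [sub_self, add_zero, cubeDist_le_iff hr]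
      exact h n (by omega) (by omega)
    · linarith [cubeDist_le_one (x n) (y n)]
  have h2 : Summable fun n : ℤ => (2 : ℝ) ^ (-|n|) * (if n ∈ s then 1 else 0) :=
    summable_of_ne_finset_zero (s := s) fun n hn => by simp [hn]
  have h3 : ∑' n : ℤ, (2 : ℝ) ^ (-|n|) * (if n ∈ s then 1 else 0) = ∑ n ∈ s, (2 : ℝ) ^ (-|n|) := by
    rw [tsum_eq_sum (s := s) fun n hn => by simp [hn]]
    exact Finset.sum_congr rfl fun n hn => by simp [hn]
  have h4 : Summable fun n : ℤ => (2 : ℝ) ^ (-|n|) * r + (2 : ℝ) ^ (-|n|) := 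
    (summable_weight.mul_right r).add summable_weight
  calc shiftDist x y ≤ ∑' n : ℤ, ((2 : ℝ) ^ (-|n|) * r + (2 : ℝ) ^ (-|n|) -
        (2 : ℝ) ^ (-|n|) * (if n ∈ s then 1 else 0)) := by
        refine (summable_shiftDist x y).tsum_le_tsum (fun n => ?_) (h4.sub h2)
        refine (mul_le_mul_of_nonneg_left (h1 n) (by positivity)).trans_eq (by ring)
    _ = weightSum * r + weightSum - ∑ n ∈ s, (2 : ℝ) ^ (-|n|) := by
        rw [h4.tsum_sub h2, (summable_weight.mul_right r).tsum_add summable_weight, tsum_mul_right, h3,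
          weightSum]
    _ ≤ _ := by linarith

/-- The metric of a subshift. -/
abbrev subDist (X : Set (FullShift a)) : X → X → ℝ :=
  fun x y => shiftDist (x : FullShift a) (y : FullShift a)

section DynDist

variable {X : Type*} {T : X → X} {d : X → X → ℝ} {N : ℕ}

theorem le_dynDist {n : ℕ} (hn : n < N) (x y : X) :
    d (T^[n] x) (T^[n] y) ≤ dynDist T d N x y := by
  refine le_csSup (Set.Finite.bddAbove ?_) ⟨n, hn, rfl⟩
  refine ((Set.finite_Iio N).image fun n => d (T^[n] x) (T^[n] y)).subset ?_
  rintro _ ⟨n, hn, rfl⟩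
  exact ⟨n, hn, rfl⟩

theorem dynDist_le {x y : X} {c : ℝ} (hc : 0 ≤ c) (h : ∀ n < N, d (T^[n] x) (T^[n] y) ≤ c) :
    dynDist T d N x y ≤ c := by
  refine Real.sSup_le ?_ hc
  rintro _ ⟨n, hn, rfl⟩
  exact h n hn

theorem dynDist_nonneg (hd : ∀ x y, 0 ≤ d x y) (x y : X) : 0 ≤ dynDist T d N x y :=
  Real.sSup_nonneg fun _ ⟨_, _, h⟩ => h ▸ hd _ _

theorem dynDist_comm (hd : ∀ x y, d x y = d y x) (x y : X) :
    dynDist T d N x y = dynDist T d N y x := by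
  simp only [dynDist, hd]

theorem dynDist_triangle (hd0 : ∀ x y, 0 ≤ d x y) (hd : ∀ x y z, d x z ≤ d x y + d y z) (x y z : X) :
    dynDist T d N x z ≤ dynDist T d N x y + dynDist T d N y z :=
  dynDist_le (add_nonneg (dynDist_nonneg hd0 _ _) (dynDist_nonneg hd0 _ _)) fun _ hn =>
    (hd _ _ _).trans (add_le_add (le_dynDist hn _ _) (le_dynDist hn _ _))

end DynDist

section SetEDiam

variable {X : Type*} {ρ : X → X → ℝ}

theorem lt_of_setEDiam_lt {E : Set X} {ε : ℝ} (hE : setEDiam ρ E < ENNReal.ofReal ε) {x y : X}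
    (hx : x ∈ E) (hy : y ∈ E) : ρ x y < ε := by
  refine lt_of_not_ge fun h => (hE.trans_le (ENNReal.ofReal_le_ofReal h)).not_ge ?_
  exact le_iSup₂_of_le x hx (le_iSup₂_of_le y hy le_rfl)

theorem setEDiam_lt {E : Set X} {r ε : ℝ} (hε : 0 < ε) (hr : r < ε)
    (h : ∀ x ∈ E, ∀ y ∈ E, ρ x y ≤ r) : setEDiam ρ E < ENNReal.ofReal ε :=
  (iSup₂_le fun x hx => iSup₂_le fun y hy => ENNReal.ofReal_le_ofReal (h x hx y hy)).trans_lt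
    ((ENNReal.ofReal_lt_ofReal_iff hε).2 hr)

theorem exists_cover_of_code {ι : Type*} [Fintype ι] (code : X → ι) {r ε : ℝ} (hr : 0 < r)
    (hrε : 5 * r < ε) (hcomm : ∀ x y, ρ x y = ρ y x) (htri : ∀ x y z, ρ x z ≤ ρ x y + ρ y z)
    (h : ∀ x y, code x = code y → ρ x y ≤ r) :
    ∃ U : Fin (Fintype.card ι) → Set X, (∀ i, ROpen ρ (U i)) ∧
      (∀ i, setEDiam ρ (U i) < ENNReal.ofReal ε) ∧ ∀ x, ∃ i, x ∈ U i := by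
  let e := Fintype.equivFin ι
  refine ⟨fun i => {x | ∃ z, code z = e.symm i ∧ ρ z x < 2 * r}, fun i => ?_, fun i => ?_,
    fun x => ⟨e (code x), x, by simp, by linarith [h x x rfl]⟩⟩
  · rintro x ⟨z, hz, hx⟩
    exact ⟨2 * r - ρ z x, by linarith, fun y hy => ⟨z, hz, by linarith [htri z x y]⟩⟩
  · refine setEDiam_lt (r := 5 * r) (by linarith) hrε ?_
    rintro x ⟨z, hz, hx⟩ y ⟨w, hw, hy⟩
    linarith [htri x z y, htri z w y, hcomm x z, h z w (hz.trans hw.symm)]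

theorem covNum_le_card {ι : Type*} [Fintype ι] (code : X → ι) {r ε : ℝ} (hr : 0 < r)
    (hrε : 5 * r < ε) (hcomm : ∀ x y, ρ x y = ρ y x) (htri : ∀ x y z, ρ x z ≤ ρ x y + ρ y z)
    (h : ∀ x y, code x = code y → ρ x y ≤ r) (E : Set X) :
    covNum ρ ε E ≤ Fintype.card ι ∧ ∃ U : Fin (covNum ρ ε E) → Set X, (∀ i, ROpen ρ (U i)) ∧
      (∀ i, setEDiam ρ (U i) < ENNReal.ofReal ε) ∧ E ⊆ ⋃ i, U i := by
  obtain ⟨U, h1, h2, h3⟩ := exists_cover_of_code code hr hrε hcomm htri h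
  have hmem : Fintype.card ι ∈ {n : ℕ | ∃ U : Fin n → Set X, (∀ i, ROpen ρ (U i)) ∧
      (∀ i, setEDiam ρ (U i) < ENNReal.ofReal ε) ∧ E ⊆ ⋃ i, U i} :=
    ⟨U, h1, h2, fun x _ => Set.mem_iUnion.2 (h3 x)⟩
  exact ⟨Nat.sInf_le hmem, Nat.sInf_mem ⟨_, hmem⟩⟩

end SetEDiam

section Subshift

variable {X : Set (FullShift a)} {T : X → X}

theorem iterate_shift_apply (hT : ∀ x, (T x : FullShift a) = shift (x : FullShift a)) (n : ℕ) (x : X)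
    (m : ℤ) : (T^[n] x : FullShift a) m = (x : FullShift a) (m + n) := by
  induction n generalizing m with
  | zero => simp
  | succ n ih =>
    rw [Function.iterate_succ_apply', hT, shift, ih]
    have h : m + 1 + (n : ℤ) = m + (n + 1 : ℕ) := by
      push_cast
      ring
    rw [h]

theorem subDist_comm (x y : X) : subDist X x y = subDist X y x := shiftDist_comm _ _

theorem subDist_nonneg (x y : X) : 0 ≤ subDist X x y := shiftDist_nonneg _ _

theorem subDist_triangle (x y z : X) : subDist X x z ≤ subDist X x y + subDist X y z :=
  shiftDist_triangle _ _ _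

theorem abs_sub_le_dynDist (hT : ∀ x, (T x : FullShift a) = shift (x : FullShift a)) {N : ℕ} {n : ℤ}
    (hn0 : 0 ≤ n) (hn : n < N) (x y : X) (i : Fin a) :
    |((x : FullShift a) n i : ℝ) - (y : FullShift a) n i| ≤ dynDist T (subDist X) N x y := by
  refine le_trans ?_ (le_dynDist (n := n.toNat) (by omega) x y)
  have := abs_sub_le_shiftDist (T^[n.toNat] x : FullShift a) (T^[n.toNat] y) i
  rwa [iterate_shift_apply hT, iterate_shift_apply hT, zero_add, Int.toNat_of_nonneg hn0] at this

theorem exists_dynDist_le (hT : ∀ x, (T x : FullShift a) = shift (x : FullShift a)) {η : ℝ}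
    (hη : 0 < η) : ∃ W : ℕ, ∀ (N : ℕ) (x y : X) (r : ℝ), 0 ≤ r →
      (∀ n : ℤ, -(W : ℤ) ≤ n → n < N + W →
        ∀ i, |((x : FullShift a) n i : ℝ) - (y : FullShift a) n i| ≤ r) →
      dynDist T (subDist X) N x y ≤ weightSum * r + η := by
  obtain ⟨W, hW⟩ := exists_shiftDist_le (a := a) hη
  refine ⟨W, fun N x y r hr h => dynDist_le ?_ fun n hn => hW _ _ r hr fun m h1 h2 i => ?_⟩
  · have := weightSum_pos
    positivity
  · rw [iterate_shift_apply hT, iterate_shift_apply hT]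
    exact h _ (by omega) (by omega) i

theorem ROpen.isOpen (hT : ∀ x, (T x : FullShift a) = shift (x : FullShift a)) {N : ℕ} {U : Set X}
    (hU : ROpen (dynDist T (subDist X) N) U) : IsOpen U := by
  rw [isOpen_iff_mem_nhds]
  intro x hx
  obtain ⟨δ, hδ, hxδ⟩ := hU x hx
  obtain ⟨W, hW⟩ := exists_dynDist_le hT (half_pos (half_pos hδ))
  have hw := weightSum_pos
  have h : ∀ᶠ y : X in 𝓝 x, ∀ n ∈ Finset.Ico (-(W : ℤ)) (N + W), ∀ i,
      |((x : FullShift a) n i : ℝ) - (y : FullShift a) n i| < δ / 4 / weightSum := by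
    rw [Finset.eventually_all]
    intro n _
    rw [eventually_all]
    intro i
    have hc : Continuous fun y : X => |((x : FullShift a) n i : ℝ) - (y : FullShift a) n i| :=
      (continuous_const.sub (continuous_subtype_val.comp ((continuous_apply i).comp
        ((continuous_apply n).comp continuous_subtype_val)))).abs
    refine hc.continuousAt.eventually_lt_const ?_
    simp only [sub_self, abs_zero]
    positivity
  filter_upwards [h] with y hy
  refine hxδ y ((hW N x y (δ / 4 / weightSum) (by positivity) fun n h1 h2 i =>
    (hy n (Finset.mem_Ico.2 ⟨h1, h2⟩) i).le).trans_lt ?_)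
  rw [mul_div_cancel₀ _ hw.ne']
  linarith

end Subshift

end Metric

section ToeplitzUpper

/-- The cell of width `1 / Q` containing a point of the unit interval. -/
def cell (Q : ℕ) (u : unitInterval) : Fin (Q + 1) :=
  ⟨⌊(u : ℝ) * Q⌋₊, Nat.lt_add_one_iff.2
    (Nat.floor_le_of_le (mul_le_of_le_one_left (Nat.cast_nonneg _) u.2.2))⟩

theorem abs_sub_le_of_cell_eq {Q : ℕ} (hQ : 0 < Q) {u v : unitInterval} (h : cell Q u = cell Q v) :
    |(u : ℝ) - v| ≤ 1 / Q := by
  have hQ' : (0 : ℝ) < Q := by exact_mod_cast hQ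
  have h := congrArg Fin.val h
  simp only [cell] at h
  have h1 := Nat.floor_le (mul_nonneg u.2.1 hQ'.le)
  have h2 := Nat.lt_floor_add_one ((u : ℝ) * Q)
  have h3 := Nat.floor_le (mul_nonneg v.2.1 hQ'.le)
  have h4 := Nat.lt_floor_add_one ((v : ℝ) * Q)
  rw [h] at h1 h2
  have : |(u : ℝ) - v| * Q ≤ 1 := by
    rw [← Nat.abs_cast Q, ← abs_mul, abs_le]
    constructor <;> linarith
  rwa [le_div_iff₀ hQ']

namespace Toeplitz

variable {a : ℕ} {σ : ℝ} (S : Toeplitz a σ)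

theorem exists_phase_fin (k : ℕ) (x : S.space) : ∃ j : Fin (S.L k), ∀ n : ℤ,
    n + (j : ℕ) ∉ S.hole k → (x : FullShift a) n = S.val k (n + (j : ℕ)) := by
  obtain ⟨j, h0, h1, h⟩ := S.exists_phase x.2 k
  refine ⟨⟨j.toNat, by omega⟩, fun n hn => ?_⟩
  simp only [Int.toNat_of_nonneg h0] at hn ⊢
  exact h n hn

/-- A phase of a point of the subshift at level `k`. -/
def phase (k : ℕ) (x : S.space) : Fin (S.L k) := (S.exists_phase_fin k x).choose

theorem apply_eq_val {k : ℕ} {x : S.space} {n : ℤ} (h : n + (S.phase k x : ℕ) ∉ S.hole k) :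
    (x : FullShift a) n = S.val k (n + (S.phase k x : ℕ)) :=
  (S.exists_phase_fin k x).choose_spec n h

theorem card_holes_le (k : ℕ) (m : ℤ) (M : ℕ) :
    (S.holes k m (m + M)).card ≤ (M / S.L k + 1) * S.h k := by
  rw [← S.card_holes_mul k m]
  refine Finset.card_le_card fun n hn => ?_
  rw [mem_holes] at hn ⊢
  refine ⟨⟨hn.1.1, hn.1.2.trans_le ?_⟩, hn.2⟩
  have := Nat.lt_div_mul_add (a := M) (S.L_pos k)
  have h : M ≤ S.L k * (M / S.L k + 1) := by linarith
  have h' : (M : ℤ) ≤ S.L k * ((M / S.L k + 1 : ℕ) : ℤ) := by exact_mod_cast h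
  linarith

theorem cast_card_holes_le (k : ℕ) (m : ℤ) (M : ℕ) :
    ((S.holes (k + 1) m (m + M)).card : ℝ) ≤ (σ + 1 / (k + 1)) * (M + S.L (k + 1)) := by
  have hL : (0 : ℝ) < S.L (k + 1) := by exact_mod_cast S.L_pos _
  have h1 : ((S.holes (k + 1) m (m + M)).card : ℝ) ≤ ((M / S.L (k + 1) : ℕ) + 1 : ℝ) * S.h (k + 1) := by
    exact_mod_cast S.card_holes_le (k + 1) m M
  have h2 : ((M / S.L (k + 1) : ℕ) : ℝ) ≤ M / S.L (k + 1) := Nat.cast_div_le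
  calc _ ≤ _ := h1
    _ ≤ (M / S.L (k + 1) + 1) * ((σ + 1 / (k + 1)) * S.L (k + 1)) :=
        mul_le_mul (by linarith) (S.h_le k) (by positivity) (by positivity)
    _ = _ := by field_simp

/-- The points of the subshift, coded by their phase and their discretized values at the holes of
a window. -/
def code (k : ℕ) (m M : ℤ) (Q : ℕ) (x : S.space) :
    Σ j : Fin (S.L k), (S.holes k (m + (j : ℕ)) (M + (j : ℕ)) → Fin a → Fin (Q + 1)) :=
  ⟨S.phase k x, fun p i => cell Q ((x : FullShift a) (p - (S.phase k x : ℕ)) i)⟩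

theorem abs_sub_le_of_code_eq {k : ℕ} {m M : ℤ} {Q : ℕ} (hQ : 0 < Q) {x y : S.space}
    (h : S.code k m M Q x = S.code k m M Q y) {n : ℤ} (hm : m ≤ n) (hM : n < M) (i : Fin a) :
    |((x : FullShift a) n i : ℝ) - (y : FullShift a) n i| ≤ 1 / Q := by
  have hj : S.phase k x = S.phase k y := congrArg Sigma.fst h
  by_cases hn : n + (S.phase k x : ℕ) ∈ S.hole k
  · unfold code at h
    rw [hj] at h hn
    have h' := eq_of_heq (Sigma.mk.inj h).2
    have := congrFun (congrFun h' ⟨n + (S.phase k y : ℕ),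
      S.mem_holes.2 ⟨⟨by linarith, by linarith⟩, hn⟩⟩) i
    simp only [add_sub_cancel_right] at this
    exact abs_sub_le_of_cell_eq hQ this
  · rw [S.apply_eq_val hn, S.apply_eq_val (hj ▸ hn), hj, sub_self, abs_zero]
    positivity

theorem card_code_le (hσ : 0 ≤ σ) (k : ℕ) (m : ℤ) (M Q : ℕ) :
    Real.log (Fintype.card (Σ j : Fin (S.L (k + 1)),
      (S.holes (k + 1) (m + (j : ℕ)) (m + M + (j : ℕ)) → Fin a → Fin (Q + 1)))) ≤
    Real.log (S.L (k + 1)) + a * ((σ + 1 / (k + 1)) * (M + S.L (k + 1))) * Real.log (Q + 1) := by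
  have hL : (0 : ℝ) < S.L (k + 1) := by exact_mod_cast S.L_pos _
  have hQ : (1 : ℝ) ≤ Q + 1 := by linarith [Nat.cast_nonneg (α := ℝ) Q]
  have h1 : (Fintype.card (Σ j : Fin (S.L (k + 1)),
      (S.holes (k + 1) (m + (j : ℕ)) (m + M + (j : ℕ)) → Fin a → Fin (Q + 1))) : ℝ) ≤
      S.L (k + 1) * ((Q : ℝ) + 1) ^ (a * ((σ + 1 / (k + 1)) * (M + S.L (k + 1)))) := by
    rw [Fintype.card_sigma, Nat.cast_sum]
    refine (Finset.sum_le_card_nsmul _ _ _ fun j _ => ?_).trans_eq (by rw [nsmul_eq_mul, Finset.card_univ,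
      Fintype.card_fin])
    simp only [Fintype.card_pi, Finset.prod_const, Finset.card_univ, Fintype.card_fin, Fintype.card_coe,
      ← pow_mul]
    push_cast
    rw [← Real.rpow_natCast]
    refine Real.rpow_le_rpow_of_exponent_le hQ ?_
    push_cast
    refine mul_le_mul_of_nonneg_left ?_ (Nat.cast_nonneg _)
    have := S.cast_card_holes_le k (m + (j : ℕ)) M
    rwa [show m + (j : ℕ) + (M : ℤ) = m + M + (j : ℕ) by ring] at this
  rcases Nat.eq_zero_or_pos (Fintype.card (Σ j : Fin (S.L (k + 1)),
      (S.holes (k + 1) (m + (j : ℕ)) (m + M + (j : ℕ)) → Fin a → Fin (Q + 1)))) with h0 | h0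
  · rw [h0, Nat.cast_zero, Real.log_zero]
    have : (1 : ℝ) ≤ S.L (k + 1) := by exact_mod_cast S.L_pos _
    exact add_nonneg (Real.log_nonneg this) (mul_nonneg (by positivity) (Real.log_nonneg hQ))
  · refine (Real.log_le_log (by exact_mod_cast h0) h1).trans_eq ?_
    rw [Real.log_mul hL.ne' (Real.rpow_pos_of_pos (by linarith) _).ne', Real.log_rpow (by linarith)]

variable {S} {T : S.space → S.space}

theorem exists_covNum_bound (hσ : 0 ≤ σ)
    (hT : ∀ x, (T x : FullShift a) = shift (x : FullShift a)) {ε : ℝ} (hε : 0 < ε) (hε1 : ε < 1) :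
    ∃ W : ℕ, ∀ k N (E : Set S.space), Real.log (covNum (dynDist T (subDist S.space) N) ε E) ≤
        Real.log (S.L (k + 1)) + a * ((σ + 1 / (k + 1)) * (N + 2 * W + S.L (k + 1))) *
          (Real.log (12 * weightSum + 2) + Real.log (1 / ε)) ∧
      ∃ U : Fin (covNum (dynDist T (subDist S.space) N) ε E) → Set S.space,
        (∀ i, ROpen (dynDist T (subDist S.space) N) (U i)) ∧
        (∀ i, setEDiam (dynDist T (subDist S.space) N) (U i) < ENNReal.ofReal ε) ∧ E ⊆ ⋃ i, U i := by
  obtain ⟨W, hW⟩ := exists_dynDist_le hT (show 0 < ε / 12 by positivity)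
  have hw := weightSum_pos
  set Q := ⌈12 * weightSum / ε⌉₊ with hQ
  have hQ0 : 0 < Q := Nat.ceil_pos.2 (by positivity)
  have hQ0' : (0 : ℝ) < Q := by exact_mod_cast hQ0
  have hQ1 : 12 * weightSum / ε ≤ Q := Nat.le_ceil _
  have hQ2 : (Q : ℝ) < 12 * weightSum / ε + 1 := Nat.ceil_lt_add_one (by positivity)
  have hQ3 : weightSum * (1 / Q) + ε / 12 ≤ ε / 6 := by
    rw [div_le_iff₀ hε] at hQ1
    have : weightSum * (1 / Q) ≤ ε / 12 := by
      rw [mul_one_div, div_le_iff₀ hQ0']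
      linarith
    linarith
  have hQ4 : Real.log (Q + 1) ≤ Real.log (12 * weightSum + 2) + Real.log (1 / ε) := by
    rw [← Real.log_mul (by positivity) (by positivity)]
    refine Real.log_le_log (by positivity) ?_
    have : 1 ≤ 1 / ε := by rw [le_div_iff₀ hε]; linarith
    have e : (12 * weightSum + 2) * (1 / ε) = 12 * weightSum / ε + 2 * (1 / ε) := by ring
    linarith
  refine ⟨W, fun k N E => ?_⟩
  have key := covNum_le_card (ρ := dynDist T (subDist S.space) N)
    (S.code (k + 1) (-W) (-W + (N + 2 * W : ℕ)) Q) (r := ε / 6) (ε := ε) (by positivity) (by linarith)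
    (fun x y => dynDist_comm subDist_comm x y)
    (fun x y z => dynDist_triangle subDist_nonneg subDist_triangle x y z)
    (fun x y h => (hW N x y (1 / Q) (by positivity) fun n h1 h2 i =>
      S.abs_sub_le_of_code_eq hQ0 h h1 (by push_cast; linarith) i).trans hQ3) E
  refine ⟨?_, key.2⟩
  have h1 := S.card_code_le hσ k (-W) (N + 2 * W) Q
  have h2 : Real.log (covNum (dynDist T (subDist S.space) N) ε E) ≤ Real.log (Fintype.card
      (Σ j : Fin (S.L (k + 1)), (S.holes (k + 1) (-(W : ℤ) + (j : ℕ))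
        (-(W : ℤ) + (N + 2 * W : ℕ) + (j : ℕ)) → Fin a → Fin (Q + 1)))) := by
    rcases Nat.eq_zero_or_pos (covNum (dynDist T (subDist S.space) N) ε E) with h0 | h0
    · rw [h0, Nat.cast_zero, Real.log_zero]
      exact Real.log_natCast_nonneg _
    · exact Real.log_le_log (by exact_mod_cast h0) (by exact_mod_cast key.1)
  refine (h2.trans h1).trans ?_
  push_cast
  gcongr

end Toeplitz

end ToeplitzUpper

section Rates

theorem tendsto_add_div_natCast (α β : ℝ) :
    Tendsto (fun N : ℕ => ((α / N + β : ℝ) : EReal)) atTop (𝓝 (β : EReal)) := by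
  refine (continuous_coe_real_ereal.tendsto β).comp ?_
  simpa using (tendsto_const_div_atTop_nhds_zero_nat α).add_const β

theorem liminf_coe_le {g : ℕ → ℝ} {α β : ℝ} (h : ∀ N : ℕ, N * g N ≤ α + β * N) :
    liminf (fun N : ℕ => ((g N : ℝ) : EReal)) atTop ≤ (β : EReal) := by
  rw [← (tendsto_add_div_natCast α β).liminf_eq]
  refine liminf_le_liminf ?_
  filter_upwards [eventually_gt_atTop 0] with N hN
  have hN' : (0 : ℝ) < N := by exact_mod_cast hN
  rw [EReal.coe_le_coe_iff, ← mul_le_mul_iff_right₀ hN']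
  refine (h N).trans_eq ?_
  field_simp

theorem le_liminf_coe {g : ℕ → ℝ} {α β : ℝ} (h : ∀ N : ℕ, 0 < N → α + β * N ≤ N * g N) :
    (β : EReal) ≤ liminf (fun N : ℕ => ((g N : ℝ) : EReal)) atTop := by
  rw [← (tendsto_add_div_natCast α β).liminf_eq]
  refine liminf_le_liminf ?_
  filter_upwards [eventually_gt_atTop 0] with N hN
  have hN' : (0 : ℝ) < N := by exact_mod_cast hN
  rw [EReal.coe_le_coe_iff, ← mul_le_mul_iff_right₀ hN']
  refine le_trans (le_of_eq ?_) (h N hN)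
  field_simp

theorem tendsto_log_one_div : Tendsto (fun ε : ℝ => Real.log (1 / ε)) (𝓝[>] 0) atTop := by
  simp only [one_div]
  exact Real.tendsto_log_atTop.comp tendsto_inv_nhdsGT_zero

theorem tendsto_mul_add_div_log (c A : ℝ) :
    Tendsto (fun ε : ℝ => ((c * (A / Real.log (1 / ε) + 1) : ℝ) : EReal)) (𝓝[>] 0)
      (𝓝 (c : EReal)) := by
  refine (continuous_coe_real_ereal.tendsto c).comp ?_
  simpa using ((tendsto_log_one_div.const_div_atTop A).add_const 1).const_mul c

theorem eventually_mem_Ioo : ∀ᶠ ε : ℝ in 𝓝[>] 0, 0 < ε ∧ ε < 1 :=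
  Ioo_mem_nhdsGT one_pos

end Rates

section ToeplitzUpper

namespace Toeplitz

variable {a : ℕ} {σ : ℝ} {S : Toeplitz a σ} {T : S.space → S.space}

theorem upperMdimM_le (hσ : 0 ≤ σ) (hT : ∀ x, (T x : FullShift a) = shift (x : FullShift a)) :
    upperMdimM T (subDist S.space) ≤ ((a * σ : ℝ) : EReal) := by
  have key : ∀ k : ℕ, upperMdimM T (subDist S.space) ≤ ((a * (σ + 1 / (k + 1)) : ℝ) : EReal) := by
    intro k
    refine le_trans (limsup_le_limsup ?_)
      (tendsto_mul_add_div_log (a * (σ + 1 / (k + 1))) (Real.log (12 * weightSum + 2))).limsup_eq.le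
    filter_upwards [eventually_mem_Ioo] with ε hε
    obtain ⟨W, hW⟩ := exists_covNum_bound hσ hT hε.1 hε.2
    have hlog : 0 < Real.log (1 / ε) := Real.log_pos (by rw [lt_div_iff₀ hε.1]; linarith [hε.2])
    set A := Real.log (12 * weightSum + 2)
    refine liminf_coe_le (α := (Real.log (S.L (k + 1)) + a * ((σ + 1 / (k + 1)) *
      (2 * W + S.L (k + 1))) * (A + Real.log (1 / ε))) / Real.log (1 / ε)) fun N => ?_
    have h := (hW k N Set.univ).1
    rcases Nat.eq_zero_or_pos N with rfl | hN
    · simp only [Nat.cast_zero, zero_mul, mul_zero, add_zero]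
      refine div_nonneg ((Real.log_natCast_nonneg _).trans (h.trans_eq ?_)) hlog.le
      simp
    · have hN' : (0 : ℝ) < N := by exact_mod_cast hN
      rw [← mul_div_assoc, mul_div_mul_left _ _ hN'.ne', div_le_iff₀ hlog]
      refine h.trans_eq ?_
      field_simp
      ring
  have hlim : Tendsto (fun k : ℕ => ((a * (σ + 1 / (k + 1)) : ℝ) : EReal)) atTop
      (𝓝 ((a * σ : ℝ) : EReal)) := by
    refine (continuous_coe_real_ereal.tendsto (a * σ)).comp ?_
    simpa using (tendsto_one_div_add_atTop_nhds_zero_nat.const_add σ).const_mul (a : ℝ)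
  exact ge_of_tendsto' hlim key

end Toeplitz

end ToeplitzUpper

section Conditional

theorem iterate_equivariant_apply {X : Type*} {b : ℕ} {T : X → X} {π : X → FullShift b}
    (hπ : ∀ x, π (T x) = shift (π x)) (n : ℕ) (x : X) (m : ℤ) : π (T^[n] x) m = π x (m + n) := by
  induction n generalizing m with
  | zero => simp
  | succ n ih =>
    rw [Function.iterate_succ_apply', hπ, shift, ih]
    have h : m + 1 + (n : ℤ) = m + (n + 1 : ℕ) := by
      push_cast
      ring
    rw [h]

theorem continuous_coord {b : ℕ} (t : ℤ) (i : Fin b) :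
    Continuous fun y : FullShift b => (y t i : ℝ) :=
  continuous_subtype_val.comp ((continuous_apply i).comp (continuous_apply t))

theorem exists_uniform_window {X : Type*} [TopologicalSpace X] [SeqCompactSpace X] {b : ℕ}
    {π : X → FullShift b} (hπ : Continuous π) {P : Set X → Prop}
    (h : ∀ y, ∃ O : Set X, IsOpen O ∧ π ⁻¹' {y} ⊆ O ∧ P O) :
    ∃ (R : ℕ) (δ : ℝ), 0 < δ ∧ ∀ y : FullShift b, ∃ O : Set X, P O ∧
      ∀ x, (∀ t : ℤ, -(R : ℤ) ≤ t → t ≤ R → ∀ i, |(π x t i : ℝ) - y t i| ≤ δ) → x ∈ O := by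
  by_contra! hcon
  choose y hy using fun R : ℕ => hcon R (1 / ((R : ℝ) + 1)) (by positivity)
  obtain ⟨z, φ, hφ, hz⟩ := SeqCompactSpace.tendsto_subseq y
  obtain ⟨O, hO, hzO, hPO⟩ := h z
  choose x hx hxO using fun R => hy R O hPO
  obtain ⟨w, ψ, hψ, hw⟩ := SeqCompactSpace.tendsto_subseq (x ∘ φ)
  have hwO : w ∈ Oᶜ := hO.isClosed_compl.mem_of_tendsto hw (Eventually.of_forall fun n => hxO _)
  refine hwO (hzO ?_)
  rw [Set.mem_preimage, Set.mem_singleton_iff]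
  funext t
  funext i
  have h1 : Tendsto (fun n => (π (x (φ (ψ n))) t i : ℝ)) atTop (𝓝 (π w t i)) :=
    (((continuous_coord t i).comp hπ).tendsto w).comp hw
  have h2 : Tendsto (fun n => (y (φ (ψ n)) t i : ℝ)) atTop (𝓝 (z t i)) :=
    ((continuous_coord t i).tendsto z).comp (hz.comp hψ.tendsto_atTop)
  have hφψ : Tendsto (φ ∘ ψ) atTop atTop := (hφ.comp hψ).tendsto_atTop
  have h3 : Tendsto (fun n => 1 / ((φ (ψ n) : ℝ) + 1)) atTop (𝓝 0) :=
    (tendsto_one_div_add_atTop_nhds_zero_nat (𝕜 := ℝ)).comp hφψ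
  have h4 := le_of_tendsto_of_tendsto (h1.sub h2).abs h3 (by
    filter_upwards [hφψ.eventually_ge_atTop t.natAbs] with n hn
    simp only [Function.comp_apply] at hn
    exact hx _ t (by omega) (by omega) i)
  exact Subtype.ext (sub_eq_zero.1 (abs_nonpos_iff.1 h4))

namespace Toeplitz

variable {a : ℕ} {σ : ℝ} {S : Toeplitz a σ} {T : S.space → S.space}

theorem h_le_L (S : Toeplitz a σ) (k : ℕ) : S.h k ≤ S.L k := by
  classical
  rw [← S.card_holes_L k]
  exact (Finset.card_filter_le _ _).trans (by simp)

/-- A continuous family of points of the subshift with prescribed coordinates at the holes of a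
period. -/
theorem exists_cube (S : Toeplitz a σ) (K : ℕ) :
    ∃ g : (S.holes K 0 (S.L K) × Fin a → ℝ) → S.space, Continuous g ∧
      ∀ u (n : S.holes K 0 (S.L K)) i, u (n, i) ∈ Set.Icc (0 : ℝ) 1 → ((g u : FullShift a) n i : ℝ) = u (n, i) := by
  classical
  obtain ⟨F, _, v, hF, hH⟩ := S.exists_free K
  let θ : (S.holes K 0 (S.L K) × Fin a → ℝ) → FullShift a := fun u n i =>
    if h : n ∈ S.holes K 0 (S.L K) then Set.projIcc 0 1 zero_le_one (u (⟨n, h⟩, i)) else 0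
  have hθ : Continuous θ := by
    refine continuous_pi fun n => continuous_pi fun i => ?_
    by_cases h : n ∈ S.holes K 0 (S.L K)
    · simp only [θ, h, dite_true]
      exact continuous_projIcc.comp (continuous_apply _)
    · simp only [θ, h, dite_false]
      exact continuous_const
  refine ⟨fun u => ⟨F.piecewise (θ u) v, hF _⟩, ?_, fun u n i hu => ?_⟩
  · refine Continuous.subtype_mk (continuous_pi fun n => ?_) _
    by_cases h : n ∈ F
    · simp only [Set.piecewise, h, if_true]
      exact (continuous_apply n).comp hθ
    · simp only [Set.piecewise, h, if_false]
      exact continuous_const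
  · simp only [Set.piecewise, hH _ n.2, if_true, θ, n.2, dite_true]
    rw [Set.projIcc_of_mem zero_le_one hu]

theorem waist_bound (hT : ∀ x, (T x : FullShift a) = shift (x : FullShift a)) {C : ℝ}
    (hC : ∀ n m : ℕ, 1 ≤ n → m ≤ n → ∀ f : (Fin n → ℝ) → Fin m → ℝ,
      ContinuousOn f (Set.pi Set.univ fun _ => Set.Icc 0 1) → ∀ δ > 0, ∀ ε : ℝ, 0 < ε → ε < 1 →
      ∀ M : ℕ, (∀ y, ∃ p : Fin M → Fin n → ℝ, ∀ x ∈ Set.pi Set.univ fun _ => Set.Icc (0 : ℝ) 1,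
        dist (f x) y ≤ δ → ∃ i, ∀ l, |x l - p i l| ≤ ε) → 1 ≤ C ^ n * (ε ^ n / ε ^ m) * M)
    {b : ℕ} {π : S.space → FullShift b} (hπ : Continuous π) (hπT : ∀ x, π (T x) = shift (π x))
    {N M₀ R : ℕ} (hN : 0 < N) {δ ε : ℝ} (hδ : 0 < δ) (hε : 0 < ε) (hε1 : ε < 1)
    (hcov : ∀ y : FullShift b, ∃ U : Fin M₀ → Set S.space,
      (∀ i, setEDiam (dynDist T (subDist S.space) N) (U i) < ENNReal.ofReal ε) ∧
      ∀ x, (∀ t : ℤ, -(R : ℤ) ≤ t → t ≤ R → ∀ i, |(π x t i : ℝ) - y t i| ≤ δ) → ∃ i, x ∈ U i)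
    (K : ℕ) (h1 : 1 ≤ S.h K * a) (h2 : (S.L K + 2 * R + 1) * b ≤ S.h K * a) :
    1 ≤ C ^ (S.h K * a) * (ε ^ (S.h K * a) / ε ^ ((S.L K + 2 * R + 1) * b)) *
      (M₀ ^ (S.L K / N + 1) : ℕ) := by
  classical
  obtain ⟨g, hg, hgu⟩ := S.exists_cube K
  let eι : S.holes K 0 (S.L K) × Fin a ≃ Fin (S.h K * a) :=
    Fintype.equivFinOfCardEq (by simp [S.card_holes_L])
  let eκ : (Fin (S.L K + 2 * R + 1) × Fin b) ≃ Fin ((S.L K + 2 * R + 1) * b) := finProdFinEquiv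
  let eM : (Fin (S.L K / N + 1) → Fin M₀) ≃ Fin (M₀ ^ (S.L K / N + 1)) := finFunctionFinEquiv
  let x : (Fin (S.h K * a) → ℝ) → S.space := fun u => g (u ∘ eι)
  let f : (Fin (S.h K * a) → ℝ) → Fin ((S.L K + 2 * R + 1) * b) → ℝ := fun u j =>
    π (x u) (((eκ.symm j).1 : ℕ) - R) (eκ.symm j).2
  have hx : Continuous x := hg.comp (continuous_pi fun j => continuous_apply _)
  have hf : Continuous f := continuous_pi fun j => ((continuous_coord _ _).comp hπ).comp hx
  refine hC _ _ h1 h2 f hf.continuousOn (δ / 2) (by positivity) ε hε hε1 _ fun y => ?_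
  by_cases hy : ∃ u₀, dist (f u₀) y ≤ δ / 2
  · obtain ⟨u₀, hu₀⟩ := hy
    choose U hU hcovU using fun r : Fin (S.L K / N + 1) => hcov fun t => π (x u₀) (t + (r * N : ℕ))
    have hcode : ∀ u, dist (f u) y ≤ δ / 2 → ∃ c : Fin (S.L K / N + 1) → Fin M₀,
        ∀ r, T^[r * N] (x u) ∈ U r (c r) := by
      intro u hu
      refine Classical.skolem.1 fun r => hcovU r _ fun t ht1 ht2 i => ?_
      rw [iterate_equivariant_apply hπT]
      have hr : (r : ℕ) * N ≤ S.L K :=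
        (Nat.mul_le_mul_right _ (Nat.lt_succ_iff.1 r.2)).trans (Nat.div_mul_le_self _ _)
      have hd : dist (f u) (f u₀) ≤ δ := by linarith [dist_triangle_right (f u) (f u₀) y]
      have := (dist_le_pi_dist (f u) (f u₀)
        (eκ (⟨(t + (r * N : ℕ) + R).toNat, by omega⟩, i))).trans hd
      simp only [f, Equiv.symm_apply_apply] at this
      rw [Int.toNat_of_nonneg (by omega), add_sub_cancel_right] at this
      exact this
    let p : (Fin (S.L K / N + 1) → Fin M₀) → Fin (S.h K * a) → ℝ := fun c =>
      if h : ∃ u ∈ Set.pi Set.univ fun _ => Set.Icc (0 : ℝ) 1, 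
        ∀ r, T^[r * N] (x u) ∈ U r (c r) then h.choose else 0
    refine ⟨fun i => p (eM.symm i), fun u hu hfu => ?_⟩
    obtain ⟨c, hc⟩ := hcode u hfu
    refine ⟨eM c, fun l => ?_⟩
    have hex : ∃ u ∈ Set.pi Set.univ fun _ => Set.Icc (0 : ℝ) 1,
      ∀ r, T^[r * N] (x u) ∈ U r (c r) := ⟨u, hu, hc⟩
    have hp : p c = hex.choose := dif_pos hex
    obtain ⟨hp1, hp2⟩ := hex.choose_spec
    simp only [Equiv.symm_apply_apply, hp]
    set w := hex.choose
    obtain ⟨⟨n, i⟩, rfl⟩ := eι.surjective l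
    have e1 : ((x u : FullShift a) n i : ℝ) = u (eι (n, i)) := hgu (u ∘ eι) n i (hu _ trivial)
    have e2 : ((x w : FullShift a) n i : ℝ) = w (eι (n, i)) := hgu (w ∘ eι) n i (hp1 _ trivial)
    have hn := (S.mem_holes.1 n.2).1
    have hnL : (n : ℤ).toNat < S.L K := by omega
    have hr : (n : ℤ).toNat / N < S.L K / N + 1 :=
      Nat.lt_succ_iff.2 (Nat.div_le_div_right hnL.le)
    have hlt := lt_of_setEDiam_lt (hU ⟨_, hr⟩ (c ⟨_, hr⟩)) (hc ⟨_, hr⟩) (hp2 ⟨_, hr⟩)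
    have hmod := Nat.mod_lt (n : ℤ).toNat hN
    have hle := abs_sub_le_dynDist hT (N := N) (n := ((n : ℤ).toNat % N : ℕ)) (by positivity)
      (by exact_mod_cast hmod) (T^[(n : ℤ).toNat / N * N] (x u)) (T^[(n : ℤ).toNat / N * N] (x w)) i
    have hdm : (((n : ℤ).toNat % N : ℕ) : ℤ) + ((n : ℤ).toNat / N * N : ℕ) = n := by
      rw [← Nat.cast_add, mul_comm, Nat.mod_add_div, Int.toNat_of_nonneg hn.1]
    rw [iterate_shift_apply hT, iterate_shift_apply hT, hdm, e1, e2] at hle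
    exact hle.trans hlt.le
  · exact ⟨fun _ => 0, fun u _ hu => absurd ⟨u, hu⟩ hy⟩

end Toeplitz

end Conditional

section Conditional

namespace Toeplitz

variable {a : ℕ} {σ : ℝ} {S : Toeplitz a σ} {T : S.space → S.space}

theorem tendsto_L (S : Toeplitz a σ) : Tendsto (fun k => (S.L k : ℝ)) atTop atTop := by
  refine tendsto_natCast_atTop_atTop.comp
    (tendsto_atTop_mono (fun k => ?_) tendsto_id)
  exact (Nat.lt_two_pow_self.le).trans (S.two_pow_le_L k)

theorem exists_window_cover (hσ : 0 ≤ σ) (hT : ∀ x, (T x : FullShift a) = shift (x : FullShift a))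
    {b : ℕ} {π : S.space → FullShift b} (hπ : Continuous π) (N : ℕ) {ε : ℝ} (hε : 0 < ε)
    (hε1 : ε < 1) : ∃ (R : ℕ) (δ : ℝ), 0 < δ ∧ ∀ y : FullShift b,
      ∃ U : Fin ⌊Real.exp (supLogCov π (dynDist T (subDist S.space) N) ε)⌋₊ → Set S.space,
        (∀ i, setEDiam (dynDist T (subDist S.space) N) (U i) < ENNReal.ofReal ε) ∧
        ∀ x, (∀ t : ℤ, -(R : ℤ) ≤ t → t ≤ R → ∀ i, |(π x t i : ℝ) - y t i| ≤ δ) → ∃ i, x ∈ U i := by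
  set ρ := dynDist T (subDist S.space) N
  have : CompactSpace S.space := isCompact_iff_compactSpace.1 S.isClosed_space.isCompact
  obtain ⟨W, hW⟩ := exists_covNum_bound hσ hT hε hε1
  have hbdd : BddAbove (Set.range fun y : FullShift b => Real.log (covNum ρ ε (π ⁻¹' {y}) : ℝ)) := by
    refine ⟨Real.log (S.L (0 + 1)) + a * ((σ + 1 / ((0 : ℕ) + 1)) * (N + 2 * W + S.L (0 + 1))) *
      (Real.log (12 * weightSum + 2) + Real.log (1 / ε)), ?_⟩
    rintro _ ⟨y, rfl⟩
    exact (hW 0 N (π ⁻¹' {y})).1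
  have hle : ∀ y, covNum ρ ε (π ⁻¹' {y}) ≤ ⌊Real.exp (supLogCov π ρ ε)⌋₊ := by
    intro y
    rcases Nat.eq_zero_or_pos (covNum ρ ε (π ⁻¹' {y})) with h0 | h0
    · rw [h0]
      exact Nat.zero_le _
    · rw [Nat.le_floor_iff (Real.exp_pos _).le, ← Real.log_le_iff_le_exp (by exact_mod_cast h0)]
      exact le_ciSup hbdd y
  obtain ⟨R, δ, hδ, h⟩ := exists_uniform_window hπ (P := fun O =>
    ∃ U : Fin ⌊Real.exp (supLogCov π ρ ε)⌋₊ → Set S.space,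
      (∀ i, setEDiam ρ (U i) < ENNReal.ofReal ε) ∧ O ⊆ ⋃ i, U i) fun y => by
    obtain ⟨U, hU1, hU2, hU3⟩ := (hW 0 N (π ⁻¹' {y})).2
    refine ⟨⋃ i, U i, isOpen_iUnion fun i => (hU1 i).isOpen hT, hU3,
      fun i => if h : (i : ℕ) < covNum ρ ε (π ⁻¹' {y}) then U ⟨i, h⟩ else ∅, fun i => ?_,
      Set.iUnion_subset fun i => ?_⟩
    · beta_reduce
      split_ifs
      · exact hU2 _
      · exact setEDiam_lt hε (r := 0) hε (by simp)
    · refine fun x hx => Set.mem_iUnion.2 ⟨⟨i, i.2.trans_le (hle y)⟩, ?_⟩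
      rwa [dif_pos (show (i : ℕ) < covNum ρ ε (π ⁻¹' {y}) from i.2)]
  refine ⟨R, δ, hδ, fun y => ?_⟩
  obtain ⟨O, ⟨U, hU, hOU⟩, hO⟩ := h y
  exact ⟨U, hU, fun x hx => Set.mem_iUnion.1 (hOU (hO x hx))⟩

theorem supLogCov_nonneg {X Y : Type*} (π : X → Y) (ρ : X → X → ℝ) (ε : ℝ) :
    0 ≤ supLogCov π ρ ε := Real.iSup_nonneg fun _ => Real.log_natCast_nonneg _

theorem exists_le_supLogCov (ha : 0 < a) (hσ : 0 ≤ σ)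
    (hT : ∀ x, (T x : FullShift a) = shift (x : FullShift a)) :
    ∃ A : ℝ, ∀ (b : ℕ) (π : S.space → FullShift b), Continuous π → (∀ x, π (T x) = shift (π x)) →
      b < a * σ → ∀ (ε : ℝ), 0 < ε → ε < 1 → ∀ N : ℕ, 0 < N →
        (a * σ - b) * Real.log (1 / ε) - A ≤ supLogCov π (dynDist T (subDist S.space) N) ε / N := by
  obtain ⟨C, hC1, hC⟩ := exists_waist
  refine ⟨a * Real.log C, fun b π hπ hπT hb ε hε hε1 N hN => ?_⟩
  obtain ⟨R, δ, hδ, hcov⟩ := exists_window_cover hσ hT hπ N hε hε1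
  set P := supLogCov π (dynDist T (subDist S.space) N) ε
  have hP : 0 ≤ P := supLogCov_nonneg _ _ _
  set l := Real.log (1 / ε) with hl
  have hl0 : 0 < l := Real.log_pos (by rw [lt_div_iff₀ hε]; linarith)
  have hlogC : 0 ≤ Real.log C := Real.log_nonneg hC1
  have hN' : (0 : ℝ) < N := by exact_mod_cast hN
  have ha' : (0 : ℝ) < a := by exact_mod_cast ha
  have hlim : Tendsto (fun K => P / N + (P + (2 * R + 1) * b * l) / (S.L K : ℝ)) atTop (𝓝 (P / N)) := by
    simpa using (S.tendsto_L.const_div_atTop (P + (2 * R + 1) * b * l)).const_add (P / N)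
  refine ge_of_tendsto hlim ?_
  have hlarge := S.tendsto_L.eventually_ge_atTop ((2 * R + 1) * b / (a * σ - b))
  filter_upwards [hlarge] with K hK
  have hL : (0 : ℝ) < S.L K := by exact_mod_cast S.L_pos K
  rw [div_le_iff₀ (by linarith)] at hK
  have hh := S.lt_h K
  have hhL : (S.h K : ℝ) ≤ S.L K := by exact_mod_cast S.h_le_L K
  have hσL : 0 ≤ σ * S.L K := by positivity
  have hh0 : 0 < S.h K := by exact_mod_cast hσL.trans_lt hh
  have hha : a * σ * S.L K ≤ S.h K * a := by nlinarith
  have h2 : (S.L K + 2 * R + 1) * b ≤ S.h K * a := by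
    have : ((S.L K + 2 * R + 1) * b : ℝ) ≤ S.h K * a := by linarith
    exact_mod_cast this
  have key := S.waist_bound hT hC hπ hπT hN hδ hε hε1 hcov K (Nat.mul_pos hh0 ha) h2
  set M := ⌊Real.exp P⌋₊ with hMdef
  have hM : 0 < M := by
    rw [Nat.pos_iff_ne_zero]
    intro h
    rw [h, zero_pow (Nat.succ_ne_zero _), Nat.cast_zero, mul_zero] at key
    linarith
  have hM' : (0 : ℝ) < M := by exact_mod_cast hM
  have hMP : Real.log M ≤ P := by
    rw [Real.log_le_iff_le_exp hM']
    exact Nat.floor_le (Real.exp_pos _).le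
  have hlogε : Real.log ε = -l := by rw [hl, one_div, Real.log_inv, neg_neg]
  have h3 := Real.log_le_log one_pos key
  rw [Real.log_one, Real.log_mul (by positivity) (by positivity), Real.log_mul (by positivity)
    (by positivity), Real.log_div (by positivity) (by positivity), Real.log_pow, Real.log_pow,
    Real.log_pow, Nat.cast_pow, Real.log_pow, hlogε] at h3
  push_cast at h3
  have h4 : ((S.L K / N : ℕ) : ℝ) ≤ S.L K / N := Nat.cast_div_le
  have h5 : (((S.L K / N : ℕ) : ℝ) + 1) * Real.log M ≤ (S.L K / N + 1) * P :=
    mul_le_mul (by linarith) hMP (Real.log_natCast_nonneg _) (by positivity)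
  have h6 : S.h K * a * Real.log C ≤ S.L K * a * Real.log C := by gcongr
  have h7 : a * σ * S.L K * l ≤ S.h K * a * l := by gcongr
  have h8 : ((a * σ - b) * l - a * Real.log C) * S.L K ≤
      (P / N + (P + (2 * R + 1) * b * l) / S.L K) * S.L K := by
    rw [add_mul, div_mul_cancel₀ _ hL.ne']
    have : P / N * S.L K = S.L K / N * P := by ring
    rw [this]
    nlinarith
  exact le_of_mul_le_mul_right h8 hL

theorem zero_le_lowerCondMdimM {X Y : Type*} (π : X → Y) (T : X → X) (d : X → X → ℝ) :
    0 ≤ lowerCondMdimM π T d := by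
  refine le_liminf_of_le (h := ?_)
  filter_upwards [eventually_mem_Ioo] with ε hε
  have hlog : 0 < Real.log (1 / ε) := Real.log_pos (by rw [lt_div_iff₀ hε.1]; linarith [hε.2])
  refine le_liminf_of_le (h := Eventually.of_forall fun N => ?_)
  rw [← EReal.coe_zero, EReal.coe_le_coe_iff]
  exact div_nonneg (supLogCov_nonneg _ _ _) (by positivity)

theorem le_lowerCondMdimM (ha : 0 < a) (hσ : 0 ≤ σ)
    (hT : ∀ x, (T x : FullShift a) = shift (x : FullShift a)) {b : ℕ} {π : S.space → FullShift b}
    (hπ : Continuous π) (hπT : ∀ x, π (T x) = shift (π x)) :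
    ((a * σ - b : ℝ) : EReal) ≤ lowerCondMdimM π T (subDist S.space) := by
  rcases lt_or_ge (b : ℝ) (a * σ) with hb | hb
  · obtain ⟨A, hA⟩ := exists_le_supLogCov (S := S) ha hσ hT
    rw [← (tendsto_mul_add_div_log (a * σ - b) (-A / (a * σ - b))).liminf_eq]
    refine liminf_le_liminf ?_
    filter_upwards [eventually_mem_Ioo] with ε hε
    have hlog : 0 < Real.log (1 / ε) := Real.log_pos (by rw [lt_div_iff₀ hε.1]; linarith [hε.2])
    have hs : 0 < a * σ - b := by linarith
    refine le_liminf_coe (α := 0) fun N hN => ?_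
    have hN' : (0 : ℝ) < N := by exact_mod_cast hN
    have h := hA b π hπ hπT hb ε hε.1 hε.2 N hN
    rw [zero_add, mul_comm, mul_le_mul_iff_right₀ hN', ← div_div, le_div_iff₀ hlog]
    refine le_trans (le_of_eq ?_) h
    field_simp
    ring
  · exact le_trans (by exact_mod_cast sub_nonpos.2 hb) (zero_le_lowerCondMdimM _ _ _)

theorem le_lowerMdimM (ha : 0 < a) (hσ : 0 ≤ σ)
    (hT : ∀ x, (T x : FullShift a) = shift (x : FullShift a)) :
    ((a * σ : ℝ) : EReal) ≤ lowerMdimM T (subDist S.space) := by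
  have h := le_lowerCondMdimM (S := S) (b := 0) ha hσ hT (π := fun _ _ => Fin.elim0) continuous_const
    fun _ => rfl
  rw [Nat.cast_zero, sub_zero] at h
  convert h using 1
  have : ∀ y : FullShift 0, (fun (_ : S.space) (_ : ℤ) => (Fin.elim0 : Cube 0)) ⁻¹' {y} = Set.univ :=
    fun y => Set.eq_univ_of_forall fun _ => Subsingleton.elim _ _
  simp only [lowerMdimM, lowerCondMdimM, mdimMRate, condMdimRate, supLogCov, this, ciSup_const]

end Toeplitz

end Conditional

section Skeleton

/-- The `d`-skeleton of the standard simplex with `m` vertices. -/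
def skeleton (m d : ℕ) : Geometry.SimplicialComplex ℝ (Fin m → ℝ) :=
  open Classical in
  Geometry.SimplicialComplex.ofAffineIndependent
    { faces := {s | s.Nonempty ∧ s.card ≤ d + 1 ∧
        (s : Set (Fin m → ℝ)) ⊆ Set.range fun i => Pi.single i (1 : ℝ)}
      isRelLowerSet_faces := by
        intro s hs
        refine ⟨hs.1, fun t hts ht => ⟨ht, (Finset.card_le_card hts).trans hs.2.1, ?_⟩⟩
        exact (Finset.coe_subset.2 hts).trans hs.2.2 }
    (by
      refine (Pi.linearIndependent_single_one (Fin m) ℝ).affineIndependent.range.mono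
        fun x hx => ?_
      simp only [Set.mem_iUnion, Finset.mem_coe] at hx
      obtain ⟨s, hs, hx⟩ := hx
      exact hs.2.2 hx)

theorem mem_skeleton_faces {m d : ℕ} {s : Finset (Fin m → ℝ)} : s ∈ (skeleton m d).faces ↔
    s.Nonempty ∧ s.card ≤ d + 1 ∧ (s : Set (Fin m → ℝ)) ⊆ Set.range fun i => Pi.single i (1 : ℝ) :=
  Iff.rfl

theorem skeleton_faces_finite (m d : ℕ) : (skeleton m d).faces.Finite := by
  classical
  refine (Finset.finite_toSet (Finset.univ.image fun i : Fin m =>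
    (Pi.single i (1 : ℝ) : Fin m → ℝ)).powerset).subset fun s hs => ?_
  rw [mem_skeleton_faces] at hs
  simp only [Finset.coe_powerset, Set.mem_preimage, Set.mem_powerset_iff, Finset.coe_image,
    Finset.coe_univ, Set.image_univ]
  exact hs.2.2

theorem mem_skeleton_space {m d : ℕ} {p : Fin m → ℝ} (h0 : ∀ i, 0 ≤ p i) (h1 : ∑ i, p i = 1)
    (hd : {i | p i ≠ 0}.ncard ≤ d + 1) : p ∈ (skeleton m d).space := by
  classical
  set t : Finset (Fin m) := Finset.univ.filter fun i => p i ≠ 0 with ht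
  have ht1 : ∑ i ∈ t, p i = 1 := by rw [← h1, ht, Finset.sum_filter_ne_zero]
  rw [Geometry.SimplicialComplex.mem_space_iff]
  refine ⟨t.image fun i => Pi.single i 1, mem_skeleton_faces.2 ⟨?_, ?_, ?_⟩, ?_⟩
  · rw [Finset.image_nonempty, Finset.nonempty_iff_ne_empty]
    intro h
    simp [h] at ht1
  · refine Finset.card_image_le.trans (le_trans (le_of_eq ?_) hd)
    rw [← Set.ncard_coe_finset, ht]
    simp
  · rw [Finset.coe_image]
    exact Set.image_subset_range _ _
  · have hp : p = ∑ i ∈ t, p i • (Pi.single i (1 : ℝ) : Fin m → ℝ) := by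
      conv_lhs => rw [← Finset.univ_sum_single p]
      rw [ht, Finset.sum_filter]
      refine Finset.sum_congr rfl fun i _ => ?_
      by_cases h : p i = 0 <;> simp [h, ← Pi.single_smul]
    rw [hp]
    refine (convex_convexHull ℝ _).sum_mem (fun i _ => h0 i) ht1 fun i hi => ?_
    exact subset_convexHull _ _ (by simpa using ⟨i, by simpa using hi, rfl⟩)

/-- The dimensions of the finite simplicial complexes into which `X` has an `ε`-embedding. -/
def embeddingDims (X : Type*) [TopologicalSpace X] (ρ : X → X → ℝ) (ε : ℝ) : Set ℕ :=
  {k : ℕ | ∃ (m : ℕ) (K : Geometry.SimplicialComplex ℝ (Fin m → ℝ)),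
    K.faces.Finite ∧ (∀ s ∈ K.faces, s.card ≤ k + 1) ∧
    ∃ f : X → K.space, Continuous f ∧
      ∀ p : K.space, setEDiam ρ (f ⁻¹' {p}) < ENNReal.ofReal ε}

theorem mem_embeddingDims_of_partition {X V : Type*} [TopologicalSpace X] [Fintype V]
    {ρ : X → X → ℝ} {r ε : ℝ} {d : ℕ} (lam : X → V → ℝ) (hlam : Continuous lam)
    (h0 : ∀ x v, 0 ≤ lam x v) (h1 : ∀ x, ∑ v, lam x v = 1)
    (hd : ∀ x, {v | lam x v ≠ 0}.ncard ≤ d + 1) (hε : 0 < ε) (hr : r < ε)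
    (h : ∀ x y v, lam x v ≠ 0 → lam y v ≠ 0 → ρ x y ≤ r) : d ∈ embeddingDims X ρ ε := by
  let e := Fintype.equivFin V
  have hmem : ∀ x, (fun i => lam x (e.symm i)) ∈ (skeleton (Fintype.card V) d).space := fun x => by
    refine mem_skeleton_space (fun i => h0 x _) ?_ ?_
    · rw [← h1 x]
      exact e.symm.sum_comp _
    · refine le_trans (le_of_eq ?_) (hd x)
      rw [← Set.ncard_image_of_injective _ e.symm.injective]
      congr 1
      ext v
      simp only [Set.mem_image, Set.mem_ofPred_eq]
      exact ⟨fun ⟨i, hi, hv⟩ => hv ▸ hi, fun hv => ⟨e v, by simpa using hv, by simp⟩⟩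
  refine ⟨_, skeleton (Fintype.card V) d, skeleton_faces_finite _ _,
    fun s hs => (mem_skeleton_faces.1 hs).2.1, fun x => ⟨_, hmem x⟩, ?_, fun p => ?_⟩
  · refine Continuous.subtype_mk (continuous_pi fun i => ?_) _
    exact (continuous_apply (e.symm i)).comp hlam
  · refine setEDiam_lt hε hr fun x hx y hy => ?_
    obtain ⟨v, -, hv⟩ : ∃ v ∈ Finset.univ, lam x v ≠ 0 :=
      Finset.exists_ne_zero_of_sum_ne_zero (by rw [h1]; exact one_ne_zero)
    refine h x y v hv ?_
    have hxy := congr_fun (congr_arg Subtype.val (hx.trans hy.symm)) (e v)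
    simp only [Equiv.symm_apply_apply] at hxy
    rwa [← hxy]

end Skeleton

section Grid

variable {ι : Type*} [Fintype ι] {Q : ℕ}

/-- The weight at a point `w` of a vertex `v` of the cubical grid, positive iff a translate
`w + t • 1` with `0 < t < 1` lies in the open unit cube with lowest corner `v`. -/
def gridWeight (w : ι → ℝ) (v : ι → Fin (Q + 1)) : ℝ :=
  ∏ c, ∏ c', max 0 (min 1 ((v c : ℕ) + 1 - w c) - max 0 ((v c' : ℕ) - w c'))

theorem gridWeight_nonneg (w : ι → ℝ) (v : ι → Fin (Q + 1)) : 0 ≤ gridWeight w v :=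
  Finset.prod_nonneg fun _ _ => Finset.prod_nonneg fun _ _ => le_max_left _ _

theorem continuous_gridWeight (v : ι → Fin (Q + 1)) :
    Continuous fun w : ι → ℝ => gridWeight w v := by
  unfold gridWeight
  fun_prop

theorem lt_of_gridWeight_ne_zero {w : ι → ℝ} {v : ι → Fin (Q + 1)} (h : gridWeight w v ≠ 0)
    (c c' : ι) : max 0 (((v c' : ℕ) : ℝ) - w c') < min 1 (((v c : ℕ) : ℝ) + 1 - w c) := by
  have h1 := Finset.prod_ne_zero_iff.1 h c (Finset.mem_univ c)
  have h2 := Finset.prod_ne_zero_iff.1 h1 c' (Finset.mem_univ c')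
  by_contra! h3
  exact h2 (max_eq_left (by linarith))

theorem abs_sub_lt_of_gridWeight_ne_zero {w : ι → ℝ} {v : ι → Fin (Q + 1)}
    (h : gridWeight w v ≠ 0) (c : ι) : |((v c : ℕ) : ℝ) - w c| < 1 := by
  have h1 := lt_of_gridWeight_ne_zero h c c
  rw [max_lt_iff, lt_min_iff, lt_min_iff] at h1
  exact abs_lt.2 ⟨by linarith, h1.2.1⟩

theorem le_total_of_gridWeight_ne_zero {w : ι → ℝ} {v v' : ι → Fin (Q + 1)}
    (h : gridWeight w v ≠ 0) (h' : gridWeight w v' ≠ 0) : v ≤ v' ∨ v' ≤ v := by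
  by_contra! H
  simp only [Pi.le_def, not_forall, not_le] at H
  obtain ⟨⟨c, hc⟩, c', hc'⟩ := H
  have h1 := lt_of_gridWeight_ne_zero h c' c
  have h2 := lt_of_gridWeight_ne_zero h' c c'
  rw [max_lt_iff, lt_min_iff, lt_min_iff] at h1 h2
  have h3 : ((v' c : ℕ) : ℝ) + 1 ≤ (v c : ℕ) := by exact_mod_cast hc
  have h4 : ((v c' : ℕ) : ℝ) + 1 ≤ (v' c' : ℕ) := by exact_mod_cast hc'
  linarith [h1.2.2, h2.2.2]

theorem sum_gridWeight_pos [DecidableEq ι] {w : ι → ℝ} (h0 : ∀ c, 0 ≤ w c) (hQ : ∀ c, w c ≤ Q) :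
    0 < ∑ v : ι → Fin (Q + 1), gridWeight w v := by
  classical
  refine Finset.sum_pos' (fun v _ => gridWeight_nonneg w v)
    ⟨fun c => ⟨⌊w c⌋₊, Nat.lt_succ_of_le (Nat.floor_le_of_le (hQ c))⟩, Finset.mem_univ _, ?_⟩
  refine Finset.prod_pos fun c _ => Finset.prod_pos fun c' _ => ?_
  rw [lt_max_iff]
  right
  rw [max_eq_left (sub_nonpos.2 (Nat.floor_le (h0 c'))), sub_zero]
  exact lt_min one_pos (by linarith [Nat.lt_floor_add_one (w c)])

theorem ncard_gridWeight_ne_zero_le {w : ι → ℝ} (h0 : ∀ c, 0 ≤ w c) {d : ℕ}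
    (hd : {c | ∀ m : ℕ, w c ≠ m}.ncard ≤ d) :
    {v : ι → Fin (Q + 1) | gridWeight w v ≠ 0}.ncard ≤ d + 1 := by
  classical
  have hval : ∀ v : ι → Fin (Q + 1), gridWeight w v ≠ 0 → ∀ c, ⌊w c⌋₊ ≤ (v c : ℕ) ∧
      (v c : ℕ) ≤ ⌊w c⌋₊ + if ∀ m : ℕ, w c ≠ m then 1 else 0 := by
    intro v hv c
    have h := abs_lt.1 (abs_sub_lt_of_gridWeight_ne_zero hv c)
    constructor
    · have : (⌊w c⌋₊ : ℝ) < (v c : ℕ) + 1 := by linarith [Nat.floor_le (h0 c)]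
      exact Nat.lt_add_one_iff.1 (by exact_mod_cast this)
    · split_ifs with hc
      · have : ((v c : ℕ) : ℝ) < ⌊w c⌋₊ + 1 + 1 := by linarith [Nat.lt_floor_add_one (w c)]
        exact Nat.lt_add_one_iff.1 (by exact_mod_cast this)
      · push Not at hc
        obtain ⟨m, hm⟩ := hc
        rw [hm, Nat.floor_natCast]
        have : ((v c : ℕ) : ℝ) < m + 1 := by linarith
        exact Nat.lt_add_one_iff.1 (by exact_mod_cast this)
  set A := ∑ c, ⌊w c⌋₊
  have hcard : (Finset.Icc A (A + d)).card = d + 1 := by simp [Nat.card_Icc]; omega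
  rw [← hcard, ← Set.ncard_coe_finset]
  refine Set.ncard_le_ncard_of_injOn (fun v => ∑ c, (v c : ℕ)) (fun v hv => ?_)
    (fun v hv v' hv' hs => ?_) (Finset.finite_toSet _)
  · rw [Finset.coe_Icc]
    refine ⟨Finset.sum_le_sum fun c _ => (hval v hv c).1, ?_⟩
    refine (Finset.sum_le_sum fun c _ => (hval v hv c).2).trans ?_
    rw [Finset.sum_add_distrib]
    refine Nat.add_le_add_left (le_trans (le_of_eq ?_) hd) _
    rw [Finset.sum_boole, ← Set.ncard_coe_finset]
    simp
  · have key : ∀ v v' : ι → Fin (Q + 1), v ≤ v' → ∑ c, (v c : ℕ) = ∑ c, (v' c : ℕ) → v = v' := by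
      intro v v' hle hs
      ext c
      exact (Finset.sum_eq_sum_iff_of_le fun c _ => Fin.le_def.1 (hle c)).1 hs c (Finset.mem_univ c)
    rcases le_total_of_gridWeight_ne_zero hv hv' with h | h
    · exact key v v' h hs
    · exact (key v' v h hs.symm).symm

theorem mem_embeddingDims_of_coords [DecidableEq ι] {X : Type*} [TopologicalSpace X] {ρ : X → X → ℝ} {r ε : ℝ}
    {d : ℕ} (hQ : 0 < Q) (z : X → ι → ℝ) (hz : Continuous z) (h0 : ∀ x c, 0 ≤ z x c)
    (h1 : ∀ x c, z x c ≤ 1) (hd : ∀ x, {c | ∀ m : ℕ, Q * z x c ≠ m}.ncard ≤ d) (hε : 0 < ε)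
    (hr : r < ε) (h : ∀ x y, (∀ c, |z x c - z y c| ≤ 2 / Q) → ρ x y ≤ r) :
    d ∈ embeddingDims X ρ ε := by
  classical
  have hQ' : (0 : ℝ) < Q := by exact_mod_cast hQ
  set w : X → ι → ℝ := fun x c => Q * z x c with hw
  have hw0 : ∀ x c, 0 ≤ w x c := fun x c => mul_nonneg hQ'.le (h0 x c)
  have hwQ : ∀ x c, w x c ≤ Q := fun x c => mul_le_of_le_one_right hQ'.le (h1 x c)
  have hwc : Continuous w := by fun_prop
  have hpos : ∀ x, 0 < ∑ v : ι → Fin (Q + 1), gridWeight (w x) v :=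
    fun x => sum_gridWeight_pos (hw0 x) (hwQ x)
  have hne : ∀ x (v : ι → Fin (Q + 1)), gridWeight (w x) v / ∑ v : ι → Fin (Q + 1), gridWeight (w x) v ≠ 0 ↔
      gridWeight (w x) v ≠ 0 := fun x v => by simp [(hpos x).ne']
  refine mem_embeddingDims_of_partition
    (fun x (v : ι → Fin (Q + 1)) => gridWeight (w x) v / ∑ v : ι → Fin (Q + 1), gridWeight (w x) v)
    ?_ (fun x v => div_nonneg (gridWeight_nonneg _ _) (hpos x).le) (fun x => ?_) (fun x => ?_)
    hε hr fun x y v hx hy => h x y fun c => ?_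
  · refine continuous_pi fun v => ((continuous_gridWeight v).comp hwc).div ?_ fun x => (hpos x).ne'
    exact continuous_finsetSum _ fun v _ => (continuous_gridWeight v).comp hwc
  · rw [← Finset.sum_div, div_self (hpos x).ne']
  · simp only [hne]
    exact ncard_gridWeight_ne_zero_le (hw0 x) (hd x)
  · have hx' := abs_lt.1 (abs_sub_lt_of_gridWeight_ne_zero ((hne x v).1 hx) c)
    have hy' := abs_lt.1 (abs_sub_lt_of_gridWeight_ne_zero ((hne y v).1 hy) c)
    simp only [hw] at hx' hy'
    rw [abs_le, ← neg_div, div_le_iff₀ hQ', le_div_iff₀ hQ']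
    constructor <;> linarith

end Grid

section MeanDimension

namespace Toeplitz

variable {a : ℕ} {σ : ℝ} {S : Toeplitz a σ} {T : S.space → S.space}

theorem ncard_nonint_le (k : ℕ) (x : S.space) (m : ℤ) (M : ℕ) {Q : ℕ}
    (hQ : 2 ^ (k + 1) ∣ Q) :
    {c : Finset.Ico m (m + M) × Fin a |
      ∀ j : ℕ, (Q : ℝ) * (x : FullShift a) c.1 c.2 ≠ j}.ncard ≤
      ⌊(σ + 1 / (k + 1)) * (M + S.L (k + 1))⌋₊ * a := by
  classical
  set p : ℤ := ((S.phase (k + 1) x : ℕ) : ℤ)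
  have h1 : (S.holes (k + 1) (m + p) (m + p + M)).card ≤
      ⌊(σ + 1 / (k + 1)) * (M + S.L (k + 1))⌋₊ := Nat.le_floor (S.cast_card_holes_le k (m + p) M)
  refine le_trans ?_ (Nat.mul_le_mul_right a h1)
  have h2 : (S.holes (k + 1) (m + p) (m + p + M)).card * a =
      (S.holes (k + 1) (m + p) (m + p + M) ×ˢ (Finset.univ : Finset (Fin a))).card := by
    rw [Finset.card_product, Finset.card_fin]
  rw [h2, ← Set.ncard_coe_finset]
  refine Set.ncard_le_ncard_of_injOn (fun c => ((c.1 : ℤ) + p, c.2)) (fun c hc => ?_)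
    (fun c _ c' _ h => ?_) (Finset.finite_toSet _)
  · have hm := Finset.mem_Ico.1 c.1.2
    simp only [Finset.coe_product, Set.mem_prod, Finset.mem_coe, mem_holes, Finset.mem_univ, and_true]
    refine ⟨⟨by linarith, by linarith⟩, ?_⟩
    by_contra hn
    obtain ⟨Q', rfl⟩ := hQ
    obtain ⟨z, hz⟩ := S.dyadic_val (k + 1) (c.1 + p) c.2
    rw [← S.apply_eq_val hn] at hz
    have hz0 : 0 ≤ z := by
      have : (0 : ℝ) ≤ z := by
        rw [← hz]
        exact mul_nonneg ((x : FullShift a) c.1 c.2).2.1 (by positivity)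
      exact_mod_cast this
    lift z to ℕ using hz0
    refine hc (Q' * z) ?_
    push_cast at hz ⊢
    rw [← hz]
    ring
  · simp only [Prod.mk.injEq, add_left_inj] at h
    exact Prod.ext (Subtype.ext h.1) h.2

theorem exists_embeddingDim (hσ : 0 ≤ σ) (hT : ∀ x, (T x : FullShift a) = shift (x : FullShift a))
    {ε : ℝ} (hε : 0 < ε) : ∃ W : ℕ, ∀ k N : ℕ,
      ∃ d ∈ embeddingDims S.space (dynDist T (subDist S.space) N) ε,
        (d : ℝ) ≤ a * ((σ + 1 / (k + 1)) * (N + 2 * W + S.L (k + 1))) := by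
  obtain ⟨W, hW⟩ := exists_dynDist_le hT (show 0 < ε / 4 by positivity)
  have hw := weightSum_pos
  refine ⟨W, fun k N => ?_⟩
  set Q' := ⌈8 * weightSum / ε⌉₊ with hQ'
  have hQ0 : 0 < Q' := Nat.ceil_pos.2 (by positivity)
  set Q := 2 ^ (k + 1) * Q' with hQ
  have hQpos : 0 < Q := by positivity
  have hQpos' : (0 : ℝ) < Q := by exact_mod_cast hQpos
  have hQ1 : 8 * weightSum / ε ≤ Q := (Nat.le_ceil _).trans
    (by exact_mod_cast Nat.le_mul_of_pos_left Q' (by positivity))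
  have hr : weightSum * (2 / Q) + ε / 4 ≤ ε / 2 := by
    rw [div_le_iff₀ hε] at hQ1
    have : weightSum * (2 / Q) ≤ ε / 4 := by
      rw [← mul_div_assoc, div_le_iff₀ hQpos']
      linarith
    linarith
  refine ⟨⌊(σ + 1 / (k + 1)) * ((N + 2 * W : ℕ) + S.L (k + 1))⌋₊ * a,
    mem_embeddingDims_of_coords (r := ε / 2) hQpos
      (fun (x : S.space) (c : Finset.Ico (-(W : ℤ)) (-W + (N + 2 * W : ℕ)) × Fin a) =>
        ((x : FullShift a) c.1 c.2 : ℝ)) ?_ (fun x c => ((x : FullShift a) c.1 c.2).2.1)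
      (fun x c => ((x : FullShift a) c.1 c.2).2.2)
      (fun x => ncard_nonint_le k x _ _ (Dvd.intro _ rfl)) hε (by linarith) fun x y h =>
        (hW N x y (2 / Q) (by positivity) fun n h1 h2 i => ?_).trans hr, ?_⟩
  · exact continuous_pi fun c => (continuous_coord (c.1 : ℤ) c.2).comp continuous_subtype_val
  · exact h (⟨n, Finset.mem_Ico.2 ⟨h1, by push_cast; linarith⟩⟩, i)
  · rw [Nat.cast_mul, mul_comm]
    refine mul_le_mul_of_nonneg_left ((Nat.floor_le (by positivity)).trans_eq ?_) (Nat.cast_nonneg a)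
    push_cast
    rfl

theorem mdim_le (hσ : 0 ≤ σ) (hT : ∀ x, (T x : FullShift a) = shift (x : FullShift a)) :
    mdim S.space T (subDist S.space) ≤ ((a * σ : ℝ) : EReal) := by
  have key : ∀ k : ℕ, mdim S.space T (subDist S.space) ≤ ((a * (σ + 1 / (k + 1)) : ℝ) : EReal) := by
    intro k
    refine (limsup_le_limsup (v := fun _ => ((a * (σ + 1 / (k + 1)) : ℝ) : EReal)) ?_).trans_eq
      (limsup_const _)
    filter_upwards [eventually_mem_Ioo] with ε hε
    obtain ⟨W, hW⟩ := exists_embeddingDim hσ hT hε.1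
    refine liminf_coe_le (α := a * ((σ + 1 / (k + 1)) * (2 * W + S.L (k + 1)))) fun N => ?_
    obtain ⟨d, hd, hd'⟩ := hW k N
    have h : (widim S.space (dynDist T (subDist S.space) N) ε : ℝ) ≤ d := by
      exact_mod_cast Nat.sInf_le hd
    rcases Nat.eq_zero_or_pos N with rfl | hN
    · simp only [Nat.cast_zero, zero_mul, mul_zero, add_zero]
      positivity
    · have hN' : (0 : ℝ) < N := by exact_mod_cast hN
      rw [mul_div_cancel₀ _ hN'.ne']
      refine (h.trans hd').trans_eq ?_
      ring
  have hlim : Tendsto (fun k : ℕ => ((a * (σ + 1 / (k + 1)) : ℝ) : EReal)) atTop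
      (𝓝 ((a * σ : ℝ) : EReal)) := by
    refine (continuous_coe_real_ereal.tendsto (a * σ)).comp ?_
    simpa using (tendsto_one_div_add_atTop_nhds_zero_nat.const_add σ).const_mul (a : ℝ)
  exact ge_of_tendsto' hlim key

end Toeplitz

end MeanDimension

section Dimension

theorem dimH_convexHull_finset_le {m k : ℕ} {s : Finset (Fin m → ℝ)} (hs : s.card ≤ k + 1) :
    dimH (convexHull ℝ (s : Set (Fin m → ℝ))) ≤ k := by
  classical
  rcases s.eq_empty_or_nonempty with rfl | hne
  · simp
  · rw [Real.Convex.dimH_eq_finrank_vectorSpan (convex_convexHull ℝ _) (by simpa using hne),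
      ← direction_affineSpan, affineSpan_convexHull, direction_affineSpan]
    have h := finrank_vectorSpan_image_finset_le ℝ id s (n := s.card - 1)
      (by have := hne.card_pos; omega)
    rw [Finset.image_id] at h
    exact_mod_cast h.trans (by omega)

theorem dimH_space_le {m k : ℕ} {K : Geometry.SimplicialComplex ℝ (Fin m → ℝ)}
    (hK : K.faces.Finite) (hk : ∀ s ∈ K.faces, s.card ≤ k + 1) : dimH K.space ≤ k := by
  rw [Geometry.SimplicialComplex.space, dimH_bUnion hK.countable]
  exact iSup₂_le fun s hs => dimH_convexHull_finset_le (hk s hs)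

theorem exists_infDist_ge {E : Type*} [MetricSpace E] {A B : Set E} (hA : IsCompact A)
    (hB : IsCompact B) (hBne : B.Nonempty) (hAB : Disjoint A B) :
    ∃ c > 0, ∀ q ∈ A, c ≤ Metric.infDist q B :=
  hA.exists_forall_le' (Metric.continuous_infDist_pt B).continuousOn fun _ hq =>
    (hB.isClosed.notMem_iff_infDist_pos hBne).1 (Set.disjoint_left.1 hAB hq)

/-- A continuous map on the cube `[0,1]ⁿ` separating opposite faces cannot take its values in a set
of Hausdorff dimension less than `n`. -/
theorem le_dimH_of_disjoint_faces {n : ℕ} {E : Type*} [MetricSpace E] {s : Set E}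
    {p : (Fin n → ℝ) → E} (hp : Continuous p) (hps : ∀ u, p u ∈ s)
    (h : ∀ i, ∀ u u' : Fin n → ℝ, (∀ j, u j ∈ Set.Icc (0 : ℝ) 1) → (∀ j, u' j ∈ Set.Icc (0 : ℝ) 1) →
      u i = 0 → u' i = 1 → p u ≠ p u') : n ≤ dimH s := by
  by_contra! hlt
  have hC : IsCompact {u : Fin n → ℝ | ∀ j, u j ∈ Set.Icc (0 : ℝ) 1} := by
    have := isCompact_univ_pi fun _ : Fin n => isCompact_Icc (a := (0 : ℝ)) (b := 1)
    convert this using 1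
    ext u
    simp only [Set.mem_ofPred_eq, Set.mem_univ_pi]
  let face : Fin n → ℝ → Set E := fun i t =>
    p '' ({u | ∀ j, u j ∈ Set.Icc (0 : ℝ) 1} ∩ {u | u i = t})
  have hface : ∀ i t, IsCompact (face i t) := fun i t =>
    (hC.inter_right (isClosed_eq (continuous_apply i) continuous_const)).image hp
  have hne : ∀ i, ∀ t ∈ Set.Icc (0 : ℝ) 1, (face i t).Nonempty := fun i t ht =>
    ⟨p fun _ => t, fun _ => t, ⟨fun _ => ht, rfl⟩, rfl⟩
  have hdisj : ∀ i, Disjoint (face i 0) (face i 1) := fun i => by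
    rw [Set.disjoint_left]
    rintro _ ⟨u, hu, rfl⟩ ⟨u', hu', he⟩
    exact h i u u' hu.1 hu'.1 hu.2 hu'.2 he.symm
  choose c hc hc' using fun i =>
    exists_infDist_ge (hface i 0) (hface i 1) (hne i 1 ⟨zero_le_one, le_rfl⟩) (hdisj i)
  choose d hd hd' using fun i =>
    exists_infDist_ge (hface i 1) (hface i 0) (hne i 0 ⟨le_rfl, zero_le_one⟩) (hdisj i).symm
  let Φ : E → Fin n → ℝ := fun q i => Metric.infDist q (face i 0) - Metric.infDist q (face i 1)
  have hΦ : LipschitzWith (1 + 1) Φ := by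
    refine LipschitzWith.of_dist_le_mul fun q q' => (dist_pi_le_iff (by positivity)).2 fun i => ?_
    exact ((Metric.lipschitz_infDist_pt (face i 0)).sub
      (Metric.lipschitz_infDist_pt (face i 1))).dist_le_mul q q'
  have hdense : Dense (Φ '' s)ᶜ := by
    refine dense_compl_of_dimH_lt_finrank ?_
    rw [Module.finrank_fin_fun]
    exact (hΦ.dimH_image_le s).trans_lt hlt
  obtain ⟨w, hw, hws⟩ := hdense.inter_open_nonempty
    (Set.univ.pi fun i => Set.Ioo (-c i) (d i))
    (isOpen_set_pi Set.finite_univ fun i _ => isOpen_Ioo)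
    ⟨0, fun i _ => ⟨neg_lt_zero.2 (hc i), hd i⟩⟩
  have hmem : ∀ v : Fin n → ℝ, (∀ j, v j ∈ Set.Icc (-1 : ℝ) 1) →
      ∀ j, (v j + 1) / 2 ∈ Set.Icc (0 : ℝ) 1 :=
    fun v hv j => ⟨by linarith [(hv j).1], by linarith [(hv j).2]⟩
  obtain ⟨v, hv, hv0⟩ := poincare_miranda (G := fun v => Φ (p fun j => (v j + 1) / 2) - w)
    ((hΦ.continuous.comp (hp.comp (by fun_prop))).sub continuous_const)
    (fun v i hv hvi => by
      have hA : p (fun j => (v j + 1) / 2) ∈ face i 0 :=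
        ⟨_, ⟨hmem v hv, by simp [hvi]⟩, rfl⟩
      simp only [Pi.sub_apply, Φ, Metric.infDist_zero_of_mem hA]
      linarith [hc' i _ hA, (hw i trivial).1])
    (fun v i hv hvi => by
      have hB : p (fun j => (v j + 1) / 2) ∈ face i 1 :=
        ⟨_, ⟨hmem v hv, by simp [hvi]⟩, rfl⟩
      simp only [Pi.sub_apply, Φ, Metric.infDist_zero_of_mem hB]
      linarith [hd' i _ hB, (hw i trivial).2])
  exact hws ⟨_, hps _, sub_eq_zero.1 hv0⟩

theorem le_of_mem_embeddingDims {X ι : Type*} [TopologicalSpace X] [Fintype ι] {ρ : X → X → ℝ}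
    {ε : ℝ} {k : ℕ} (hk : k ∈ embeddingDims X ρ ε) (hε : ε ≤ 1) {g : (ι → ℝ) → X} (hg : Continuous g)
    (h : ∀ u u' : ι → ℝ, (∀ j, u j ∈ Set.Icc (0 : ℝ) 1) → (∀ j, u' j ∈ Set.Icc (0 : ℝ) 1) →
      ∀ i, |u i - u' i| ≤ ρ (g u) (g u')) : Fintype.card ι ≤ k := by
  obtain ⟨m, K, hK, hKk, f, hf, hfε⟩ := hk
  let e := Fintype.equivFin ι
  have := (le_dimH_of_disjoint_faces (n := Fintype.card ι) (s := K.space)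
    (p := fun u => (f (g fun j => u (e j)) : Fin m → ℝ))
    (continuous_subtype_val.comp (hf.comp (hg.comp (by fun_prop)))) (fun u => (f _).2)
    fun i u u' hu hu' hi hi' he => ?_).trans (dimH_space_le hK hKk)
  · exact_mod_cast this
  · have h1 := h (fun j => u (e j)) (fun j => u' (e j)) (fun j => hu _) (fun j => hu' _) (e.symm i)
    have h2 := lt_of_setEDiam_lt (hfε (f (g fun j => u (e j)))) rfl (Subtype.ext he.symm)
    rw [Equiv.apply_symm_apply, hi, hi'] at h1
    norm_num at h1
    linarith

end Dimension

section MeanDimensionLower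

namespace Toeplitz

variable {a : ℕ} {σ : ℝ} {S : Toeplitz a σ} {T : S.space → S.space}

theorem continuous_of_eq_shift (hT : ∀ x, (T x : FullShift a) = shift (x : FullShift a)) :
    Continuous T := by
  refine continuous_induced_rng.2 ?_
  have h : Subtype.val ∘ T = fun x : S.space => shift (x : FullShift a) := funext hT
  rw [h]
  exact continuous_pi fun n => (continuous_apply (n + 1)).comp continuous_subtype_val

variable (S) in
/-- Some window of length `N` contains at least `σ * N - 1` holes of a sufficiently high level. -/
theorem exists_window_holes {N : ℕ} (hN : 0 < N) : ∃ K r : ℕ,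
    σ * N - 1 ≤ ((S.holes K 0 (S.L K)).filter fun n : ℤ => (n / N).toNat = r).card := by
  have hN' : (0 : ℝ) < N := by exact_mod_cast hN
  obtain ⟨K, hK⟩ := (S.tendsto_L.eventually_ge_atTop ((N : ℝ) * N)).exists
  refine ⟨K, ?_⟩
  by_contra! hlt
  have hmaps : ∀ n ∈ S.holes K 0 (S.L K), (n / N).toNat ∈ Finset.range (S.L K / N + 1) := by
    intro n hn
    rw [mem_holes] at hn
    rw [Finset.mem_range, Nat.lt_succ_iff, Int.toNat_le]
    push_cast
    exact Int.ediv_le_ediv (by exact_mod_cast hN) hn.1.2.le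
  have hcard := Finset.card_eq_sum_card_fiberwise hmaps
  rw [S.card_holes_L] at hcard
  have h1 : (S.h K : ℝ) ≤ ((S.L K / N : ℕ) + 1 : ℝ) * (σ * N - 1) := by
    rw [hcard, Nat.cast_sum]
    refine (Finset.sum_le_sum fun r _ => (hlt r).le).trans_eq ?_
    rw [Finset.sum_const, Finset.card_range, nsmul_eq_mul]
    push_cast
    rfl
  have h0 : 0 < σ * N - 1 := (Nat.cast_nonneg _).trans_lt (hlt 0)
  have h2 : ((S.L K / N : ℕ) : ℝ) ≤ S.L K / N := Nat.cast_div_le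
  have h3 := S.lt_h K
  have hL : (0 : ℝ) < S.L K := by exact_mod_cast S.L_pos K
  have hσ1 : σ ≤ 1 := by
    have : (S.h K : ℝ) ≤ S.L K := by exact_mod_cast S.h_le_L K
    nlinarith
  have h4 : (N : ℝ) ≤ S.L K / N := by rwa [le_div_iff₀ hN']
  have h5 : ((S.L K / N : ℕ) + 1 : ℝ) * (σ * N - 1) ≤ (S.L K / N + 1) * (σ * N - 1) := by
    gcongr
  have h6 : ((S.L K : ℝ) / N + 1) * (σ * N - 1) = σ * S.L K + σ * N - S.L K / N - 1 := by
    field_simp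
    ring
  nlinarith

theorem le_of_mem_embeddingDims_dynDist
    (hT : ∀ x, (T x : FullShift a) = shift (x : FullShift a)) {ε : ℝ} (hε : ε ≤ 1) {N d : ℕ}
    (hN : 0 < N) (hd : d ∈ embeddingDims S.space (dynDist T (subDist S.space) N) ε) :
    a * (σ * N - 1) ≤ d := by
  classical
  obtain ⟨K, r, hr⟩ := S.exists_window_holes hN
  obtain ⟨g, hg, hgu⟩ := S.exists_cube K
  set P := (S.holes K 0 (S.L K)).filter fun n : ℤ => (n / N).toNat = r with hP
  let ext : (P × Fin a → ℝ) → (S.holes K 0 (S.L K) × Fin a → ℝ) := fun u c =>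
    if h : (c.1 : ℤ) ∈ P then u (⟨c.1, h⟩, c.2) else 0
  have hext : Continuous ext := by
    refine continuous_pi fun c => ?_
    by_cases h : (c.1 : ℤ) ∈ P
    · simpa only [ext, h, dite_true] using continuous_apply _
    · simpa only [ext, h, dite_false] using continuous_const
  have hcoord : ∀ u : P × Fin a → ℝ, (∀ j, u j ∈ Set.Icc (0 : ℝ) 1) → ∀ c : P × Fin a,
      ((T^[r * N] (g (ext u)) : FullShift a) ((c.1 : ℤ) - (r * N : ℕ)) c.2 : ℝ) = u c := by
    intro u hu c
    have he : ext u (⟨c.1, (Finset.mem_filter.1 c.1.2).1⟩, c.2) = u c := by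
      simp only [ext, c.1.2, dite_true]
    rw [iterate_shift_apply hT, sub_add_cancel, ← he]
    refine hgu (ext u) ⟨c.1, _⟩ c.2 ?_
    rw [he]
    exact hu c
  have key := le_of_mem_embeddingDims hd hε
    (((continuous_of_eq_shift hT).iterate (r * N)).comp (hg.comp hext)) fun u u' hu hu' c => ?_
  · rw [Fintype.card_prod, Fintype.card_coe, Fintype.card_fin] at key
    rw [mul_comm]
    refine (mul_le_mul_of_nonneg_right hr (Nat.cast_nonneg a)).trans ?_
    exact_mod_cast key
  · have hc := Finset.mem_filter.1 c.1.2
    have hc0 := (S.mem_holes.1 hc.1).1.1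
    have hN' : (0 : ℤ) < N := by exact_mod_cast hN
    have h1 := Int.mul_ediv_add_emod (c.1 : ℤ) N
    have h2 := Int.emod_nonneg (c.1 : ℤ) hN'.ne'
    have h3 := Int.emod_lt_of_pos (c.1 : ℤ) hN'
    have h4 : (c.1 : ℤ) / N = r := by
      have := Int.toNat_of_nonneg (Int.ediv_nonneg hc0 hN'.le)
      rw [hc.2] at this
      exact this.symm
    rw [h4] at h1
    have h := abs_sub_le_dynDist hT (n := (c.1 : ℤ) - (r * N : ℕ)) (N := N)
      (by push_cast; linarith) (by push_cast; linarith) (T^[r * N] (g (ext u)))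
      (T^[r * N] (g (ext u'))) c.2
    rwa [hcoord u hu, hcoord u' hu'] at h

theorem le_mdim (hσ : 0 ≤ σ) (hT : ∀ x, (T x : FullShift a) = shift (x : FullShift a)) :
    ((a * σ : ℝ) : EReal) ≤ mdim S.space T (subDist S.space) := by
  refine le_trans ?_ (limsup_le_limsup (u := fun _ => ((a * σ : ℝ) : EReal)) ?_)
  · rw [limsup_const]
  · filter_upwards [eventually_mem_Ioo] with ε hε
    obtain ⟨W, hW⟩ := exists_embeddingDim hσ hT hε.1
    refine le_liminf_coe (α := -a) fun N hN => ?_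
    have hN' : (0 : ℝ) < N := by exact_mod_cast hN
    obtain ⟨d, hd, -⟩ := hW 0 N
    have h := le_of_mem_embeddingDims_dynDist hT hε.2.le hN (Nat.sInf_mem ⟨d, hd⟩)
    rw [mul_div_cancel₀ _ hN'.ne']
    refine le_trans (le_of_eq ?_) h
    ring

end Toeplitz

end MeanDimensionLower

end

/-- For `0 ≤ s < a` there is a minimal closed subset `X ⊆ ([0,1]^a)^ℤ` with
`mdim(X, σ) = mdim_M(X, σ, D) = s` and such that any equivariant continuous map
`π : (X, σ) → (([0,1]^b)^ℤ, σ)` satisfies `lower-mdim_M(π, σ, D) ≥ s − b`. -/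
theorem stmt_5 (a : ℕ) (s : ℝ) (hs0 : 0 ≤ s) (hsa : s < a) :
    ∃ X : Set (FullShift a), X.Nonempty ∧ IsClosed X ∧ shift '' X = X ∧
      (∀ x ∈ X, X ⊆ closure {y : FullShift a | ∃ n : ℤ, y = fun k => x (k + n)}) ∧
      ∀ T : X → X, (∀ x : X, (T x : FullShift a) = shift (x : FullShift a)) →
        (mdim X T (fun x y : X => shiftDist (x : FullShift a) (y : FullShift a))
            = (s : EReal) ∧
          upperMdimM T (fun x y : X => shiftDist (x : FullShift a) (y : FullShift a))
            = (s : EReal) ∧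
          lowerMdimM T (fun x y : X => shiftDist (x : FullShift a) (y : FullShift a))
            = (s : EReal)) ∧
        ∀ (b : ℕ) (π : X → FullShift b), Continuous π → (∀ x, π (T x) = shift (π x)) →
          ((s - (b : ℝ) : ℝ) : EReal) ≤
            lowerCondMdimM π T
              (fun x y : X => shiftDist (x : FullShift a) (y : FullShift a)) := by
  have ha : (0 : ℝ) < a := hs0.trans_lt hsa
  have hσ : 0 ≤ s / a := div_nonneg hs0 ha.le
  have hs : (a : ℝ) * (s / a) = s := mul_div_cancel₀ _ ha.ne'
  obtain ⟨S⟩ := exists_toeplitz a hσ ((div_lt_one ha).2 hsa)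
  refine ⟨S.space, S.nonempty_space, S.isClosed_space, S.shift_image_space,
    fun x hx => S.space_subset_closure hx, fun T hT => ?_⟩
  have hs' : ((a * (s / a) : ℝ) : EReal) = s := by rw [hs]
  have hmdim := Toeplitz.mdim_le hσ hT
  have hupper := Toeplitz.upperMdimM_le hσ hT
  have hlower := Toeplitz.le_lowerMdimM (by exact_mod_cast ha) hσ hT
  have hle : lowerMdimM T (subDist S.space) ≤ upperMdimM T (subDist S.space) := liminf_le_limsup
  refine ⟨⟨?_, ?_, ?_⟩, fun b π hπ hπT => ?_⟩
  · exact le_antisymm (hmdim.trans_eq hs') (hs'.ge.trans (Toeplitz.le_mdim hσ hT))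
  · exact le_antisymm (hupper.trans_eq hs') (hs'.ge.trans (hlower.trans hle))
  · exact le_antisymm (hle.trans (hupper.trans_eq hs')) (hs'.ge.trans hlower)
  · have h := Toeplitz.le_lowerCondMdimM (by exact_mod_cast ha) hσ hT hπ hπT
    rwa [hs] at h
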